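/- Let $K$ be an algebraically closed field of characteristic $0$ that is complete with respect to a non-trivial (possibly non-archimedean) absolute value $|\cdot|$, and let $f\in K(z)$ be a rational function of degree $d>1$. Notation. Let $\|\cdot\|$ be the maximum norm (non-archimedean $K$) or the Euclidean norm $\sqrt{|p_0|^2+|p_1|^2}$ (archimedean $K$) on $K^2$, let $\pi:K^2\setminus\{0\}\to\mathbb{P}^1=\mathbb{P}^1(K)$ be the canonical projection, and put $(z_0,z_1)\wedge(w_0,w_1):=z_0w_1-z_1w_0$. The chordal metric on $\mathbb{P}^1$ is $[\pi(p),\pi(q)]:=|p\wedge q|/(\|p\|\,\|q\|)$. Let $\mathsf{P}^1$ be the Berkovich projective line over $K$ (equal to $\mathbb{P}^1$ if $K$ is archimedean), in which $\mathbb{P}^1$ is dense, let $[x,y]_{\mathrm{can}}:=\limsup_{\mathbb{P}^1\times\mathbb{P}^1\ni(z,w)\to(x,y)}[z,w]$ be the generalized Hsia kernel on $\mathsf{P}^1$, and let $\Omega_{\mathrm{can}}$ be the Dirac measure at the Gauss point (non-archimedean $K$) or the normalized Fubini–Study area element (archimedean $K$). Let $\Delta$ be the Laplacian on $\mathsf{P}^1$,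 normalized by $\Delta\log[\cdot,y]_{\mathrm{can}}=\delta_y-\Omega_{\mathrm{can}}$ for every $y\in\mathsf{P}^1$; thus, for a continuous $g$ and a probability Radon measure $\mu$ on $\mathsf{P}^1$, $\Delta g+\Omega_{\mathrm{can}}=\mu$ means that $g$ and $x\mapsto\int_{\mathsf{P}^1}\log[x,y]_{\mathrm{can}}\,d\mu(y)$ differ by a constant. A non-degenerate homogeneous lift of $f$ is a homogeneous polynomial endomorphism $F$ of $K^2$ of degree $d$ with $F^{-1}(0)=\{0\}$ and $\pi\circ F=f\circ\pi$ on $K^2\setminus\{0\}$. For such $F$ the functions $\log\|F^n\|-d^n\log\|\cdot\|$ descend to $\mathbb{P}^1$ and extend continuously to functions $T_{F^n}$ on $\mathsf{P}^1$; put $g_F:=\lim_{n\to\infty}T_{F^n}/d^n$ on $\mathsf{P}^1$. The equilibrium measure of $f$ is the probability Radon measure $\mu_f:=\Delta g_F+\Omega_{\mathrm{can}}$ on $\mathsf{P}^1$, which does not depend on $F$. The dynamical Green function $g_f$ of $f$ is the unique continuous function $g$ on $\mathsf{P}^1$ with $\Delta g+\Omega_{\mathrm{can}}=\mu_f$ and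 $$\sup_\nu\int_{\mathsf{P}^1\times\mathsf{P}^1}\bigl(\log[x,y]_{\mathrm{can}}-g(x)-g(y)\bigr)\,d(\nu\times\nu)(x,y)=0,$$ where $\nu$ ranges over all probability Radon measures on $\mathsf{P}^1$. Let $f^{\#}$ be the chordal derivative $f^{\#}(z)=\lim_{w\to z}[f(w),f(z)]/[w,z]$ on $\mathbb{P}^1$, extended continuously to $\mathsf{P}^1$, and let $L(f):=\int_{\mathsf{P}^1}\log(f^{\#})\,d\mu_f$ be the Lyapunov exponent of $f$. Statement. Let $F$ be a non-degenerate homogeneous lift of $f$ with $g_F=g_f$ on $\mathsf{P}^1$, let $C_1^F,\dots,C_{2d-2}^F\in K^2\setminus\{0\}$ satisfy $$\det DF(p)=\prod_{j=1}^{2d-2}\bigl(p\wedge C_j^F\bigr)\qquad\text{for all }p\in K^2,$$ and put $c_j:=\pi(C_j^F)$. Then $\log(f^{\#})$ is $\mu_f$-integrable and $$L(f)=-\log|d|+\sum_{j=1}^{2d-2}\bigl(g_f(c_j)+\log\|C_j^F\|\bigr).$$ -/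

import Mathlib

open Filter Topology MeasureTheory
open scoped ENNReal Polynomial

noncomputable section

namespace BerkovichLine

variable {K : Type*}

/-! ### The plane `K²` and the classical projective line `ℙ¹ = ℙ¹(K)` -/

/-- The classical projective line `ℙ¹(K)`; the canonical projection `π : K² \ {0} → ℙ¹` is
`Projectivization.mk K`. The affine coordinate of `π (v₀, v₁)` is `v₀ / v₁`. -/
abbrev P1 (K : Type*) [Field K] : Type _ := Projectivization K (Fin 2 → K)

open Classical in
/-- The norm on `K²`: the maximum norm for non-archimedean `K`, the Euclidean norm for
archimedean `K`. -/
def norm2 [NormedField K] (v : Fin 2 → K) : ℝ :=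
  if IsUltrametricDist K then max ‖v 0‖ ‖v 1‖ else Real.sqrt (‖v 0‖ ^ 2 + ‖v 1‖ ^ 2)

/-- The wedge product `(z₀, z₁) ∧ (w₀, w₁) = z₀ w₁ - z₁ w₀`. -/
def wedge [Field K] (v w : Fin 2 → K) : K := v 0 * w 1 - v 1 * w 0

/-- The normalized chordal metric `[z, w] = |p ∧ q| / (‖p‖ ‖q‖)`, `p ∈ π⁻¹(z)`, `q ∈ π⁻¹(w)`.
The value does not depend on the representatives. -/
def chordal [NormedField K] (z w : P1 K) : ℝ :=
  ‖wedge z.rep w.rep‖ / (norm2 z.rep * norm2 w.rep)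

/-! ### The Berkovich projective line `𝖯¹ = 𝖯¹(K)` -/

/-- The Berkovich affine line: the multiplicative seminorms on `K[X]` that extend the absolute
value of `K`. -/
def BerkA1 (K : Type*) [NormedField K] : Type _ :=
  {x : MulRingSeminorm K[X] // ∀ a : K, x (Polynomial.C a) = ‖a‖}

/-- The topology of pointwise convergence on `K[X]`. -/
instance [NormedField K] : TopologicalSpace (BerkA1 K) :=
  TopologicalSpace.induced (fun x (p : K[X]) => x.1 p) inferInstance

/-- The Berkovich projective line: the one-point compactification of the Berkovich affine
line. (For archimedean `K` it is the Riemann sphere, every multiplicative seminorm as above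
being the evaluation at a point of `K`.) -/
abbrev BerkP1 (K : Type*) [NormedField K] : Type _ := OnePoint (BerkA1 K)

instance [NormedField K] : MeasurableSpace (BerkP1 K) := borel _

instance [NormedField K] : BorelSpace (BerkP1 K) := ⟨rfl⟩

/-- The classical point `z ∈ K`, i.e. the seminorm `p ↦ |p(z)|`. -/
def evalPoint [NormedField K] (z : K) : BerkA1 K :=
  ⟨{ toFun := fun p => ‖p.eval z‖
     map_zero' := by simp
     add_le' := fun p q => by simpa using norm_add_le (p.eval z) (q.eval z)
     neg' := fun p => by simp
     map_one' := by simp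
     map_mul' := fun p q => by simp },
   fun a => by
    change ‖(Polynomial.C a).eval z‖ = ‖a‖
    simp⟩

open Classical in
/-- The embedding `ℙ¹ → 𝖯¹`. -/
def toBerk [NormedField K] (z : P1 K) : BerkP1 K :=
  if z.rep 1 = 0 then OnePoint.infty else OnePoint.some (evalPoint (z.rep 0 / z.rep 1))

/-- The continuous extension to `𝖯¹` of a real function on the dense subset `ℙ¹`. -/
def extendBerk [NormedField K] (φ : P1 K → ℝ) (x : BerkP1 K) : ℝ :=
  limUnder (comap toBerk (𝓝 x)) φ

/-- The canonical (Gauss) point, for non-archimedean `K`: the Gauss norm on `K[X]`. -/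
def gaussPoint [NormedField K] [IsUltrametricDist K] : BerkA1 K :=
  have hna : IsNonarchimedean (NormedField.toAbsoluteValue K) :=
    fun x y => IsUltrametricDist.norm_add_le_max x y
  ⟨{ toFun := fun p => p.gaussNorm (NormedField.toAbsoluteValue K) 1
     map_zero' := by simp
     add_le' := fun p q =>
      (Polynomial.isNonarchimedean_gaussNorm _ hna zero_le_one p q).trans
        (max_le_add_of_nonneg (p.gaussNorm_nonneg _ zero_le_one)
          (q.gaussNorm_nonneg _ zero_le_one))
     neg' := fun p => by
      simp only [Polynomial.gaussNorm, Polynomial.support_neg, Polynomial.coeff_neg,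
        AbsoluteValue.map_neg]
     map_one' := by
      rw [← Polynomial.C_1, Polynomial.gaussNorm_C]
      simp
     map_mul' := fun p q => Polynomial.gaussNorm_mul hna zero_lt_one p q },
   fun a => by
    change (Polynomial.C a).gaussNorm (NormedField.toAbsoluteValue K) 1 = ‖a‖
    rw [Polynomial.gaussNorm_C]
    rfl⟩

/-! ### Potential theory on `𝖯¹` -/

/-- The generalized Hsia kernel `[x, y]_can` with respect to the canonical point, i.e. the upper
semicontinuous extension `limsup_{ℙ¹ × ℙ¹ ∋ (z, w) → (x, y)} [z, w]` of the chordal metric. (For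
archimedean `K` it is the chordal metric itself.) -/
def hsia [NormedField K] (x y : BerkP1 K) : ℝ :=
  limsup (fun p : P1 K × P1 K => chordal p.1 p.2) (comap (Prod.map toBerk toBerk) (𝓝 (x, y)))

open Classical in
/-- `-log [x, y]_can ∈ [0, ∞]`; recall that `0 ≤ [x, y]_can ≤ 1`. -/
def negLogHsia [NormedField K] (x y : BerkP1 K) : ℝ≥0∞ :=
  if hsia x y = 0 then ⊤ else ENNReal.ofReal (-Real.log (hsia x y))

/-- The logarithmic potential `x ↦ ∫ log [x, y]_can dμ(y) ∈ [-∞, 0]` of `μ`. -/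
def logPotential [NormedField K] (μ : Measure (BerkP1 K)) (x : BerkP1 K) : EReal :=
  -((∫⁻ y, negLogHsia x y ∂μ : ℝ≥0∞) : EReal)

/-- `ν` is the normalized Fubini–Study area element of `K` (archimedean `K`): the probability
measure on `K` that is invariant under rotations and gives mass `r² / (1 + r²)` to the disc of
radius `r` about the origin. For `K = ℂ` its density with
respect to the Lebesgue measure is proportional to `(1 + |z|²)⁻²`. -/
def IsFubiniStudy [NormedField K] [MeasurableSpace K] (ν : Measure K) : Prop :=
  IsProbabilityMeasure ν ∧ (∀ u : K, ‖u‖ = 1 → ν.map (fun z => u * z) = ν) ∧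
    ∀ r : ℝ, 0 ≤ r → ν (Metric.closedBall 0 r) = ENNReal.ofReal (r ^ 2 / (1 + r ^ 2))

open Classical in
/-- The measure `Ω_can` on `𝖯¹`: the Dirac measure at the canonical point for non-archimedean
`K`, the normalized Fubini–Study area element for archimedean `K`. -/
def canonicalMeasure (K : Type*) [NormedField K] : Measure (BerkP1 K) :=
  letI : MeasurableSpace K := borel K
  if _h : IsUltrametricDist K then
    Measure.dirac (OnePoint.some (gaussPoint (K := K)))
  else if h : ∃ ν : Measure K, IsFubiniStudy ν then
    h.choose.map (fun z => (OnePoint.some (evalPoint z) : BerkP1 K))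
  else 0

/-- `Δ g = μ - ν`, for measures `μ`, `ν` of equal mass. The Laplacian `Δ` on `𝖯¹` is the inverse,
modulo constants, of the operator that maps a measure to its logarithmic potential; as the
potential of `Ω_can` is constant, it is normalized by `Δ log [·, y]_can = δ_y - Ω_can`. -/
def HasLaplacian [NormedField K] (g : BerkP1 K → ℝ) (μ ν : Measure (BerkP1 K)) : Prop :=
  μ Set.univ = ν Set.univ ∧
    ∃ c : ℝ, ∀ x, (g x : EReal) + logPotential ν x = logPotential μ x + (c : EReal)

/-- `g` is a continuous weight on `𝖯¹` with `μ^g = Δ g + Ω_can` equal to `μ`: the function `g` is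
continuous, and `μ` is a probability Radon measure. -/
def IsContinuousWeight [NormedField K] (g : BerkP1 K → ℝ) (μ : Measure (BerkP1 K)) : Prop :=
  Continuous g ∧ IsProbabilityMeasure μ ∧ μ.Regular ∧ HasLaplacian g μ (canonicalMeasure K)

/-- The energy `∫∫ Φ_g d(ν × ν)`, where `Φ_g(x, y) = log [x, y]_can - g(x) - g(y)`, of a
probability measure `ν`, with values in `[-∞, ∞)`. -/
def energy [NormedField K] (g : BerkP1 K → ℝ) (ν : Measure (BerkP1 K)) : EReal :=
  -((∫⁻ x, ∫⁻ y, negLogHsia x y ∂ν ∂ν : ℝ≥0∞) : EReal) - ((2 * ∫ x, g x ∂ν : ℝ) : EReal)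

/-- The `g`-equilibrium energy `V_g` of `𝖯¹`: the supremum of the energies of all probability
Radon measures. -/
def equilibriumEnergy [NormedField K] (g : BerkP1 K → ℝ) : EReal :=
  ⨆ ν ∈ {ν : Measure (BerkP1 K) | IsProbabilityMeasure ν ∧ ν.Regular}, energy g ν

/-! ### Rational functions, their lifts, and their dynamics -/

/-- The degree of a rational function. -/
def ratDegree [Field K] (f : RatFunc K) : ℕ := max f.num.natDegree f.denom.natDegree

/-- The numerator and the denominator of `f`, homogenized in degree `deg f`, as a map `K² → K²`. -/
def homogMap [Field K] (f : RatFunc K) (v : Fin 2 → K) : Fin 2 → K :=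
  ![MvPolynomial.eval v (f.num.homogenize (ratDegree f)),
    MvPolynomial.eval v (f.denom.homogenize (ratDegree f))]

lemma eval_homogenize [Field K] (p : K[X]) (n : ℕ) (v : Fin 2 → K) :
    MvPolynomial.eval v (p.homogenize n) =
      ∑ i ∈ Finset.range (n + 1), p.coeff i * (v 0 ^ i * v 1 ^ (n - i)) := by
  have h := Finset.Nat.sum_antidiagonal_eq_sum_range_succ
    (fun i j => p.coeff i * (v 0 ^ i * v 1 ^ j)) n
  rw [← Nat.succ_eq_add_one, ← h, Polynomial.homogenize, map_sum]
  refine Finset.sum_congr rfl fun ij _ => ?_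
  rw [MvPolynomial.eval_monomial, Finsupp.prod_fintype _ _ (by simp)]
  simp [Fin.prod_univ_two]

lemma eval_homogenize_of_ne [Field K] {p : K[X]} {n : ℕ} (hn : p.natDegree ≤ n)
    {v : Fin 2 → K} (hv : v 1 ≠ 0) :
    MvPolynomial.eval v (p.homogenize n) = v 1 ^ n * p.eval (v 0 / v 1) := by
  rw [eval_homogenize, Polynomial.eval_eq_sum_range' (Nat.lt_succ_of_le hn), Finset.mul_sum]
  refine Finset.sum_congr rfl fun i hi => ?_
  have hi' : i ≤ n := Nat.lt_succ_iff.1 (Finset.mem_range.1 hi)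
  have h : v 1 ^ n = v 1 ^ (n - i) * v 1 ^ i := by rw [← pow_add, Nat.sub_add_cancel hi']
  rw [h, div_pow]
  field_simp

lemma eval_homogenize_of_eq [Field K] (p : K[X]) (n : ℕ) {v : Fin 2 → K} (hv : v 1 = 0) :
    MvPolynomial.eval v (p.homogenize n) = p.coeff n * v 0 ^ n := by
  rw [eval_homogenize, Finset.sum_range_succ, Finset.sum_eq_zero]
  · simp
  · intro i hi
    have : n - i ≠ 0 := Nat.sub_ne_zero_of_lt (Finset.mem_range.1 hi)
    simp [hv, this]

lemma homogMap_ne_zero [Field K] (f : RatFunc K) {v : Fin 2 → K} (hv : v ≠ 0) :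
    homogMap f v ≠ 0 := by
  intro h
  have h0 : MvPolynomial.eval v (f.num.homogenize (ratDegree f)) = 0 := congrFun h 0
  have h1 : MvPolynomial.eval v (f.denom.homogenize (ratDegree f)) = 0 := congrFun h 1
  by_cases hv1 : v 1 = 0
  · have hv0 : v 0 ≠ 0 := by
      intro hv0
      apply hv
      ext i
      fin_cases i
      · exact hv0
      · exact hv1
    rw [eval_homogenize_of_eq _ _ hv1] at h0 h1
    have h0' := (mul_eq_zero.1 h0).resolve_right (pow_ne_zero _ hv0)
    have h1' := (mul_eq_zero.1 h1).resolve_right (pow_ne_zero _ hv0)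
    have hd : f.denom.natDegree ≠ ratDegree f := by
      intro e
      rw [← e] at h1'
      exact f.denom_ne_zero (Polynomial.leadingCoeff_eq_zero.1 h1')
    have hn : f.num.natDegree = ratDegree f := by
      unfold ratDegree at hd ⊢
      omega
    rw [← hn] at h0'
    have hz : f.num = 0 := Polynomial.leadingCoeff_eq_zero.1 h0'
    apply hd
    rw [← hn, RatFunc.num_eq_zero_iff.1 hz]
    simp
  · have hn : f.num.natDegree ≤ ratDegree f := le_max_left _ _
    have hd : f.denom.natDegree ≤ ratDegree f := le_max_right _ _
    rw [eval_homogenize_of_ne hn hv1] at h0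
    rw [eval_homogenize_of_ne hd hv1] at h1
    have h0' := (mul_eq_zero.1 h0).resolve_left (pow_ne_zero _ hv1)
    have h1' := (mul_eq_zero.1 h1).resolve_left (pow_ne_zero _ hv1)
    obtain ⟨a, b, hab⟩ := f.isCoprime_num_denom
    have := congrArg (Polynomial.eval (v 0 / v 1)) hab
    simp [h0', h1'] at this

/-- The self-map of `ℙ¹` given by the rational function `f`. -/
def ratMap [Field K] (f : RatFunc K) (z : P1 K) : P1 K :=
  Projectivization.mk K (homogMap f z.rep) (homogMap_ne_zero f z.rep_nonzero)

/-- A non-degenerate homogeneous lift `F = (F₀, F₁)` of `f`: a homogeneous polynomial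
endomorphism of `K²` of degree `deg f` with `F⁻¹(0) = {0}` and `π ∘ F = f ∘ π`. -/
structure HomogeneousLift [Field K] (f : RatFunc K) where
  /-- the components of `F` -/
  poly : Fin 2 → MvPolynomial (Fin 2) K
  isHomogeneous : ∀ i, (poly i).IsHomogeneous (ratDegree f)
  nondegenerate : ∀ v : Fin 2 → K, v ≠ 0 → (fun i => MvPolynomial.eval v (poly i)) ≠ 0
  lifts : ∀ (v : Fin 2 → K) (hv : v ≠ 0),
    Projectivization.mk K (fun i => MvPolynomial.eval v (poly i)) (nondegenerate v hv) =
      ratMap f (Projectivization.mk K v hv)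

namespace HomogeneousLift

/-- `F` as a map `K² → K²`. -/
def toMap [Field K] {f : RatFunc K} (F : HomogeneousLift f) (v : Fin 2 → K) : Fin 2 → K :=
  fun i => MvPolynomial.eval v (F.poly i)

/-- The Jacobian determinant `det DF` at `v`. -/
def jacobianDet [Field K] {f : RatFunc K} (F : HomogeneousLift f) (v : Fin 2 → K) : K :=
  (Matrix.of fun i j => MvPolynomial.eval v (MvPolynomial.pderiv j (F.poly i))).det

/-- The function `T_{Fⁿ} = log ‖Fⁿ‖ - dⁿ log ‖·‖`, which descends to `ℙ¹`, extended continuously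
to `𝖯¹`. -/
def T [NormedField K] {f : RatFunc K} (F : HomogeneousLift f) (n : ℕ) : BerkP1 K → ℝ :=
  extendBerk fun z =>
    Real.log (norm2 (F.toMap^[n] z.rep)) - (ratDegree f : ℝ) ^ n * Real.log (norm2 z.rep)

/-- The function `g_F = lim_{n → ∞} T_{Fⁿ} / dⁿ` on `𝖯¹`. -/
def green [NormedField K] {f : RatFunc K} (F : HomogeneousLift f) (x : BerkP1 K) : ℝ :=
  limUnder atTop fun n : ℕ => F.T n x / (ratDegree f : ℝ) ^ n

end HomogeneousLift

open Classical in
/-- The equilibrium measure `μ_f = Δ g_F + Ω_can` of `f`, where `F` is any non-degenerate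
homogeneous lift of `f`. -/
def equilibriumMeasure [NormedField K] (f : RatFunc K) : Measure (BerkP1 K) :=
  if h : ∃ μ : Measure (BerkP1 K), ∃ F : HomogeneousLift f, IsContinuousWeight F.green μ
  then h.choose else 0

/-- `g` is the dynamical Green function `g_f` of `f` on `𝖯¹`, i.e. the unique continuous weight
on `𝖯¹` with `Δ g + Ω_can = μ_f` that is normalized by `V_g = 0`. -/
def IsDynamicalGreenFunction [NormedField K] (f : RatFunc K) (g : BerkP1 K → ℝ) : Prop :=
  IsContinuousWeight g (equilibriumMeasure f) ∧ equilibriumEnergy g = 0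

/-- The chordal derivative `f^#(z) = lim_{w → z} [f(w), f(z)] / [w, z]` on `ℙ¹`; the limit is
taken along `w ≠ z` in the topology of the chordal metric. -/
def chordalDeriv [NormedField K] (f : RatFunc K) (z : P1 K) : ℝ :=
  limUnder (comap (fun w => chordal w z) (𝓝[>] 0))
    fun w => chordal (ratMap f w) (ratMap f z) / chordal w z

/-- The chordal derivative `f^#`, extended continuously to `𝖯¹`. -/
def chordalDerivBerk [NormedField K] (f : RatFunc K) : BerkP1 K → ℝ :=
  extendBerk (chordalDeriv f)

/-- The Lyapunov exponent `L(f) = ∫ log (f^#) dμ_f`. -/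
def lyapunov [NormedField K] (f : RatFunc K) : ℝ :=
  ∫ x, Real.log (chordalDerivBerk f x) ∂(equilibriumMeasure f)

end BerkovichLine

end

open Filter Topology MeasureTheory
open scoped ENNReal Polynomial
noncomputable section
namespace BerkovichLine

set_option linter.unusedSectionVars false

variable {K : Type*}

/-! ### The plane and the chordal metric -/

section Plane

variable [NormedField K]

lemma norm2_nonneg (v : Fin 2 → K) : 0 ≤ norm2 v := by
  unfold norm2
  split_ifs
  · exact le_max_of_le_left (norm_nonneg _)
  · exact Real.sqrt_nonneg _

lemma norm_apply_le_norm2 (v : Fin 2 → K) (i : Fin 2) : ‖v i‖ ≤ norm2 v := by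
  unfold norm2
  split_ifs
  · fin_cases i
    · exact le_max_left _ _
    · exact le_max_right _ _
  · apply Real.le_sqrt_of_sq_le
    fin_cases i
    · simp
    · simp

lemma norm_le_norm2 (v : Fin 2 → K) : ‖v‖ ≤ norm2 v :=
  (pi_norm_le_iff_of_nonneg (norm2_nonneg v)).2 (norm_apply_le_norm2 v)

lemma norm2_le_two_mul_norm (v : Fin 2 → K) : norm2 v ≤ 2 * ‖v‖ := by
  have h0 := norm_le_pi_norm v 0
  have h1 := norm_le_pi_norm v 1
  have hn := norm_nonneg v
  unfold norm2
  split_ifs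
  · exact max_le (by linarith) (by linarith)
  · apply Real.sqrt_le_iff.2 ⟨by positivity, ?_⟩
    nlinarith [norm_nonneg (v 0), norm_nonneg (v 1)]

lemma norm2_pos {v : Fin 2 → K} (hv : v ≠ 0) : 0 < norm2 v :=
  (norm_pos_iff.2 hv).trans_le (norm_le_norm2 v)

lemma norm2_smul (c : K) (v : Fin 2 → K) : norm2 (c • v) = ‖c‖ * norm2 v := by
  unfold norm2
  split_ifs
  · simp [mul_max_of_nonneg]
  · simp only [Pi.smul_apply, smul_eq_mul, norm_mul, mul_pow, ← mul_add]
    rw [Real.sqrt_mul (by positivity), Real.sqrt_sq (norm_nonneg c)]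

lemma continuous_norm2 : Continuous (norm2 : (Fin 2 → K) → ℝ) := by
  unfold norm2
  split_ifs <;> fun_prop

lemma wedge_swap (v w : Fin 2 → K) : wedge w v = -wedge v w := by
  simp only [wedge]; ring

lemma wedge_self (v : Fin 2 → K) : wedge v v = 0 := by
  simp only [wedge]; ring

lemma wedge_smul_left (c : K) (v w : Fin 2 → K) : wedge (c • v) w = c * wedge v w := by
  simp only [wedge, Pi.smul_apply, smul_eq_mul]; ring

lemma wedge_smul_right (c : K) (v w : Fin 2 → K) : wedge v (c • w) = c * wedge v w := by
  simp only [wedge, Pi.smul_apply, smul_eq_mul]; ring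

lemma norm_wedge_swap (v w : Fin 2 → K) : ‖wedge w v‖ = ‖wedge v w‖ := by
  rw [wedge_swap, norm_neg]

lemma continuous_wedge : Continuous fun p : (Fin 2 → K) × (Fin 2 → K) => wedge p.1 p.2 := by
  unfold wedge; fun_prop

lemma norm_wedge_le (v w : Fin 2 → K) : ‖wedge v w‖ ≤ norm2 v * norm2 w := by
  by_cases h : IsUltrametricDist K
  · have key : ‖wedge v w‖ ≤ max ‖v 0 * w 1‖ ‖v 1 * w 0‖ := by
      have := IsUltrametricDist.norm_add_le_max (v 0 * w 1) (-(v 1 * w 0))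
      simpa only [wedge, sub_eq_add_neg, norm_neg] using this
    refine key.trans (max_le ?_ ?_) <;> rw [norm_mul] <;>
      exact mul_le_mul (norm_apply_le_norm2 _ _) (norm_apply_le_norm2 _ _) (norm_nonneg _)
        (norm2_nonneg _)
  · have key : ‖wedge v w‖ ≤ ‖v 0‖ * ‖w 1‖ + ‖v 1‖ * ‖w 0‖ := by
      rw [wedge, ← norm_mul, ← norm_mul]
      exact norm_sub_le _ _
    refine key.trans ?_
    simp only [norm2, h, if_false]
    rw [← Real.sqrt_mul (by positivity)]
    apply Real.le_sqrt_of_sq_le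
    nlinarith [sq_nonneg (‖v 0‖ * ‖w 0‖ - ‖v 1‖ * ‖w 1‖)]

lemma exists_smul_eq_of_wedge_eq_zero {v w : Fin 2 → K} (hw : w ≠ 0) (h : wedge v w = 0) :
    ∃ c : K, v = c • w := by
  simp only [wedge] at h
  by_cases h0 : w 0 = 0
  · have h1 : w 1 ≠ 0 := fun h1 => hw (by ext i; fin_cases i <;> simp [h0, h1])
    refine ⟨v 1 / w 1, ?_⟩
    ext i
    fin_cases i
    · have : v 0 = 0 := by simpa [h0, h1] using h
      simp [this, h0]
    · simp [h1]
  · refine ⟨v 0 / w 0, ?_⟩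
    ext i
    fin_cases i
    · simp [h0]
    · simp only [Fin.mk_one, Pi.smul_apply, smul_eq_mul]
      field_simp
      linear_combination -h

/-- The chordal distance in terms of arbitrary representatives. -/
lemma chordal_mk {v w : Fin 2 → K} (hv : v ≠ 0) (hw : w ≠ 0) :
    chordal (Projectivization.mk K v hv) (Projectivization.mk K w hw) =
      ‖wedge v w‖ / (norm2 v * norm2 w) := by
  obtain ⟨a, ha⟩ := Projectivization.exists_smul_eq_mk_rep K v hv
  obtain ⟨b, hb⟩ := Projectivization.exists_smul_eq_mk_rep K w hw
  have ha0 : ‖(a : K)‖ ≠ 0 := norm_ne_zero_iff.2 a.ne_zero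
  have hb0 : ‖(b : K)‖ ≠ 0 := norm_ne_zero_iff.2 b.ne_zero
  rw [chordal, ← ha, ← hb, Units.smul_def, Units.smul_def, wedge_smul_left, wedge_smul_right,
    norm2_smul, norm2_smul, norm_mul, norm_mul]
  have := norm2_pos hv
  have := norm2_pos hw
  field_simp

lemma chordal_mk_right (z : P1 K) {w : Fin 2 → K} (hw : w ≠ 0) :
    chordal z (Projectivization.mk K w hw) = ‖wedge z.rep w‖ / (norm2 z.rep * norm2 w) := by
  conv_lhs => rw [← z.mk_rep]
  exact chordal_mk _ _

lemma chordal_nonneg (z w : P1 K) : 0 ≤ chordal z w :=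
  div_nonneg (norm_nonneg _) (mul_nonneg (norm2_nonneg _) (norm2_nonneg _))

lemma chordal_le_one (z w : P1 K) : chordal z w ≤ 1 :=
  div_le_one_of_le₀ (norm_wedge_le _ _) (mul_nonneg (norm2_nonneg _) (norm2_nonneg _))

lemma chordal_comm (z w : P1 K) : chordal z w = chordal w z := by
  rw [chordal, chordal, norm_wedge_swap, mul_comm]

lemma affine_ne_zero (t : K) : (![t, 1] : Fin 2 → K) ≠ 0 := fun h => by
  simpa using congrFun h 1

lemma coaffine_ne_zero (t : K) : (![1, t] : Fin 2 → K) ≠ 0 := fun h => by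
  simpa using congrFun h 0

/-- The point of `ℙ¹` with affine coordinate `t`. -/
def ofAffine (t : K) : P1 K := Projectivization.mk K ![t, 1] (affine_ne_zero t)

/-- The point at infinity of `ℙ¹`. -/
def inftyPt : P1 K := Projectivization.mk K ![1, 0] (coaffine_ne_zero 0)

lemma mk_eq_ofAffine {v : Fin 2 → K} (hv : v ≠ 0) (h : v 1 ≠ 0) :
    Projectivization.mk K v hv = ofAffine (v 0 / v 1) := by
  rw [ofAffine, Projectivization.mk_eq_mk_iff']
  refine ⟨v 1, ?_⟩
  ext i
  fin_cases i
  · simp [mul_div_cancel₀ _ h]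
  · simp

lemma mk_eq_inftyPt {v : Fin 2 → K} (hv : v ≠ 0) (h : v 1 = 0) :
    Projectivization.mk K v hv = inftyPt := by
  rw [inftyPt, Projectivization.mk_eq_mk_iff']
  refine ⟨v 0, ?_⟩
  ext i
  fin_cases i
  · simp
  · simp [h]

lemma ofAffine_or_inftyPt (z : P1 K) : (∃ t, z = ofAffine t) ∨ z = inftyPt := by
  by_cases h : z.rep 1 = 0
  · right
    conv_lhs => rw [← z.mk_rep]
    exact mk_eq_inftyPt _ h
  · left
    refine ⟨z.rep 0 / z.rep 1, ?_⟩
    conv_lhs => rw [← z.mk_rep]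
    exact mk_eq_ofAffine _ h

lemma toBerk_ofAffine (t : K) :
    toBerk (ofAffine t) = OnePoint.some (evalPoint t) := by
  obtain ⟨a, ha⟩ := Projectivization.exists_smul_eq_mk_rep K ![t, 1] (affine_ne_zero t)
  have h1 : (ofAffine t).rep 1 = a := by rw [ofAffine, ← ha]; simp [Units.smul_def]
  have h0 : (ofAffine t).rep 0 = a * t := by rw [ofAffine, ← ha]; simp [Units.smul_def]
  rw [toBerk, if_neg (by rw [h1]; exact a.ne_zero), h0, h1, mul_div_cancel_left₀ _ a.ne_zero]

lemma toBerk_inftyPt : toBerk (inftyPt : P1 K) = OnePoint.infty := by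
  obtain ⟨a, ha⟩ := Projectivization.exists_smul_eq_mk_rep K ![1, 0] (coaffine_ne_zero (0 : K))
  have h1 : (inftyPt : P1 K).rep 1 = 0 := by rw [inftyPt, ← ha]; simp
  rw [toBerk, if_pos h1]

lemma chordal_ofAffine (s t : K) :
    chordal (ofAffine s) (ofAffine t) = ‖s - t‖ / (norm2 ![s, 1] * norm2 ![t, 1]) := by
  rw [ofAffine, ofAffine, chordal_mk]
  simp [wedge]

lemma chordal_ofAffine_inftyPt (s : K) :
    chordal (ofAffine s) inftyPt = 1 / norm2 ![s, 1] := by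
  have h : norm2 (![1, 0] : Fin 2 → K) = 1 := by
    unfold norm2
    split_ifs <;> simp
  rw [ofAffine, inftyPt, chordal_mk, h]
  simp [wedge]

end Plane

/-! ### Topology of the Berkovich line -/

section Topology

variable [NormedField K]

lemma BerkA1.continuous_apply (p : K[X]) : Continuous fun x : BerkA1 K => x.1 p :=
  (_root_.continuous_apply p).comp continuous_induced_dom

instance : T2Space (BerkA1 K) := by
  refine T2Space.of_injective_continuous (f := fun (x : BerkA1 K) (p : K[X]) => x.1 p) ?_
    continuous_induced_dom
  intro x y h
  exact Subtype.ext (DFunLike.coe_injective h)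

lemma BerkA1.apply_nonneg (x : BerkA1 K) (p : K[X]) : 0 ≤ x.1 p := NonnegHomClass.apply_nonneg x.1 p

lemma BerkA1.apply_le (x : BerkA1 K) (p : K[X]) {R : ℝ} (hR : x.1 Polynomial.X ≤ R) :
    x.1 p ≤ ∑ i ∈ p.support, ‖p.coeff i‖ * R ^ i := by
  have h : x.1 (∑ i ∈ p.support, Polynomial.C (p.coeff i) * Polynomial.X ^ i) ≤
      ∑ i ∈ p.support, x.1 (Polynomial.C (p.coeff i) * Polynomial.X ^ i) := by
    refine Finset.le_sum_of_subadditive _ (map_zero x.1).le (fun a b => map_add_le_add x.1 a b) _ _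
  conv_lhs => rw [p.as_sum_support_C_mul_X_pow]
  refine h.trans (Finset.sum_le_sum fun i _ => ?_)
  rw [map_mul, map_pow, x.2]
  gcongr

lemma BerkA1.isCompact_setOf_apply_X_le (R : ℝ) :
    IsCompact {x : BerkA1 K | x.1 Polynomial.X ≤ R} := by
  have hind : IsInducing (fun (x : BerkA1 K) (p : K[X]) => x.1 p) := ⟨rfl⟩
  rw [hind.isCompact_iff]
  refine IsCompact.of_isClosed_subset (isCompact_univ_pi fun p : K[X] =>
    isCompact_Icc (a := (0 : ℝ)) (b := ∑ i ∈ p.support, ‖p.coeff i‖ * R ^ i)) ?_ ?_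
  · have : (fun (x : BerkA1 K) (p : K[X]) => x.1 p) '' {x : BerkA1 K | x.1 Polynomial.X ≤ R} =
        {u : K[X] → ℝ | u 0 = 0 ∧ (∀ p q, u (p + q) ≤ u p + u q) ∧ (∀ p, u (-p) = u p) ∧
          u 1 = 1 ∧ (∀ p q, u (p * q) = u p * u q) ∧ (∀ a, u (Polynomial.C a) = ‖a‖) ∧
          u Polynomial.X ≤ R} := by
      ext u
      constructor
      · rintro ⟨x, hx, rfl⟩
        exact ⟨map_zero x.1, map_add_le_add x.1, map_neg_eq_map x.1, map_one x.1, map_mul x.1,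
          x.2, hx⟩
      · rintro ⟨h0, hadd, hneg, h1, hmul, hC, hX⟩
        exact ⟨⟨{ toFun := u
                  map_zero' := h0
                  add_le' := hadd
                  neg' := hneg
                  map_one' := h1
                  map_mul' := hmul }, hC⟩, hX, rfl⟩
    rw [this]
    have c : ∀ p : K[X], Continuous fun u : K[X] → ℝ => u p := fun p => _root_.continuous_apply p
    simp only [Set.ofPred_and, Set.ofPred_forall]
    refine (isClosed_eq (c _) continuous_const).inter <|
      (isClosed_iInter fun p => isClosed_iInter fun q =>
        isClosed_le (c _) ((c _).add (c _))).inter <|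
      (isClosed_iInter fun p => isClosed_eq (c _) (c _)).inter <|
      (isClosed_eq (c _) continuous_const).inter <|
      (isClosed_iInter fun p => isClosed_iInter fun q =>
        isClosed_eq (c _) ((c _).mul (c _))).inter <|
      (isClosed_iInter fun a => isClosed_eq (c _) continuous_const).inter <|
      isClosed_le (c _) continuous_const
  · rintro _ ⟨x, hx, rfl⟩ p -
    exact ⟨x.apply_nonneg p, x.apply_le p hx⟩

/-- The trace on `ℙ¹` of the neighbourhood filter of a point of `𝖯¹`. -/
def trace (x : BerkP1 K) : Filter (P1 K) := comap toBerk (𝓝 x)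

lemma tendsto_toBerk_trace (x : BerkP1 K) : Tendsto toBerk (trace x) (𝓝 x) := tendsto_comap

lemma pure_le_trace (z : P1 K) : pure z ≤ trace (toBerk z) := by
  rw [trace, ← map_le_iff_le_comap, map_pure]
  exact pure_le_nhds _

instance trace_toBerk_neBot (z : P1 K) : (trace (toBerk z)).NeBot :=
  NeBot.mono inferInstance (pure_le_trace z)

/-- Affine coordinate, with junk value `0` at infinity. -/
def affineCoord (z : P1 K) : K := z.rep 0 / z.rep 1

lemma toBerk_of_rep_ne {z : P1 K} (h : z.rep 1 ≠ 0) :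
    toBerk z = OnePoint.some (evalPoint (affineCoord z)) := by
  rw [toBerk, if_neg h, affineCoord]

lemma eq_ofAffine_of_rep_ne {z : P1 K} (h : z.rep 1 ≠ 0) : z = ofAffine (affineCoord z) := by
  conv_lhs => rw [← z.mk_rep]
  exact mk_eq_ofAffine _ h

lemma eventually_rep_ne (x : BerkA1 K) : ∀ᶠ z in trace (OnePoint.some x), z.rep 1 ≠ 0 := by
  have h : ∀ᶠ y in 𝓝 (OnePoint.some x : BerkP1 K), y ∈ Set.range (OnePoint.some : BerkA1 K → _) :=
    OnePoint.isOpen_range_coe.mem_nhds ⟨x, rfl⟩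
  filter_upwards [(tendsto_toBerk_trace _).eventually h] with z hz hz1
  rw [toBerk, if_pos hz1] at hz
  exact OnePoint.infty_notMem_range_coe hz

lemma tendsto_eval_trace (x : BerkA1 K) (p : K[X]) :
    Tendsto (fun z => ‖p.eval (affineCoord z)‖) (trace (OnePoint.some x)) (𝓝 (x.1 p)) := by
  have hc : ContinuousAt (fun y : BerkP1 K => y.elim 0 (fun x : BerkA1 K => x.1 p))
      (OnePoint.some x) :=
    OnePoint.continuousAt_coe.2 (BerkA1.continuous_apply p).continuousAt
  have := hc.tendsto.comp (tendsto_toBerk_trace (OnePoint.some x))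
  refine this.congr' ?_
  filter_upwards [eventually_rep_ne x] with z hz
  rw [Function.comp_apply, toBerk_of_rep_ne hz]
  rfl

/-- The coordinate `z₁ / z₀` at infinity, with junk value `0` at the origin. -/
def inftyCoord (z : P1 K) : K := z.rep 1 / z.rep 0

lemma eventually_trace_infty (R : ℝ) :
    ∀ᶠ z : P1 K in trace OnePoint.infty, z.rep 1 ≠ 0 → R < ‖affineCoord z‖ := by
  have hcl : IsClosed {x : BerkA1 K | x.1 Polynomial.X ≤ R} :=
    isClosed_le (BerkA1.continuous_apply _) continuous_const
  have h : ∀ᶠ y in 𝓝 (OnePoint.infty : BerkP1 K),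
      y ∈ ((OnePoint.some : BerkA1 K → BerkP1 K) '' {x : BerkA1 K | x.1 Polynomial.X ≤ R})ᶜ :=
    (OnePoint.isOpen_compl_image_coe.2
      ⟨hcl, BerkA1.isCompact_setOf_apply_X_le R⟩).mem_nhds OnePoint.infty_notMem_image_coe
  filter_upwards [(tendsto_toBerk_trace _).eventually h] with z hz hz1
  by_contra! hR
  refine hz ⟨evalPoint (affineCoord z), ?_, (toBerk_of_rep_ne hz1).symm⟩
  change ‖Polynomial.X.eval (affineCoord z)‖ ≤ R
  simpa using hR

lemma eventually_rep_zero_ne : ∀ᶠ z : P1 K in trace OnePoint.infty, z.rep 0 ≠ 0 := by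
  filter_upwards [eventually_trace_infty (K := K) 0] with z hz h0
  by_cases h1 : z.rep 1 = 0
  · exact z.rep_nonzero (by ext i; fin_cases i <;> simp [h0, h1])
  · simpa [affineCoord, h0] using hz h1

lemma tendsto_inftyCoord : Tendsto (inftyCoord (K := K)) (trace OnePoint.infty) (𝓝 0) := by
  rw [tendsto_zero_iff_norm_tendsto_zero, Metric.tendsto_nhds]
  intro ε hε
  filter_upwards [eventually_trace_infty (K := K) ε⁻¹, eventually_rep_zero_ne] with z hz h0
  by_cases h1 : z.rep 1 = 0
  · simpa [inftyCoord, h1] using hε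
  · have h := hz h1
    have e : inftyCoord z = (affineCoord z)⁻¹ := by simp [inftyCoord, affineCoord]
    rw [e, Real.dist_eq, sub_zero, abs_norm, norm_inv]
    exact inv_lt_of_inv_lt₀ hε h

/-- Near a classical point of `𝖯¹`, the projection `K² \ {0} → ℙ¹` has a continuous section. -/
lemma exists_local_section (w : P1 K) : ∃ (W : Fin 2 → K) (hW : W ≠ 0) (σ : P1 K → Fin 2 → K)
    (hσ : ∀ z, σ z ≠ 0), w = Projectivization.mk K W hW ∧
      (∀ᶠ z in trace (toBerk w), z = Projectivization.mk K (σ z) (hσ z)) ∧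
      Tendsto σ (trace (toBerk w)) (𝓝 W) := by
  rcases ofAffine_or_inftyPt w with ⟨t, rfl⟩ | rfl
  · refine ⟨![t, 1], affine_ne_zero t, fun z => ![affineCoord z, 1], fun z => affine_ne_zero _,
      rfl, ?_, ?_⟩
    · rw [toBerk_ofAffine]
      filter_upwards [eventually_rep_ne (evalPoint t)] with z hz
      exact eq_ofAffine_of_rep_ne hz
    · rw [toBerk_ofAffine, tendsto_pi_nhds]
      intro i
      fin_cases i
      · change Tendsto (fun z => affineCoord z) _ (𝓝 t)
        have := tendsto_eval_trace (evalPoint t) (Polynomial.X - Polynomial.C t)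
        have e : (evalPoint t).1 (Polynomial.X - Polynomial.C t) = 0 := by
          change ‖(Polynomial.X - Polynomial.C t).eval t‖ = 0
          simp
        rw [e] at this
        rw [tendsto_iff_norm_sub_tendsto_zero]
        simpa using this
      · exact tendsto_const_nhds
  · refine ⟨![1, 0], coaffine_ne_zero 0, fun z => ![1, inftyCoord z], fun z => coaffine_ne_zero _,
      rfl, ?_, ?_⟩
    · rw [toBerk_inftyPt]
      filter_upwards [eventually_rep_zero_ne] with z hz
      conv_lhs => rw [← z.mk_rep]
      rw [Projectivization.mk_eq_mk_iff']
      refine ⟨z.rep 0, ?_⟩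
      ext i
      fin_cases i
      · simp
      · simp [inftyCoord, mul_div_cancel₀ _ hz]
    · rw [toBerk_inftyPt, tendsto_pi_nhds]
      intro i
      fin_cases i
      · exact tendsto_const_nhds
      · exact tendsto_inftyCoord

/-- For every classical point `w`, the function `[·, w]` extends continuously to `𝖯¹`. -/
lemma exists_tendsto_chordal (x : BerkP1 K) (w : P1 K) :
    ∃ r, Tendsto (fun z => chordal z w) (trace x) (𝓝 r) := by
  induction x using OnePoint.rec with
  | infty =>
    obtain ⟨W, hW, σ, hσ, hw, hev, hlim⟩ := exists_local_section (inftyPt : P1 K)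
    rw [toBerk_inftyPt] at hev hlim
    refine ⟨‖wedge W w.rep‖ / (norm2 W * norm2 w.rep), ?_⟩
    have h1 : Tendsto (fun z => ‖wedge (σ z) w.rep‖ / (norm2 (σ z) * norm2 w.rep))
        (trace OnePoint.infty) (𝓝 (‖wedge W w.rep‖ / (norm2 W * norm2 w.rep))) := by
      refine Tendsto.div ?_ ?_ (mul_pos (norm2_pos hW) (norm2_pos w.rep_nonzero)).ne'
      · exact ((continuous_wedge.comp (Continuous.prodMk_left w.rep)).norm.tendsto W).comp hlim
      · exact ((continuous_norm2.tendsto W).comp hlim).mul_const _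
    refine h1.congr' ?_
    filter_upwards [hev] with z hz
    conv_rhs => rw [hz, ← w.mk_rep]
    rw [chordal_mk]
  | coe x =>
    have hN : Tendsto (fun z => norm2 ![affineCoord z, 1]) (trace (OnePoint.some x))
        (𝓝 (open Classical in if IsUltrametricDist K then max (x.1 Polynomial.X) 1
          else Real.sqrt (x.1 Polynomial.X ^ 2 + 1))) := by
      have hX := tendsto_eval_trace x Polynomial.X
      simp only [Polynomial.eval_X] at hX
      by_cases h : IsUltrametricDist K
      · simpa [norm2, h] using hX.max (tendsto_const_nhds (x := (1 : ℝ)))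
      · simpa [norm2, h] using ((hX.pow 2).add_const 1).sqrt
    have hpos : 0 < (open Classical in if IsUltrametricDist K then max (x.1 Polynomial.X) 1
          else Real.sqrt (x.1 Polynomial.X ^ 2 + 1)) := by
      split_ifs
      · exact lt_max_of_lt_right one_pos
      · positivity
    rcases ofAffine_or_inftyPt w with ⟨t, rfl⟩ | rfl
    · have hX := tendsto_eval_trace x (Polynomial.X - Polynomial.C t)
      refine ⟨_, (hX.div (hN.mul_const (norm2 ![t, 1]))
        (mul_pos hpos (norm2_pos (affine_ne_zero t))).ne').congr' ?_⟩
      filter_upwards [eventually_rep_ne x] with z hz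
      conv_rhs => rw [eq_ofAffine_of_rep_ne hz, chordal_ofAffine]
      simp
    · refine ⟨_, (tendsto_const_nhds (x := (1 : ℝ))).div hN hpos.ne' |>.congr' ?_⟩
      filter_upwards [eventually_rep_ne x] with z hz
      conv_rhs => rw [eq_ofAffine_of_rep_ne hz, chordal_ofAffine_inftyPt]
      simp

end Topology

/-! ### The Hsia kernel and continuous extensions -/

section Hsia

variable [NormedField K]

lemma hsia_eq_limsup (x y : BerkP1 K) :
    hsia x y = limsup (fun p : P1 K × P1 K => chordal p.1 p.2) (trace x ×ˢ trace y) := by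
  rw [hsia, nhds_prod_eq, trace, trace, Filter.prod_comap_comap_eq]
  rfl

lemma isBoundedUnder_le_chordal (l : Filter (P1 K × P1 K)) :
    l.IsBoundedUnder (· ≤ ·) fun p : P1 K × P1 K => chordal p.1 p.2 :=
  isBoundedUnder_of ⟨1, fun p => chordal_le_one p.1 p.2⟩

lemma isBoundedUnder_ge_chordal (l : Filter (P1 K × P1 K)) :
    l.IsBoundedUnder (· ≥ ·) fun p : P1 K × P1 K => chordal p.1 p.2 :=
  isBoundedUnder_of ⟨0, fun p => chordal_nonneg p.1 p.2⟩

lemma eventually_chordal_lt {x y : BerkP1 K} {r : ℝ} (h : hsia x y < r) :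
    ∀ᶠ p in trace x ×ˢ trace y, chordal p.1 p.2 < r := by
  rw [hsia_eq_limsup] at h
  exact eventually_lt_of_limsup_lt h (isBoundedUnder_le_chordal _)

lemma hsia_comm (x y : BerkP1 K) : hsia x y = hsia y x := by
  rw [hsia_eq_limsup, hsia_eq_limsup, Filter.prod_comm, limsup, limsup, Filter.map_map]
  congr 2
  ext p
  exact chordal_comm _ _

lemma extendBerk_eq {φ : P1 K → ℝ} {x : BerkP1 K} [(trace x).NeBot] {r : ℝ}
    (h : Tendsto φ (trace x) (𝓝 r)) : extendBerk φ x = r := h.limUnder_eq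

lemma eq_of_tendsto_trace_toBerk {φ : P1 K → ℝ} {z : P1 K} {r : ℝ}
    (h : Tendsto φ (trace (toBerk z)) (𝓝 r)) : r = φ z :=
  tendsto_nhds_unique (h.mono_left (pure_le_trace z)) (tendsto_pure_nhds φ z)

lemma tendsto_chordal_prod {x : BerkP1 K} {w : P1 K} {r : ℝ}
    (h : Tendsto (fun z => chordal z w) (trace x) (𝓝 r)) :
    Tendsto (fun p : P1 K × P1 K => chordal p.1 p.2) (trace x ×ˢ trace (toBerk w)) (𝓝 r) := by
  obtain ⟨W, hW, σ, hσ, hw, hev, hlim⟩ := exists_local_section w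
  have hWpos := norm2_pos hW
  have h1 : Tendsto (fun z : P1 K => ‖wedge z.rep W‖ / norm2 z.rep) (trace x)
      (𝓝 (r * norm2 W)) := by
    refine (h.mul_const (norm2 W)).congr fun z => ?_
    rw [hw, chordal_mk_right]
    have := norm2_pos z.rep_nonzero
    field_simp
  have h2 : Tendsto (fun z => norm2 (σ z - W)) (trace (toBerk w)) (𝓝 0) := by
    have := (continuous_norm2.tendsto (0 : Fin 2 → K)).comp (tendsto_sub_nhds_zero_iff.2 hlim)
    simpa [norm2, Function.comp_def] using this
  have h3 : Tendsto (fun p : P1 K × P1 K =>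
      ‖wedge p.1.rep (σ p.2)‖ / norm2 p.1.rep - ‖wedge p.1.rep W‖ / norm2 p.1.rep)
      (trace x ×ˢ trace (toBerk w)) (𝓝 0) := by
    refine squeeze_zero_norm (fun p => ?_) (h2.comp tendsto_snd)
    have hp := norm2_pos p.1.rep_nonzero
    rw [← sub_div, norm_div, Real.norm_of_nonneg hp.le, div_le_iff₀ hp, Function.comp_apply]
    have e : wedge p.1.rep (σ p.2 - W) = wedge p.1.rep (σ p.2) - wedge p.1.rep W := by
      simp only [wedge, Pi.sub_apply]
      ring
    rw [mul_comm]
    refine le_trans ?_ (norm_wedge_le p.1.rep (σ p.2 - W))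
    rw [e]
    exact abs_norm_sub_norm_le _ _
  have h4 : Tendsto (fun p : P1 K × P1 K => ‖wedge p.1.rep (σ p.2)‖ / norm2 p.1.rep)
      (trace x ×ˢ trace (toBerk w)) (𝓝 (r * norm2 W)) := by
    simpa using h3.add (h1.comp tendsto_fst)
  have h5 : Tendsto (fun p : P1 K × P1 K => norm2 (σ p.2))
      (trace x ×ˢ trace (toBerk w)) (𝓝 (norm2 W)) :=
    ((continuous_norm2.tendsto W).comp hlim).comp tendsto_snd
  have h6 := h4.div h5 hWpos.ne'
  rw [mul_div_cancel_right₀ _ hWpos.ne'] at h6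
  refine h6.congr' ?_
  filter_upwards [tendsto_snd.eventually hev] with p hp
  conv_rhs => rw [hp, chordal_mk_right]
  rw [Pi.div_apply, div_div]

variable [∀ x : BerkP1 K, (trace x).NeBot]

lemma hsia_le_of_eventually {x y : BerkP1 K} {r : ℝ}
    (h : ∀ᶠ p in trace x ×ˢ trace y, chordal p.1 p.2 ≤ r) : hsia x y ≤ r := by
  rw [hsia_eq_limsup]
  exact limsup_le_of_le (isBoundedUnder_ge_chordal _).isCoboundedUnder_le h

lemma hsia_nonneg (x y : BerkP1 K) : 0 ≤ hsia x y := by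
  rw [hsia_eq_limsup]
  exact le_limsup_of_frequently_le (Eventually.of_forall fun _ => chordal_nonneg _ _).frequently
    (isBoundedUnder_le_chordal _)

lemma hsia_le_one (x y : BerkP1 K) : hsia x y ≤ 1 :=
  hsia_le_of_eventually (Eventually.of_forall fun _ => chordal_le_one _ _)

lemma isOpen_setOf_hsia_lt (x : BerkP1 K) (r : ℝ) : IsOpen {y | hsia x y < r} := by
  rw [isOpen_iff_mem_nhds]
  intro y hy
  obtain ⟨s, hs, hsr⟩ := exists_between (show hsia x y < r from hy)
  obtain ⟨A, hA, B, hB, hAB⟩ := Filter.mem_prod_iff.1 (eventually_chordal_lt hs)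
  obtain ⟨V, hV, hVB⟩ := Filter.mem_comap.1 hB
  obtain ⟨O, hOV, hO, hyO⟩ := mem_nhds_iff.1 hV
  filter_upwards [hO.mem_nhds hyO] with y' hy'
  refine lt_of_le_of_lt (hsia_le_of_eventually ?_) hsr
  have hB' : toBerk ⁻¹' O ∈ trace y' := preimage_mem_comap (hO.mem_nhds hy')
  filter_upwards [prod_mem_prod hA hB'] with p hp
  exact (hAB (Set.mk_mem_prod hp.1 (hVB (hOV hp.2)))).le

lemma measurable_hsia (x : BerkP1 K) : Measurable (hsia x) :=
  measurable_of_Iio fun r => (isOpen_setOf_hsia_lt x r).measurableSet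

lemma hsia_eq_of_tendsto {x y : BerkP1 K} {r : ℝ}
    (h : Tendsto (fun p : P1 K × P1 K => chordal p.1 p.2) (trace x ×ˢ trace y) (𝓝 r)) :
    hsia x y = r := by
  rw [hsia_eq_limsup]
  exact h.limsup_eq

lemma tendsto_chordal (x : BerkP1 K) (w : P1 K) :
    Tendsto (fun z => chordal z w) (trace x) (𝓝 (hsia x (toBerk w))) := by
  obtain ⟨r, hr⟩ := exists_tendsto_chordal x w
  rwa [hsia_eq_of_tendsto (tendsto_chordal_prod hr)]

lemma hsia_toBerk (z w : P1 K) : hsia (toBerk z) (toBerk w) = chordal z w :=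
  eq_of_tendsto_trace_toBerk (φ := fun z => chordal z w) (tendsto_chordal _ w)

/-- A function on `ℙ¹` that has a limit at every point of `𝖯¹` extends continuously. -/
lemma continuous_of_tendsto_trace {φ : P1 K → ℝ} {Φ : BerkP1 K → ℝ}
    (h : ∀ x, Tendsto φ (trace x) (𝓝 (Φ x))) : Continuous Φ := by
  rw [continuous_iff_continuousAt]
  intro x
  refine (nhds_basis_uniformity' (Metric.uniformity_basis_dist_le (α := ℝ))).tendsto_right_iff.2 ?_
  intro ε hε
  have h1 : ∀ᶠ z in trace x, dist (φ z) (Φ x) ≤ ε :=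
    (h x).eventually (Metric.closedBall_mem_nhds _ hε)
  obtain ⟨V, hV, hVB⟩ := Filter.mem_comap.1 h1
  obtain ⟨O, hOV, hO, hxO⟩ := mem_nhds_iff.1 hV
  filter_upwards [hO.mem_nhds hxO] with y hy
  have hy' : ∀ᶠ z in trace y, dist (φ z) (Φ x) ≤ ε :=
    mem_of_superset (preimage_mem_comap (hO.mem_nhds hy)) fun z hz => hVB (hOV hz)
  have := le_of_tendsto ((h y).dist tendsto_const_nhds) hy'
  rw [dist_comm] at this
  exact this

end Hsia

/-- `-log r ∈ [0, ∞]` for `r ∈ [0, 1]`. -/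
def negLog (r : ℝ) : ℝ≥0∞ := open Classical in if r = 0 then ⊤ else ENNReal.ofReal (-Real.log r)

lemma negLogHsia_eq [NormedField K] (x y : BerkP1 K) : negLogHsia x y = negLog (hsia x y) := rfl

lemma measurable_negLog : Measurable negLog :=
  Measurable.ite (measurableSet_singleton 0) measurable_const
    (ENNReal.measurable_ofReal.comp Real.measurable_log.neg)

lemma negLog_zero : negLog 0 = ⊤ := if_pos rfl

lemma negLog_of_ne {r : ℝ} (hr : r ≠ 0) : negLog r = ENNReal.ofReal (-Real.log r) := if_neg hr

lemma measurable_negLogHsia [NormedField K] [∀ x : BerkP1 K, (trace x).NeBot] (x : BerkP1 K) :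
    Measurable (negLogHsia x) :=
  measurable_negLog.comp (measurable_hsia x)

/-! ### Fibres of homogeneous lifts -/

section Algebra

variable [Field K]

lemma natDegree_aeval_X_one_le {P : MvPolynomial (Fin 2) K} {n : ℕ} (hP : P.IsHomogeneous n) :
    (MvPolynomial.aeval ![Polynomial.X, 1] P : K[X]).natDegree ≤ n := by
  rw [P.as_sum, map_sum]
  refine Polynomial.natDegree_sum_le_of_forall_le _ _ fun m hm => ?_
  have hdeg := hP (MvPolynomial.mem_support_iff.1 hm)
  rw [MvPolynomial.aeval_monomial, Finsupp.prod_fintype _ _ (by simp)]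
  have h0 : m 0 ≤ n := by
    rw [← hdeg, Finsupp.weight_apply, Finsupp.sum_fintype _ _ (by simp)]
    simp
  simp only [Fin.prod_univ_two, Matrix.cons_val_zero, Matrix.cons_val_one, one_pow, mul_one]
  exact (Polynomial.natDegree_C_mul_X_pow_le _ _).trans h0

/-- A nonzero binary form over an algebraically closed field is a product of linear forms. -/
lemma exists_eval_eq_prod_wedge [IsAlgClosed K] {P : MvPolynomial (Fin 2) K} {n : ℕ}
    (hn : n ≠ 0) (hP : P.IsHomogeneous n) (h0 : P ≠ 0) :
    ∃ s : Multiset (Fin 2 → K), s.card = n ∧ (∀ w ∈ s, w ≠ 0) ∧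
      ∀ v, MvPolynomial.eval v P = (s.map (wedge v)).prod := by
  set q : K[X] := MvPolynomial.aeval ![Polynomial.X, 1] P with hq
  have hqn : q.natDegree ≤ n := natDegree_aeval_X_one_le hP
  have hPq : q.homogenize n = P := Polynomial.homogenize_eq_of_isHomogeneous hP rfl
  have hq0 : q ≠ 0 := fun h => h0 (by rw [← hPq, h, Polynomial.homogenize_zero])
  have hcard : q.roots.card = q.natDegree :=
    IsAlgClosed.card_roots_eq_natDegree
  have hsplit : ∀ t, q.eval t = q.leadingCoeff * (q.roots.map fun r => t - r).prod := by
    intro t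
    conv_lhs => rw [← Polynomial.C_leadingCoeff_mul_prod_multiset_X_sub_C hcard]
    rw [Polynomial.eval_mul, Polynomial.eval_C, Polynomial.eval_multiset_prod, Multiset.map_map]
    simp
  set s₀ : Multiset (Fin 2 → K) :=
    q.roots.map (fun r => ![r, 1]) + Multiset.replicate (n - q.natDegree) ![-1, 0] with hs₀
  have hs₀card : s₀.card = n := by
    simp [hs₀, hcard, hqn]
  have hs₀ne : ∀ w ∈ s₀, w ≠ 0 := by
    intro w hw h
    rcases Multiset.mem_add.1 hw with hw | hw
    · obtain ⟨r, -, rfl⟩ := Multiset.mem_map.1 hw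
      simpa using congrFun h 1
    · rw [Multiset.eq_of_mem_replicate hw] at h
      simpa using congrFun h 0
  have hs₀prod : ∀ v, MvPolynomial.eval v P = q.leadingCoeff * (s₀.map (wedge v)).prod := by
    intro v
    have e : (s₀.map (wedge v)).prod =
        (q.roots.map fun r => v 0 - v 1 * r).prod * v 1 ^ (n - q.natDegree) := by
      simp [hs₀, wedge, Multiset.map_map, Function.comp_def]
    rw [e, ← hPq]
    by_cases hv : v 1 = 0
    · rw [eval_homogenize_of_eq _ _ hv, hv]
      rcases hqn.eq_or_lt with h | h
      · simp [h, hcard, Polynomial.leadingCoeff]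
      · rw [Polynomial.coeff_eq_zero_of_natDegree_lt h, zero_pow (by omega)]
        simp
    · rw [eval_homogenize_of_ne hqn hv, hsplit]
      have e2 : (q.roots.map fun r => v 0 - v 1 * r).prod =
          v 1 ^ q.natDegree * (q.roots.map fun r => v 0 / v 1 - r).prod := by
        rw [← hcard, ← Multiset.prod_replicate, ← Multiset.map_const', ← Multiset.prod_map_mul]
        congr 1
        refine Multiset.map_congr rfl fun r _ => ?_
        field_simp
      have e3 : v 1 ^ n = v 1 ^ q.natDegree * v 1 ^ (n - q.natDegree) := by
        rw [← pow_add, Nat.add_sub_cancel' hqn]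
      rw [e2, e3]
      ring
  obtain ⟨a, ha⟩ : ∃ a, a ∈ s₀ := Multiset.card_pos_iff_exists_mem.1 (by omega)
  obtain ⟨s', hs'⟩ := Multiset.exists_cons_of_mem ha
  have hlc : q.leadingCoeff ≠ 0 := Polynomial.leadingCoeff_ne_zero.2 hq0
  refine ⟨(q.leadingCoeff • a) ::ₘ s', ?_, ?_, ?_⟩
  · rw [← hs₀card, hs']
    simp
  · intro w hw
    rcases Multiset.mem_cons.1 hw with rfl | hw
    · exact smul_ne_zero hlc (hs₀ne a ha)
    · exact hs₀ne w (by rw [hs']; exact Multiset.mem_cons_of_mem hw)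
  · intro v
    rw [hs₀prod, hs']
    simp only [Multiset.map_cons, Multiset.prod_cons]
    have : wedge v (q.leadingCoeff • a) = q.leadingCoeff * wedge v a := by
      simp only [wedge, Pi.smul_apply, smul_eq_mul]; ring
    rw [this]
    ring

/-- `s` is the multiset of (suitably normalized) preimages of `W` under a homogeneous map `H`. -/
def IsFiber (H : (Fin 2 → K) → Fin 2 → K) (W : Fin 2 → K) (s : Multiset (Fin 2 → K)) : Prop :=
  (∀ w ∈ s, w ≠ 0) ∧ ∀ v, wedge (H v) W = (s.map (wedge v)).prod

namespace HomogeneousLift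

variable {f : RatFunc K} (F : HomogeneousLift f)

lemma toMap_ne_zero {v : Fin 2 → K} (hv : v ≠ 0) : F.toMap v ≠ 0 := F.nondegenerate v hv

lemma iterate_toMap_ne_zero (n : ℕ) {v : Fin 2 → K} (hv : v ≠ 0) : F.toMap^[n] v ≠ 0 := by
  induction n with
  | zero => exact hv
  | succ n ih => rw [Function.iterate_succ_apply']; exact F.toMap_ne_zero ih

lemma toMap_smul (c : K) (v : Fin 2 → K) : F.toMap (c • v) = c ^ ratDegree f • F.toMap v := by
  ext i
  rw [toMap, Pi.smul_apply, toMap, MvPolynomial.eval_eq', MvPolynomial.eval_eq', smul_eq_mul,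
    Finset.mul_sum]
  refine Finset.sum_congr rfl fun m hm => ?_
  have hdeg := F.isHomogeneous i (MvPolynomial.mem_support_iff.1 hm)
  rw [Finsupp.weight_apply, Finsupp.sum_fintype _ _ (by simp)] at hdeg
  simp only [Pi.smul_apply, smul_eq_mul, mul_pow, Finset.prod_mul_distrib]
  rw [Finset.prod_pow_eq_pow_sum]
  have : ∑ i, m i = ratDegree f := by simpa using hdeg
  rw [this]
  ring

lemma iterate_toMap_smul (n : ℕ) (c : K) (v : Fin 2 → K) :
    F.toMap^[n] (c • v) = c ^ ratDegree f ^ n • F.toMap^[n] v := by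
  induction n with
  | zero => simp
  | succ n ih =>
    rw [Function.iterate_succ_apply', ih, toMap_smul, Function.iterate_succ_apply', ← pow_mul,
      ← pow_succ]

/-- The form `p ↦ F(p) ∧ W`. -/
def wedgeForm (W : Fin 2 → K) : MvPolynomial (Fin 2) K :=
  F.poly 0 * MvPolynomial.C (W 1) - F.poly 1 * MvPolynomial.C (W 0)

lemma eval_wedgeForm (W v : Fin 2 → K) :
    MvPolynomial.eval v (F.wedgeForm W) = wedge (F.toMap v) W := by
  simp [wedgeForm, wedge, toMap]

lemma isHomogeneous_wedgeForm (W : Fin 2 → K) : (F.wedgeForm W).IsHomogeneous (ratDegree f) := by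
  refine MvPolynomial.IsHomogeneous.sub ?_ ?_
  · simpa using (F.isHomogeneous 0).mul (MvPolynomial.isHomogeneous_C _ (W 1))
  · simpa using (F.isHomogeneous 1).mul (MvPolynomial.isHomogeneous_C _ (W 0))

variable [IsAlgClosed K]

lemma exists_toMap_apply_eq_zero {i : Fin 2} (hd : ratDegree f ≠ 0) :
    ∃ v : Fin 2 → K, v ≠ 0 ∧ F.toMap v i = 0 := by
  by_cases h : F.poly i = 0
  · exact ⟨![1, 0], fun h => by simpa using congrFun h 0, by simp [toMap, h]⟩
  · obtain ⟨s, hs, hne, hprod⟩ := exists_eval_eq_prod_wedge hd (F.isHomogeneous i) h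
    obtain ⟨a, ha⟩ : ∃ a, a ∈ s := Multiset.card_pos_iff_exists_mem.1 (by omega)
    refine ⟨a, hne a ha, ?_⟩
    rw [toMap, hprod]
    exact Multiset.prod_eq_zero (Multiset.mem_map.2 ⟨a, ha, by simp [wedge, mul_comm]⟩)

lemma exists_isFiber (hd : ratDegree f ≠ 0) {W : Fin 2 → K} (hW : W ≠ 0) :
    ∃ s, s.card = ratDegree f ∧ IsFiber F.toMap W s := by
  have h0 : F.wedgeForm W ≠ 0 := by
    intro h
    have hz : ∀ v, F.toMap v 0 * W 1 = F.toMap v 1 * W 0 := fun v => by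
      have := F.eval_wedgeForm W v
      rw [h, map_zero, wedge] at this
      linear_combination -this
    by_cases hW0 : W 0 = 0
    · have hW1 : W 1 ≠ 0 := fun h1 => hW (by ext i; fin_cases i <;> simp [hW0, h1])
      obtain ⟨v, hv, hv1⟩ := F.exists_toMap_apply_eq_zero (i := 1) hd
      have := hz v
      rw [hv1, zero_mul] at this
      refine F.toMap_ne_zero hv ?_
      ext i
      fin_cases i
      · exact (mul_eq_zero.1 this).resolve_right hW1
      · exact hv1
    · obtain ⟨v, hv, hv0⟩ := F.exists_toMap_apply_eq_zero (i := 0) hd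
      have := hz v
      rw [hv0, zero_mul, eq_comm] at this
      refine F.toMap_ne_zero hv ?_
      ext i
      fin_cases i
      · exact hv0
      · exact (mul_eq_zero.1 this).resolve_right hW0
  obtain ⟨s, hs, hne, hprod⟩ :=
    exists_eval_eq_prod_wedge hd (F.isHomogeneous_wedgeForm W) h0
  exact ⟨s, hs, hne, fun v => by rw [← F.eval_wedgeForm, hprod]⟩

open Classical in
/-- The lifts of the preimages of `π W` under `f`. -/
def fiber (W : Fin 2 → K) : Multiset (Fin 2 → K) :=
  if h : ∃ s, s.card = ratDegree f ∧ IsFiber F.toMap W s then h.choose else 0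

/-- The lifts of the preimages of `π W` under `fⁿ`. -/
def iterFiber : ℕ → (Fin 2 → K) → Multiset (Fin 2 → K)
  | 0, W => {W}
  | n + 1, W => (iterFiber n W).bind F.fiber

lemma fiber_spec (hd : ratDegree f ≠ 0) {W : Fin 2 → K} (hW : W ≠ 0) :
    (F.fiber W).card = ratDegree f ∧ IsFiber F.toMap W (F.fiber W) := by
  have h := F.exists_isFiber hd hW
  rw [fiber, dif_pos h]
  exact h.choose_spec

lemma iterFiber_spec (hd : ratDegree f ≠ 0) (n : ℕ) {W : Fin 2 → K} (hW : W ≠ 0) :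
    (F.iterFiber n W).card = ratDegree f ^ n ∧ IsFiber F.toMap^[n] W (F.iterFiber n W) := by
  induction n with
  | zero => simp [iterFiber, IsFiber, hW]
  | succ n ih =>
    obtain ⟨hc, hne, hprod⟩ := ih
    refine ⟨?_, ?_, ?_⟩
    · rw [iterFiber, Multiset.card_bind, Multiset.map_congr rfl
        (f := Multiset.card ∘ F.fiber) (g := fun _ => ratDegree f) (fun w hw => (F.fiber_spec hd (hne w hw)).1)]
      simp [hc, pow_succ]
    · intro w hw
      obtain ⟨u, hu, hwu⟩ := Multiset.mem_bind.1 hw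
      exact (F.fiber_spec hd (hne u hu)).2.1 w hwu
    · intro v
      rw [Function.iterate_succ_apply, hprod, iterFiber, Multiset.map_bind, Multiset.prod_bind]
      congr 1
      exact Multiset.map_congr rfl fun u hu => (F.fiber_spec hd (hne u hu)).2.2 v

end HomogeneousLift

end Algebra

/-! ### Escape rates and Green functions of lifts -/

section Escape

open HomogeneousLift

variable [NormedField K]

lemma wedge_smul_eq (a b p : Fin 2 → K) :
    wedge a b • p = wedge p b • a + wedge a p • b := by
  ext i
  fin_cases i <;> simp [wedge] <;> ring

lemma norm_wedge_mul_norm_le (a b p : Fin 2 → K) :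
    ‖wedge a b‖ * ‖p‖ ≤ ‖wedge p b‖ * ‖a‖ + ‖wedge p a‖ * ‖b‖ := by
  rw [← norm_smul, wedge_smul_eq, norm_wedge_swap a p, ← norm_smul, ← norm_smul]
  exact norm_add_le _ _

lemma norm_multiset_prod_map {α : Type*} (s : Multiset α) (φ : α → K) :
    ‖(s.map φ).prod‖ = (s.map fun a => ‖φ a‖).prod := by
  induction s using Multiset.induction_on with
  | empty => simp
  | cons a s ih => simp [ih]

lemma pow_card_le_multiset_prod {α : Type*} (s : Multiset α) (φ : α → ℝ) {c : ℝ} (hc : 0 ≤ c)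
    (h : ∀ a ∈ s, c ≤ φ a) : c ^ s.card ≤ (s.map φ).prod := by
  rw [← Multiset.prod_replicate, ← Multiset.map_const']
  exact Multiset.prod_map_le_prod_map₀ _ _ (fun _ _ => hc) h

lemma exists_pos_wedge_lower_bound {A B : Multiset (Fin 2 → K)}
    (h : ∀ a ∈ A, ∀ b ∈ B, wedge a b ≠ 0) :
    ∃ ε > 0, ∀ p : Fin 2 → K, (∀ a ∈ A, ε * ‖p‖ ≤ ‖wedge p a‖) ∨ ∀ b ∈ B, ε * ‖p‖ ≤ ‖wedge p b‖ := by
  classical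
  have h1 : ∀ᶠ ε in 𝓝[>] (0 : ℝ), ∀ a ∈ A.toFinset, ∀ b ∈ B.toFinset,
      ε * (‖a‖ + ‖b‖) < ‖wedge a b‖ := by
    refine (Filter.eventually_all_finset _).2 fun a ha => (Filter.eventually_all_finset _).2
      fun b hb => ?_
    have : Tendsto (fun ε : ℝ => ε * (‖a‖ + ‖b‖)) (𝓝[>] 0) (𝓝 0) := by
      have : Tendsto (fun ε : ℝ => ε * (‖a‖ + ‖b‖)) (𝓝 0) (𝓝 (0 * (‖a‖ + ‖b‖))) :=
        (continuous_mul_const _).tendsto 0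
      rw [zero_mul] at this
      exact this.mono_left nhdsWithin_le_nhds
    exact this.eventually (gt_mem_nhds
      (norm_pos_iff.2 (h a (Multiset.mem_toFinset.1 ha) b (Multiset.mem_toFinset.1 hb))))
  obtain ⟨ε, hε, hε0⟩ := (h1.and self_mem_nhdsWithin).exists
  refine ⟨ε, hε0, fun p => ?_⟩
  by_contra! hcon
  obtain ⟨⟨a, ha, hap⟩, b, hb, hbp⟩ := hcon
  have h2 := hε a (Multiset.mem_toFinset.2 ha) b (Multiset.mem_toFinset.2 hb)
  have h3 := norm_wedge_mul_norm_le a b p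
  have hp : 0 < ‖p‖ := by
    by_contra! hp
    have : p = 0 := norm_le_zero_iff.1 hp
    subst this
    simp [wedge] at hap
  nlinarith [norm_nonneg a, norm_nonneg b, norm_nonneg (wedge p a), norm_nonneg (wedge p b)]

namespace HomogeneousLift

variable [IsAlgClosed K] {f : RatFunc K} (F : HomogeneousLift f)

lemma exists_norm2_lower_bound (hd : ratDegree f ≠ 0) :
    ∃ c > 0, ∀ v, c * norm2 v ^ ratDegree f ≤ norm2 (F.toMap v) := by
  have hA := F.fiber_spec hd (W := ![0, 1]) (fun h => by simpa using congrFun h 1)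
  have hB := F.fiber_spec hd (W := ![-1, 0]) (fun h => by simpa using congrFun h 0)
  set A := F.fiber ![0, 1]
  set B := F.fiber ![-1, 0]
  have hF0 : ∀ v, F.toMap v 0 = (A.map (wedge v)).prod := fun v => by
    rw [← hA.2.2 v]; simp [wedge]
  have hF1 : ∀ v, F.toMap v 1 = (B.map (wedge v)).prod := fun v => by
    rw [← hB.2.2 v]; simp [wedge]
  have hAB : ∀ a ∈ A, ∀ b ∈ B, wedge a b ≠ 0 := by
    intro a ha b hb hab
    refine F.toMap_ne_zero (hA.2.1 a ha) ?_
    ext i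
    fin_cases i
    · change F.toMap a 0 = 0
      rw [hF0]
      exact Multiset.prod_eq_zero (Multiset.mem_map.2 ⟨a, ha, wedge_self a⟩)
    · change F.toMap a 1 = 0
      rw [hF1]
      exact Multiset.prod_eq_zero (Multiset.mem_map.2 ⟨b, hb, hab⟩)
  obtain ⟨ε, hε, h⟩ := exists_pos_wedge_lower_bound hAB
  refine ⟨(ε / 2) ^ ratDegree f, by positivity, fun v => ?_⟩
  have h2 : ε / 2 * norm2 v ≤ ε * ‖v‖ := by
    have := norm2_le_two_mul_norm v
    nlinarith
  have h0 : 0 ≤ ε / 2 * norm2 v := mul_nonneg (by positivity) (norm2_nonneg v)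
  rw [← mul_pow]
  rcases h v with h | h
  · refine le_trans ?_ (norm_apply_le_norm2 _ 0)
    rw [hF0, norm_multiset_prod_map, ← hA.1]
    exact pow_card_le_multiset_prod _ _ h0 fun a ha => h2.trans (h a ha)
  · refine le_trans ?_ (norm_apply_le_norm2 _ 1)
    rw [hF1, norm_multiset_prod_map, ← hB.1]
    exact pow_card_le_multiset_prod _ _ h0 fun a ha => h2.trans (h a ha)

lemma norm_apply_le_of_isFiber {H : (Fin 2 → K) → Fin 2 → K} {W : Fin 2 → K}
    {s : Multiset (Fin 2 → K)} (h : IsFiber H W s) (v : Fin 2 → K) :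
    ‖wedge (H v) W‖ ≤ norm2 v ^ s.card * (s.map norm2).prod := by
  rw [h.2, norm_multiset_prod_map]
  refine (Multiset.prod_map_le_prod_map₀ _ (fun w => norm2 v * norm2 w)
    (fun _ _ => norm_nonneg _) (fun w _ => norm_wedge_le v w)).trans_eq ?_
  rw [Multiset.prod_map_mul, Multiset.map_const', Multiset.prod_replicate]

lemma exists_norm2_upper_bound (hd : ratDegree f ≠ 0) :
    ∃ C > 0, ∀ v, norm2 (F.toMap v) ≤ C * norm2 v ^ ratDegree f := by
  have hA := F.fiber_spec hd (W := ![0, 1]) (fun h => by simpa using congrFun h 1)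
  have hB := F.fiber_spec hd (W := ![-1, 0]) (fun h => by simpa using congrFun h 0)
  have hnn : ∀ s : Multiset (Fin 2 → K), 0 ≤ (s.map norm2).prod := fun s =>
    Multiset.prod_nonneg fun a ha => by
      obtain ⟨w, -, rfl⟩ := Multiset.mem_map.1 ha
      exact norm2_nonneg w
  set a := ((F.fiber ![0, 1]).map norm2).prod
  set b := ((F.fiber ![-1, 0]).map norm2).prod
  have ha : 0 ≤ a := hnn _
  have hb : 0 ≤ b := hnn _
  refine ⟨2 * (a + b) + 1, by positivity, fun v => ?_⟩
  have hv : 0 ≤ norm2 v ^ ratDegree f := pow_nonneg (norm2_nonneg v) _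
  have h0 : ‖F.toMap v 0‖ ≤ norm2 v ^ ratDegree f * a := by
    have := norm_apply_le_of_isFiber hA.2 v
    rw [hA.1] at this
    simpa [wedge] using this
  have h1 : ‖F.toMap v 1‖ ≤ norm2 v ^ ratDegree f * b := by
    have := norm_apply_le_of_isFiber hB.2 v
    rw [hB.1] at this
    simpa [wedge] using this
  have h2 : ‖F.toMap v‖ ≤ norm2 v ^ ratDegree f * (a + b) := by
    refine (pi_norm_le_iff_of_nonneg (by positivity)).2 fun i => ?_
    fin_cases i
    · exact h0.trans (by gcongr; linarith)
    · exact h1.trans (by gcongr; linarith)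
  have := norm2_le_two_mul_norm (F.toMap v)
  nlinarith

lemma exists_abs_log_norm2_sub_le (hd : ratDegree f ≠ 0) :
    ∃ C, 0 ≤ C ∧ ∀ v, v ≠ 0 →
      |Real.log (norm2 (F.toMap v)) - ratDegree f * Real.log (norm2 v)| ≤ C := by
  obtain ⟨c, hc, hlow⟩ := F.exists_norm2_lower_bound hd
  obtain ⟨C, hC, hup⟩ := F.exists_norm2_upper_bound hd
  refine ⟨max (-Real.log c) (Real.log C) ⊔ 0, le_max_right _ _, fun v hv => ?_⟩
  have hv' := norm2_pos hv
  have hFv := norm2_pos (F.toMap_ne_zero hv)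
  have h1 := Real.log_le_log (by positivity) (hlow v)
  have h2 := Real.log_le_log hFv (hup v)
  rw [Real.log_mul (by positivity) (by positivity), Real.log_pow] at h1 h2
  rw [abs_le]
  constructor
  · have := le_max_left (-Real.log c) (Real.log C)
    have := le_max_left (max (-Real.log c) (Real.log C)) 0
    linarith
  · have := le_max_right (-Real.log c) (Real.log C)
    have := le_max_left (max (-Real.log c) (Real.log C)) 0
    linarith

/-- The function `T_{Fⁿ}` on `ℙ¹`. -/
def logRatio (n : ℕ) (z : P1 K) : ℝ :=
  Real.log (norm2 (F.toMap^[n] z.rep)) - (ratDegree f : ℝ) ^ n * Real.log (norm2 z.rep)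

lemma logRatio_mk (n : ℕ) {v : Fin 2 → K} (hv : v ≠ 0) :
    F.logRatio n (Projectivization.mk K v hv) =
      Real.log (norm2 (F.toMap^[n] v)) - (ratDegree f : ℝ) ^ n * Real.log (norm2 v) := by
  obtain ⟨a, ha⟩ := Projectivization.exists_smul_eq_mk_rep K v hv
  have ha0 : ‖(a : K)‖ ≠ 0 := norm_ne_zero_iff.2 a.ne_zero
  have h1 := (norm2_pos hv).ne'
  have h2 := (norm2_pos (F.iterate_toMap_ne_zero n hv)).ne'
  rw [logRatio, ← ha, Units.smul_def, F.iterate_toMap_smul, norm2_smul, norm2_smul, norm_pow,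
    Real.log_mul (pow_ne_zero _ ha0) h2, Real.log_mul ha0 h1, Real.log_pow]
  push_cast
  ring

lemma exists_abs_logRatio_succ_sub_le (hd : ratDegree f ≠ 0) :
    ∃ C, 0 ≤ C ∧ ∀ n z, |F.logRatio (n + 1) z - ratDegree f * F.logRatio n z| ≤ C := by
  obtain ⟨C, hC, h⟩ := F.exists_abs_log_norm2_sub_le hd
  refine ⟨C, hC, fun n z => ?_⟩
  have := h _ (F.iterate_toMap_ne_zero n z.rep_nonzero)
  rw [logRatio, logRatio, Function.iterate_succ_apply']
  convert this using 2
  ring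

lemma exists_le_logRatio (hd : ratDegree f ≠ 0) (n : ℕ) : ∃ C, ∀ z, C ≤ F.logRatio n z := by
  obtain ⟨C, hC, h⟩ := F.exists_abs_logRatio_succ_sub_le hd
  induction n with
  | zero => exact ⟨0, fun z => by simp [logRatio]⟩
  | succ n ih =>
    obtain ⟨C', h'⟩ := ih
    refine ⟨ratDegree f * C' - C, fun z => ?_⟩
    have h1 := (abs_le.1 (h n z)).1
    have h2 : (ratDegree f : ℝ) * C' ≤ ratDegree f * F.logRatio n z := by
      gcongr
      exact h' z
    linarith

/-- The maximum norm or the Euclidean norm, in terms of the absolute values of the entries. -/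
def normPair (K : Type*) [NormedField K] (a b : ℝ) : ℝ :=
  open Classical in if IsUltrametricDist K then max a b else Real.sqrt (a ^ 2 + b ^ 2)

lemma norm2_eq_normPair (v : Fin 2 → K) : norm2 v = normPair K ‖v 0‖ ‖v 1‖ := rfl

lemma normPair_div (a b : ℝ) {c : ℝ} (hc : 0 < c) :
    normPair K (a / c) (b / c) = normPair K a b / c := by
  unfold normPair
  split_ifs
  · rw [max_div_div_right hc.le]
  · rw [div_pow, div_pow, ← add_div, Real.sqrt_div' _ (by positivity), Real.sqrt_sq hc.le]

lemma continuous_normPair : Continuous fun p : ℝ × ℝ => normPair K p.1 p.2 := by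
  unfold normPair
  split_ifs <;> fun_prop

lemma tendsto_multiset_prod_chordal [∀ x : BerkP1 K, (trace x).NeBot] (x : BerkP1 K)
    (s : Multiset (Fin 2 → K)) (hs : ∀ w ∈ s, w ≠ 0) :
    ∃ r, Tendsto (fun z : P1 K => ‖(s.map (wedge z.rep)).prod‖ / norm2 z.rep ^ s.card)
      (trace x) (𝓝 r) := by
  induction s using Multiset.induction_on with
  | empty => exact ⟨1, by simp⟩
  | cons a s ih =>
    obtain ⟨r, hr⟩ := ih fun w hw => hs w (Multiset.mem_cons_of_mem hw)
    have ha : a ≠ 0 := hs a (Multiset.mem_cons_self a s)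
    refine ⟨_, (((tendsto_chordal x (Projectivization.mk K a ha)).mul_const (norm2 a)).mul
      hr).congr fun z => ?_⟩
    have h1 := norm2_pos z.rep_nonzero
    have h2 := norm2_pos ha
    rw [chordal_mk_right, Multiset.map_cons, Multiset.prod_cons, norm_mul, Multiset.card_cons,
      pow_succ]
    field_simp

variable [∀ x : BerkP1 K, (trace x).NeBot]

lemma tendsto_logRatio (hd : ratDegree f ≠ 0) (n : ℕ) (x : BerkP1 K) :
    Tendsto (F.logRatio n) (trace x) (𝓝 (F.T n x)) := by
  have hA := F.iterFiber_spec hd n (W := ![0, 1]) (fun h => by simpa using congrFun h 1)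
  have hB := F.iterFiber_spec hd n (W := ![-1, 0]) (fun h => by simpa using congrFun h 0)
  obtain ⟨a, ha⟩ := tendsto_multiset_prod_chordal x _ hA.2.1
  obtain ⟨b, hb⟩ := tendsto_multiset_prod_chordal x _ hB.2.1
  have hab := (continuous_normPair (K := K)).continuousAt.tendsto.comp (ha.prodMk_nhds hb)
  have hexp : ∀ z : P1 K, Real.exp (F.logRatio n z) =
      norm2 (F.toMap^[n] z.rep) / norm2 z.rep ^ ratDegree f ^ n := by
    intro z
    have h1 := norm2_pos z.rep_nonzero
    have h2 := norm2_pos (F.iterate_toMap_ne_zero n z.rep_nonzero)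
    rw [logRatio, Real.exp_sub, Real.exp_log h2, ← Nat.cast_pow, ← Real.log_pow,
      Real.exp_log (by positivity)]
  have hlim : Tendsto (fun z => Real.exp (F.logRatio n z)) (trace x) (𝓝 (normPair K a b)) := by
    refine hab.congr fun z => ?_
    have h1 := norm2_pos z.rep_nonzero
    rw [Function.comp_apply, hA.1, hB.1, normPair_div _ _ (by positivity), ← hA.2.2, ← hB.2.2, hexp,
      norm2_eq_normPair (F.toMap^[n] z.rep)]
    simp [wedge]
  obtain ⟨C, hC⟩ := F.exists_le_logRatio hd n
  have hpos : 0 < normPair K a b :=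
    (Real.exp_pos C).trans_le (ge_of_tendsto hlim
      (Eventually.of_forall fun z => Real.exp_le_exp.2 (hC z)))
  have := hlim.log hpos.ne'
  simp only [Real.log_exp] at this
  have e : F.T n x = Real.log (normPair K a b) := extendBerk_eq this
  rwa [e]

lemma T_toBerk_mk (hd : ratDegree f ≠ 0) (n : ℕ) {v : Fin 2 → K} (hv : v ≠ 0) :
    F.T n (toBerk (Projectivization.mk K v hv)) =
      Real.log (norm2 (F.toMap^[n] v)) - (ratDegree f : ℝ) ^ n * Real.log (norm2 v) := by
  rw [eq_of_tendsto_trace_toBerk (F.tendsto_logRatio hd n _), logRatio_mk]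

lemma continuous_T (hd : ratDegree f ≠ 0) (n : ℕ) : Continuous (F.T n) :=
  continuous_of_tendsto_trace fun x => F.tendsto_logRatio hd n x

lemma exists_abs_T_div_sub_green_le (hd : 1 < ratDegree f) :
    ∃ C, ∀ n x, |F.T n x / (ratDegree f : ℝ) ^ n - F.green x| ≤ C * ((ratDegree f : ℝ)⁻¹) ^ n := by
  have hd0 : ratDegree f ≠ 0 := by omega
  have hd1 : (1 : ℝ) < ratDegree f := by exact_mod_cast hd
  obtain ⟨C, hC, h⟩ := F.exists_abs_logRatio_succ_sub_le hd0
  have hT : ∀ n x, |F.T (n + 1) x - ratDegree f * F.T n x| ≤ C := fun n x =>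
    le_of_tendsto ((F.tendsto_logRatio hd0 (n + 1) x).sub
      ((F.tendsto_logRatio hd0 n x).const_mul _)).abs (Eventually.of_forall fun z => h n z)
  have hr : ((ratDegree f : ℝ)⁻¹) < 1 := inv_lt_one_of_one_lt₀ hd1
  have hu : ∀ x n, dist (F.T n x / (ratDegree f : ℝ) ^ n)
      (F.T (n + 1) x / (ratDegree f : ℝ) ^ (n + 1)) ≤ C * ((ratDegree f : ℝ)⁻¹) ^ n := by
    intro x n
    have e : F.T n x / (ratDegree f : ℝ) ^ n - F.T (n + 1) x / (ratDegree f : ℝ) ^ (n + 1) =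
        -((F.T (n + 1) x - ratDegree f * F.T n x) / (ratDegree f : ℝ) ^ (n + 1)) := by
      field_simp
      ring
    rw [Real.dist_eq, e, abs_neg, abs_div, abs_of_pos (by positivity : (0 : ℝ) < _ ^ (n + 1)),
      inv_pow, ← div_eq_mul_inv]
    have hp : (ratDegree f : ℝ) ^ n ≤ (ratDegree f : ℝ) ^ (n + 1) :=
      pow_le_pow_right₀ hd1.le (Nat.le_succ n)
    exact div_le_div₀ hC (hT n x) (by positivity) hp
  refine ⟨C / (1 - (ratDegree f : ℝ)⁻¹), fun n x => ?_⟩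
  have hcau := cauchySeq_of_le_geometric _ _ hr (hu x)
  have hlim : Tendsto (fun n => F.T n x / (ratDegree f : ℝ) ^ n) atTop (𝓝 (F.green x)) :=
    hcau.tendsto_limUnder
  have := dist_le_of_le_geometric_of_tendsto _ _ hr (hu x) hlim n
  rw [Real.dist_eq] at this
  convert this using 1
  ring

lemma tendsto_T_div (hd : 1 < ratDegree f) (x : BerkP1 K) :
    Tendsto (fun n => F.T n x / (ratDegree f : ℝ) ^ n) atTop (𝓝 (F.green x)) := by
  obtain ⟨C, hC⟩ := F.exists_abs_T_div_sub_green_le hd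
  have hr : ((ratDegree f : ℝ)⁻¹) < 1 := inv_lt_one_of_one_lt₀ (by exact_mod_cast hd)
  rw [tendsto_iff_norm_sub_tendsto_zero]
  refine squeeze_zero (fun _ => norm_nonneg _) (fun n => hC n x) ?_
  simpa using (tendsto_pow_atTop_nhds_zero_of_lt_one (by positivity) hr).const_mul C

open Classical in
/-- The homogeneous escape rate `G_F = g_F ∘ π + log ‖·‖` of `F`. -/
def escapeRate (v : Fin 2 → K) : ℝ :=
  if hv : v = 0 then 0 else F.green (toBerk (Projectivization.mk K v hv)) + Real.log (norm2 v)

lemma escapeRate_of_ne {v : Fin 2 → K} (hv : v ≠ 0) : F.escapeRate v =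
    F.green (toBerk (Projectivization.mk K v hv)) + Real.log (norm2 v) := dif_neg hv

lemma tendsto_escapeRate (hd : 1 < ratDegree f) {v : Fin 2 → K} (hv : v ≠ 0) :
    Tendsto (fun n => Real.log (norm2 (F.toMap^[n] v)) / (ratDegree f : ℝ) ^ n) atTop
      (𝓝 (F.escapeRate v)) := by
  rw [F.escapeRate_of_ne hv]
  refine ((F.tendsto_T_div hd _).add_const (Real.log (norm2 v))).congr fun n => ?_
  have hd0 : (ratDegree f : ℝ) ≠ 0 := by
    have : ratDegree f ≠ 0 := by omega
    exact_mod_cast this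
  rw [F.T_toBerk_mk (by omega) n hv]
  field_simp
  ring

lemma escapeRate_toMap (hd : 1 < ratDegree f) {v : Fin 2 → K} (hv : v ≠ 0) :
    F.escapeRate (F.toMap v) = ratDegree f * F.escapeRate v := by
  have hd0 : (ratDegree f : ℝ) ≠ 0 := by
    have : ratDegree f ≠ 0 := by omega
    exact_mod_cast this
  have h1 := F.tendsto_escapeRate hd (F.toMap_ne_zero hv)
  have h2 := ((tendsto_add_atTop_iff_nat 1).2 (F.tendsto_escapeRate hd hv)).const_mul
    (ratDegree f : ℝ)
  refine tendsto_nhds_unique h1 (h2.congr fun n => ?_)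
  rw [Function.iterate_succ_apply, pow_succ]
  field_simp

lemma escapeRate_smul {c : K} (hc : c ≠ 0) {v : Fin 2 → K} (hv : v ≠ 0) :
    F.escapeRate (c • v) = Real.log ‖c‖ + F.escapeRate v := by
  have hcv : c • v ≠ 0 := smul_ne_zero hc hv
  have e : Projectivization.mk K (c • v) hcv = Projectivization.mk K v hv := by
    rw [Projectivization.mk_eq_mk_iff']
    exact ⟨c, rfl⟩
  rw [F.escapeRate_of_ne hv, F.escapeRate_of_ne hcv, e, norm2_smul,
    Real.log_mul (norm_ne_zero_iff.2 hc) (norm2_pos hv).ne']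
  ring

end HomogeneousLift

end Escape

/-! ### Escape rates on fibres -/

section FiberSum

variable [NormedField K]

lemma log_multiset_prod {α : Type*} (s : Multiset α) (φ : α → ℝ) (h : ∀ a ∈ s, φ a ≠ 0) :
    Real.log (s.map φ).prod = (s.map fun a => Real.log (φ a)).sum := by
  induction s using Multiset.induction_on with
  | empty => simp
  | cons a s ih =>
    have h' : ∀ b ∈ s, φ b ≠ 0 := fun b hb => h b (Multiset.mem_cons_of_mem hb)
    rw [Multiset.map_cons, Multiset.prod_cons, Multiset.map_cons, Multiset.sum_cons, ← ih h',
      Real.log_mul (h a (Multiset.mem_cons_self a s))]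
    intro h0
    obtain ⟨b, hb, hb0⟩ := Multiset.mem_map.1 (Multiset.prod_eq_zero_iff.1 h0)
    exact h' b hb hb0

lemma exists_wedge_ne_zero {p : Fin 2 → K} (hp : p ≠ 0) : ∃ b : Fin 2 → K, wedge p b ≠ 0 := by
  by_cases h0 : p 0 = 0
  · refine ⟨![1, 0], fun h => hp ?_⟩
    ext i
    fin_cases i
    · exact h0
    · simpa [wedge] using h
  · exact ⟨![0, 1], by simpa [wedge] using h0⟩

namespace HomogeneousLift

variable [IsAlgClosed K] [∀ x : BerkP1 K, (trace x).NeBot] {f : RatFunc K} (F : HomogeneousLift f)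

lemma mul_sum_escapeRate_fiber_sub (hd : 1 < ratDegree f) {W V : Fin 2 → K} (hW : W ≠ 0)
    (hV : V ≠ 0) (hWV : wedge W V ≠ 0) :
    (ratDegree f : ℝ) * (((F.fiber W).map F.escapeRate).sum - F.escapeRate W) =
      ((F.fiber W).map fun w => ((F.fiber V).map fun v => Real.log ‖wedge w v‖).sum).sum -
        ratDegree f * Real.log ‖wedge W V‖ := by
  obtain ⟨hc, hne, hprod⟩ := F.fiber_spec (by omega) hW
  obtain ⟨-, -, hprodV⟩ := F.fiber_spec (by omega) hV
  have key : ∀ w ∈ F.fiber W, (ratDegree f : ℝ) * F.escapeRate w =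
      ((F.fiber V).map fun v => Real.log ‖wedge w v‖).sum +
        (F.escapeRate W - Real.log ‖wedge W V‖) := by
    intro w hw
    have h0 : wedge (F.toMap w) W = 0 := by
      rw [hprod]
      exact Multiset.prod_eq_zero (Multiset.mem_map.2 ⟨w, hw, wedge_self w⟩)
    obtain ⟨c, hcW⟩ := exists_smul_eq_of_wedge_eq_zero hW h0
    have hc0 : c ≠ 0 := by
      rintro rfl
      exact F.toMap_ne_zero (hne w hw) (by simpa using hcW)
    have h1 : wedge (F.toMap w) V = c * wedge W V := by rw [hcW, wedge_smul_left]
    have h2 : wedge (F.toMap w) V ≠ 0 := by rw [h1]; exact mul_ne_zero hc0 hWV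
    have h3 : ∀ v ∈ F.fiber V, ‖wedge w v‖ ≠ 0 := by
      intro v hv hv0
      refine h2 ?_
      rw [hprodV]
      exact Multiset.prod_eq_zero (Multiset.mem_map.2 ⟨v, hv, norm_eq_zero.1 hv0⟩)
    rw [← log_multiset_prod _ _ h3, ← norm_multiset_prod_map, ← hprodV, h1, norm_mul,
      Real.log_mul (norm_ne_zero_iff.2 hc0) (norm_ne_zero_iff.2 hWV),
      ← F.escapeRate_toMap hd (hne w hw), hcW, F.escapeRate_smul hc0 hW]
    ring
  have hsum : (ratDegree f : ℝ) * ((F.fiber W).map F.escapeRate).sum =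
      ((F.fiber W).map fun w => ((F.fiber V).map fun v => Real.log ‖wedge w v‖).sum).sum +
        ratDegree f * (F.escapeRate W - Real.log ‖wedge W V‖) := by
    rw [← Multiset.sum_map_mul_left, Multiset.map_congr rfl key, Multiset.sum_map_add,
      Multiset.map_const', Multiset.sum_replicate, hc, nsmul_eq_mul]
  rw [mul_sub, hsum]
  ring

lemma sum_escapeRate_fiber_sub_eq_of_wedge_ne (hd : 1 < ratDegree f) {W V : Fin 2 → K}
    (hW : W ≠ 0) (hV : V ≠ 0) (hWV : wedge W V ≠ 0) :
    ((F.fiber W).map F.escapeRate).sum - F.escapeRate W =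
      ((F.fiber V).map F.escapeRate).sum - F.escapeRate V := by
  have hd0 : (ratDegree f : ℝ) ≠ 0 := by
    have : ratDegree f ≠ 0 := by omega
    exact_mod_cast this
  have hVW : wedge V W ≠ 0 := by rw [wedge_swap]; exact neg_ne_zero.2 hWV
  refine mul_left_cancel₀ hd0 ?_
  rw [F.mul_sum_escapeRate_fiber_sub hd hW hV hWV, F.mul_sum_escapeRate_fiber_sub hd hV hW hVW,
    Multiset.sum_map_sum_map, norm_wedge_swap V W]
  simp only [norm_wedge_swap]

/-- The sum of the escape rates over a fibre is the escape rate of the base point, up to an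
additive constant (which is `log |Res F| / deg f`). -/
lemma exists_sum_escapeRate_fiber (hd : 1 < ratDegree f) : ∃ ρ : ℝ, ∀ W : Fin 2 → K, W ≠ 0 →
    ((F.fiber W).map F.escapeRate).sum = F.escapeRate W + ρ := by
  set V : Fin 2 → K := ![1, 0]
  have hV : V ≠ 0 := coaffine_ne_zero 0
  refine ⟨((F.fiber V).map F.escapeRate).sum - F.escapeRate V, fun W hW => ?_⟩
  suffices h : ((F.fiber W).map F.escapeRate).sum - F.escapeRate W =
      ((F.fiber V).map F.escapeRate).sum - F.escapeRate V by rw [← h]; ring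
  by_cases hWV : wedge W V = 0
  · obtain ⟨c, hc⟩ := exists_smul_eq_of_wedge_eq_zero hV hWV
    obtain ⟨b, hb⟩ := exists_wedge_ne_zero hW
    have hb0 : b ≠ 0 := by rintro rfl; simp [wedge] at hb
    have hb' : wedge V b ≠ 0 := fun h => hb (by rw [hc, wedge_smul_left, h, mul_zero])
    exact (F.sum_escapeRate_fiber_sub_eq_of_wedge_ne hd hW hb0 hb).trans
      (F.sum_escapeRate_fiber_sub_eq_of_wedge_ne hd hV hb0 hb').symm
  · exact F.sum_escapeRate_fiber_sub_eq_of_wedge_ne hd hW hV hWV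

lemma sum_escapeRate_iterFiber (hd : 1 < ratDegree f) {ρ : ℝ}
    (hρ : ∀ W : Fin 2 → K, W ≠ 0 → ((F.fiber W).map F.escapeRate).sum = F.escapeRate W + ρ)
    (n : ℕ) {W : Fin 2 → K} (hW : W ≠ 0) :
    ((F.iterFiber n W).map F.escapeRate).sum =
      F.escapeRate W + ρ * ∑ k ∈ Finset.range n, (ratDegree f : ℝ) ^ k := by
  induction n with
  | zero => simp [iterFiber]
  | succ n ih =>
    obtain ⟨hc, hne, -⟩ := F.iterFiber_spec (by omega) n hW
    rw [iterFiber, Multiset.map_bind, Multiset.sum_bind,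
      Multiset.map_congr rfl fun w hw => hρ w (hne w hw), Multiset.sum_map_add, ih,
      Multiset.map_const', Multiset.sum_replicate, hc, Finset.sum_range_succ, nsmul_eq_mul]
    push_cast
    ring

end HomogeneousLift

end FiberSum

/-! ### The chordal derivative -/

section Derivative

variable [NontriviallyNormedField K]

lemma hasDerivAt_eval_line (P : MvPolynomial (Fin 2) K) (p v : Fin 2 → K) :
    HasDerivAt (fun t : K => MvPolynomial.eval (p + t • v) P)
      (∑ j, MvPolynomial.eval p (MvPolynomial.pderiv j P) * v j) 0 := by
  induction P using MvPolynomial.induction_on with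
  | C a => simpa using hasDerivAt_const (0 : K) a
  | add P Q hP hQ =>
    have := hP.add hQ
    simp only [map_add, add_mul, Finset.sum_add_distrib]
    exact this
  | mul_X P i hP =>
    have hX : HasDerivAt (fun t : K => MvPolynomial.eval (p + t • v) (MvPolynomial.X i)) (v i) 0 := by
      simpa using ((hasDerivAt_id (0 : K)).mul_const (v i)).const_add (p i)
    have := hP.mul hX
    simp only [zero_smul, add_zero] at this
    have e : (∑ j, MvPolynomial.eval p (MvPolynomial.pderiv j (P * MvPolynomial.X i)) * v j) =
        (∑ j, MvPolynomial.eval p (MvPolynomial.pderiv j P) * v j) *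
          MvPolynomial.eval p (MvPolynomial.X i) + MvPolynomial.eval p P * v i := by
      fin_cases i <;>
        simp [Derivation.leibniz, MvPolynomial.pderiv_X, Fin.sum_univ_two, Pi.single_apply] <;> ring
    rw [e]
    simp only [map_mul]
    exact this

/-- The filter of punctured neighbourhoods of `z` for the chordal metric. -/
def chordalPunctured (z : P1 K) : Filter (P1 K) := comap (fun w => chordal w z) (𝓝[>] 0)

lemma chordalPunctured_neBot (z : P1 K) : (chordalPunctured z).NeBot := by
  obtain ⟨b, hb⟩ := exists_wedge_ne_zero z.rep_nonzero
  have hw : ∀ t : K, wedge (z.rep + t • b) b = wedge z.rep b := fun t => by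
    simp only [wedge, Pi.add_apply, Pi.smul_apply, smul_eq_mul]; ring
  have hne : ∀ t : K, z.rep + t • b ≠ 0 := fun t h => hb (by rw [← hw t, h]; simp [wedge])
  have hch : ∀ t : K, chordal (Projectivization.mk K _ (hne t)) z =
      ‖t‖ * ‖wedge z.rep b‖ / (norm2 (z.rep + t • b) * norm2 z.rep) := by
    intro t
    rw [chordal_comm, chordal_mk_right, mul_comm (norm2 z.rep), ← norm_mul]
    congr 2
    simp only [wedge, Pi.add_apply, Pi.smul_apply, smul_eq_mul]; ring
  have hlim : Tendsto (fun t : K => chordal (Projectivization.mk K _ (hne t)) z) (𝓝[≠] 0)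
      (𝓝[>] 0) := by
    refine tendsto_nhdsWithin_iff.2 ⟨?_, ?_⟩
    · simp_rw [hch]
      have hc : Continuous fun t : K =>
          ‖t‖ * ‖wedge z.rep b‖ / (norm2 (z.rep + t • b) * norm2 z.rep) := by
        refine Continuous.div (by fun_prop) ?_ fun t =>
          (mul_pos (norm2_pos (hne t)) (norm2_pos z.rep_nonzero)).ne'
        exact (continuous_norm2.comp (by fun_prop)).mul continuous_const
      have := (hc.tendsto 0).mono_left (nhdsWithin_le_nhds (s := {0}ᶜ))
      simpa using this
    · filter_upwards [self_mem_nhdsWithin] with t ht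
      rw [hch]
      have h1 := norm2_pos (hne t)
      have h2 := norm2_pos z.rep_nonzero
      have h3 : 0 < ‖t‖ := norm_pos_iff.2 ht
      have h4 : 0 < ‖wedge z.rep b‖ := norm_pos_iff.2 hb
      exact Set.mem_Ioi.2 (by positivity)
  rw [chordalPunctured, comap_neBot_iff]
  intro s hs
  obtain ⟨t, ht⟩ := (hlim.eventually hs).exists
  exact ⟨_, ht⟩

lemma exists_section_chordalPunctured (z : P1 K) : ∃ (σ : P1 K → Fin 2 → K),
    (∀ᶠ w in chordalPunctured z, ∃ h : σ w ≠ 0, w = Projectivization.mk K (σ w) h) ∧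
      Tendsto σ (chordalPunctured z) (𝓝 z.rep) := by
  obtain ⟨b, hb⟩ := exists_wedge_ne_zero z.rep_nonzero
  set p := z.rep with hp
  have hch : Tendsto (fun w => chordal w z) (chordalPunctured z) (𝓝 0) :=
    (tendsto_comap (f := fun w => chordal w z) (x := 𝓝[>] 0)).mono_right nhdsWithin_le_nhds
  have hq : Tendsto (fun w : P1 K => ‖wedge w.rep p‖ / norm2 w.rep) (chordalPunctured z) (𝓝 0) := by
    have := hch.mul_const (norm2 p)
    rw [zero_mul] at this
    refine this.congr fun w => ?_
    have h1 := norm2_pos w.rep_nonzero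
    have h2 : 0 < norm2 p := norm2_pos z.rep_nonzero
    rw [chordal, ← hp]
    field_simp
  have hb0 : 0 < ‖wedge p b‖ := norm_pos_iff.2 hb
  have hbig : ∀ᶠ w in chordalPunctured z,
      ‖wedge p b‖ / (4 * (‖p‖ + 1)) * norm2 w.rep ≤ ‖wedge w.rep b‖ := by
    have hsmall : ∀ᶠ w in chordalPunctured z,
        ‖wedge w.rep p‖ / norm2 w.rep < ‖wedge p b‖ / (4 * (‖b‖ + 1)) :=
      hq.eventually (gt_mem_nhds (by positivity))
    filter_upwards [hsmall] with w hw
    have h1 := norm2_pos w.rep_nonzero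
    rw [div_lt_div_iff₀ h1 (by positivity)] at hw
    have h2 := norm_wedge_mul_norm_le p b w.rep
    have h3 := norm2_le_two_mul_norm w.rep
    rw [div_mul_eq_mul_div, div_le_iff₀ (by positivity)]
    nlinarith [norm_nonneg p, norm_nonneg b, norm_nonneg (wedge w.rep b),
      norm_nonneg (wedge w.rep p)]
  have hne : ∀ᶠ w in chordalPunctured z, wedge w.rep b ≠ 0 := by
    filter_upwards [hbig] with w hw h0
    have h1 := norm2_pos w.rep_nonzero
    rw [h0, norm_zero] at hw
    have : 0 < ‖wedge p b‖ / (4 * (‖p‖ + 1)) * norm2 w.rep := by positivity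
    linarith
  refine ⟨fun w => (wedge p b / wedge w.rep b) • w.rep, ?_, ?_⟩
  · filter_upwards [hne] with w hw
    have hc : wedge p b / wedge w.rep b ≠ 0 := div_ne_zero hb hw
    refine ⟨smul_ne_zero hc w.rep_nonzero, ?_⟩
    conv_lhs => rw [← w.mk_rep]
    rw [eq_comm, Projectivization.mk_eq_mk_iff']
    exact ⟨_, rfl⟩
  · have hcoef : Tendsto (fun w : P1 K => wedge p w.rep / wedge w.rep b) (chordalPunctured z)
        (𝓝 0) := by
      have hz := hq.mul_const (‖wedge p b‖ / (4 * (‖p‖ + 1)))⁻¹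
      rw [zero_mul] at hz
      rw [tendsto_zero_iff_norm_tendsto_zero]
      refine squeeze_zero' (Eventually.of_forall fun _ => norm_nonneg _) ?_ hz
      filter_upwards [hbig] with w hw
      have h1 := norm2_pos w.rep_nonzero
      rw [norm_div, norm_wedge_swap w.rep p, ← div_eq_mul_inv, div_div]
      refine div_le_div_of_nonneg_left (norm_nonneg _) (by positivity) ?_
      rwa [mul_comm (norm2 _)]
    have hlim := (hcoef.smul_const b).const_add p
    rw [zero_smul, add_zero] at hlim
    refine hlim.congr' ?_
    filter_upwards [hne] with w hw
    have := wedge_smul_eq p b w.rep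
    rw [div_eq_inv_mul, div_eq_inv_mul, mul_smul, mul_smul, this, smul_add,
      inv_smul_smul₀ hw]

namespace HomogeneousLift

variable {f : RatFunc K} (F : HomogeneousLift f)

lemma ratMap_mk {v : Fin 2 → K} (hv : v ≠ 0) : ratMap f (Projectivization.mk K v hv) =
    Projectivization.mk K (F.toMap v) (F.toMap_ne_zero hv) := (F.lifts v hv).symm

lemma continuous_toMap : Continuous F.toMap :=
  continuous_pi fun i => MvPolynomial.continuous_eval (F.poly i)

lemma euler (p : Fin 2 → K) (i : Fin 2) :
    ∑ j, MvPolynomial.eval p (MvPolynomial.pderiv j (F.poly i)) * p j =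
      ratDegree f * F.toMap p i := by
  have := congrArg (MvPolynomial.eval p) (F.isHomogeneous i).sum_X_mul_pderiv
  rw [map_sum, nsmul_eq_mul, map_mul, map_natCast] at this
  rw [toMap, ← this]
  refine Finset.sum_congr rfl fun j _ => ?_
  rw [map_mul, MvPolynomial.eval_X, mul_comm]

variable [IsAlgClosed K]

/-- `F(q) ∧ F(p)` is divisible by `q ∧ p`, and the quotient is `det DF(p) / d` at `q = p`. -/
lemma exists_wedge_toMap_eq_mul (hd : ratDegree f ≠ 0) {p : Fin 2 → K} (hp : p ≠ 0) :
    ∃ h : (Fin 2 → K) → K, Continuous h ∧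
      (∀ q, wedge (F.toMap q) (F.toMap p) = wedge q p * h q) ∧
      F.jacobianDet p = ratDegree f * h p := by
  obtain ⟨-, hne, hprod⟩ := F.fiber_spec hd (F.toMap_ne_zero hp)
  set s := F.fiber (F.toMap p)
  have h0 : (s.map (wedge p)).prod = 0 := by rw [← hprod, wedge_self]
  obtain ⟨w, hw, hw0⟩ := Multiset.mem_map.1 (Multiset.prod_eq_zero_iff.1 h0)
  have hwp : wedge w p = 0 := by rw [wedge_swap, hw0, neg_zero]
  obtain ⟨c, rfl⟩ := exists_smul_eq_of_wedge_eq_zero hp hwp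
  obtain ⟨s', hs'⟩ := Multiset.exists_cons_of_mem hw
  have hcont : Continuous fun q : Fin 2 → K => c * (s'.map (wedge q)).prod :=
    continuous_const.mul (continuous_multiset_prod _ fun w _ =>
      continuous_wedge.comp (Continuous.prodMk_left w))
  have hfac : ∀ q, wedge (F.toMap q) (F.toMap p) = wedge q p * (c * (s'.map (wedge q)).prod) := by
    intro q
    rw [hprod, hs', Multiset.map_cons, Multiset.prod_cons, wedge_smul_right]
    ring
  refine ⟨_, hcont, hfac, ?_⟩
  generalize hh : (fun q : Fin 2 → K => c * (s'.map (wedge q)).prod) = h at hcont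
  have hfac' : ∀ q, wedge (F.toMap q) (F.toMap p) = wedge q p * h q := by
    intro q; rw [hfac, ← hh]
  have e : c * (s'.map (wedge p)).prod = h p := by rw [← hh]
  rw [e]
  obtain ⟨v, hv⟩ := exists_wedge_ne_zero hp
  set D : Fin 2 → K := fun i => ∑ j, MvPolynomial.eval p (MvPolynomial.pderiv j (F.poly i)) * v j
    with hD
  have hder : HasDerivAt (fun t : K => wedge (F.toMap (p + t • v)) (F.toMap p))
      (wedge D (F.toMap p)) 0 :=
    ((hasDerivAt_eval_line (F.poly 0) p v).mul_const (F.toMap p 1)).sub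
      ((hasDerivAt_eval_line (F.poly 1) p v).mul_const (F.toMap p 0))
  have hlim := hasDerivAt_iff_tendsto_slope_zero.1 hder
  have hlim2 : Tendsto (fun t : K => wedge v p * h (p + t • v)) (𝓝[≠] 0) (𝓝 (wedge v p * h p)) := by
    have hc : Continuous fun t : K => wedge v p * h (p + t • v) :=
      continuous_const.mul (hcont.comp (by fun_prop))
    have := (hc.tendsto 0).mono_left (nhdsWithin_le_nhds (s := {0}ᶜ))
    simpa using this
  have heq : wedge D (F.toMap p) = wedge v p * h p := by
    refine tendsto_nhds_unique hlim (hlim2.congr' ?_)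
    filter_upwards [self_mem_nhdsWithin] with t ht
    have ht' : t ≠ 0 := ht
    rw [zero_add, zero_smul, add_zero, wedge_self, sub_zero, hfac', smul_eq_mul]
    have : wedge (p + t • v) p = t * wedge v p := by
      simp only [wedge, Pi.add_apply, Pi.smul_apply, smul_eq_mul]; ring
    rw [this]
    field_simp
  have e0 := F.euler p 0
  have e1 := F.euler p 1
  have hvp : wedge v p ≠ 0 := by rw [wedge_swap]; exact neg_ne_zero.2 hv
  refine mul_left_cancel₀ hvp ?_
  have h3 : wedge v p * F.jacobianDet p = ratDegree f * wedge D (F.toMap p) := by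
    simp only [wedge, hD, jacobianDet, Matrix.det_fin_two, Matrix.of_apply, Fin.sum_univ_two] at *
    linear_combination
      (-(MvPolynomial.eval p (MvPolynomial.pderiv 0 (F.poly 1)) * v 0 +
        MvPolynomial.eval p (MvPolynomial.pderiv 1 (F.poly 1)) * v 1)) * e0 +
      (MvPolynomial.eval p (MvPolynomial.pderiv 0 (F.poly 0)) * v 0 +
        MvPolynomial.eval p (MvPolynomial.pderiv 1 (F.poly 0)) * v 1) * e1
  rw [h3, heq]
  ring

lemma chordalDeriv_eq (hd : ratDegree f ≠ 0) (z : P1 K) :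
    chordalDeriv f z * ‖(ratDegree f : K)‖ =
      ‖F.jacobianDet z.rep‖ * norm2 z.rep ^ 2 / norm2 (F.toMap z.rep) ^ 2 := by
  obtain ⟨h, hcont, hfac, hjac⟩ := F.exists_wedge_toMap_eq_mul hd z.rep_nonzero
  obtain ⟨σ, hev, hσ⟩ := exists_section_chordalPunctured z
  have : (comap (fun w => chordal w z) (𝓝[>] 0)).NeBot := chordalPunctured_neBot z
  set p := z.rep with hp
  have hp0 : p ≠ 0 := z.rep_nonzero
  have hFp := norm2_pos (F.toMap_ne_zero hp0)
  have hpp := norm2_pos hp0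
  have hlim : Tendsto (fun w => ‖h (σ w)‖ * (norm2 (σ w) * norm2 p) /
      (norm2 (F.toMap (σ w)) * norm2 (F.toMap p))) (chordalPunctured z)
      (𝓝 (‖h p‖ * (norm2 p * norm2 p) / (norm2 (F.toMap p) * norm2 (F.toMap p)))) := by
    have c1 := ((hcont.norm).tendsto p).comp hσ
    have c2 := (continuous_norm2.tendsto p).comp hσ
    have c3 := ((continuous_norm2.comp F.continuous_toMap).tendsto p).comp hσ
    exact (c1.mul (c2.mul_const _)).div (c3.mul_const _) (mul_pos hFp hFp).ne'
  have hz : z = Projectivization.mk K p hp0 := z.mk_rep.symm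
  have hpos : ∀ᶠ w in chordalPunctured z, 0 < chordal w z :=
    tendsto_comap.eventually (self_mem_nhdsWithin (a := (0 : ℝ)) (s := Set.Ioi 0))
  have hder : chordalDeriv f z =
      ‖h p‖ * (norm2 p * norm2 p) / (norm2 (F.toMap p) * norm2 (F.toMap p)) := by
    refine Tendsto.limUnder_eq (hlim.congr' ?_)
    filter_upwards [hev, hpos] with w hw hwz
    obtain ⟨hσ0, hw⟩ := hw
    have h1 := norm2_pos hσ0
    have h2 := norm2_pos (F.toMap_ne_zero hσ0)
    rw [hz] at hwz ⊢
    rw [hw, chordal_mk] at hwz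
    have h3 : ‖wedge (σ w) p‖ ≠ 0 := by
      intro h3
      rw [h3, zero_div] at hwz
      exact lt_irrefl _ hwz
    conv_rhs => rw [hw]
    rw [F.ratMap_mk, F.ratMap_mk, chordal_mk, chordal_mk, hfac, norm_mul]
    field_simp
  rw [hder, hjac, norm_mul]
  field_simp

end HomogeneousLift

end Derivative

/-! ### Logarithmic integrals -/

section LogIntegral

variable {X : Type*} [MeasurableSpace X] {μ : Measure X}

lemma log_of_lintegral_negLog {φ : X → ℝ} (hφ : Measurable φ) (h0 : ∀ x, 0 ≤ φ x)
    (h1 : ∀ x, φ x ≤ 1) {r : ℝ} (hr : 0 ≤ r) (h : ∫⁻ x, negLog (φ x) ∂μ = ENNReal.ofReal r) :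
    (∀ᵐ x ∂μ, φ x ≠ 0) ∧ Integrable (fun x => Real.log (φ x)) μ ∧
      ∫ x, Real.log (φ x) ∂μ = -r := by
  have hae : ∀ᵐ x ∂μ, φ x ≠ 0 := by
    have := ae_lt_top (measurable_negLog.comp hφ) (by
      rw [show ∫⁻ x, (negLog ∘ φ) x ∂μ = _ from h]
      exact ENNReal.ofReal_ne_top)
    filter_upwards [this] with x hx hx0
    simp [hx0, negLog_zero] at hx
  have hm : Measurable fun x => -Real.log (φ x) := (Real.measurable_log.comp hφ).neg
  have hnn : ∀ x, 0 ≤ -Real.log (φ x) := fun x =>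
    neg_nonneg.2 (Real.log_nonpos (h0 x) (h1 x))
  have h' : ∫⁻ x, ENNReal.ofReal (-Real.log (φ x)) ∂μ = ENNReal.ofReal r := by
    rw [← h]
    refine lintegral_congr_ae ?_
    filter_upwards [hae] with x hx
    rw [negLog_of_ne hx]
  have hint : Integrable (fun x => -Real.log (φ x)) μ := by
    rw [← lintegral_ofReal_ne_top_iff_integrable hm.aestronglyMeasurable
      (Eventually.of_forall hnn), h']
    exact ENNReal.ofReal_ne_top
  refine ⟨hae, by simpa using hint.neg, ?_⟩
  have := integral_eq_lintegral_of_nonneg_ae (μ := μ) (Eventually.of_forall hnn)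
    hm.aestronglyMeasurable
  rw [h', ENNReal.toReal_ofReal hr, integral_neg] at this
  linarith

lemma lintegral_negLog_of_integrable {φ : X → ℝ} (hae : ∀ᵐ x ∂μ, φ x ≠ 0)
    (h0 : ∀ x, 0 ≤ φ x) (h1 : ∀ x, φ x ≤ 1) (hint : Integrable (fun x => Real.log (φ x)) μ) :
    ∫⁻ x, negLog (φ x) ∂μ = ENNReal.ofReal (-∫ x, Real.log (φ x) ∂μ) := by
  have hneg : Integrable (fun x => -Real.log (φ x)) μ := hint.neg
  rw [← integral_neg, ofReal_integral_eq_lintegral_ofReal hneg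
    (Eventually.of_forall fun x => neg_nonneg.2 (Real.log_nonpos (h0 x) (h1 x)))]
  refine lintegral_congr_ae ?_
  filter_upwards [hae] with x hx
  rw [negLog_of_ne hx]

end LogIntegral

/-- The potential-theoretic facts about the Hsia kernel on which the critical point formula rests:
the potential of `Ω_can` is constant, the kernel is conditionally negative definite, and
the mean against `Ω_can` of the potential of the image of a measure under a self-map of `ℙ¹` is the
same constant. -/
structure HasPotentialTheory (K : Type*) [NormedField K] (h₀ : ℝ) : Prop where
  nonneg : 0 ≤ h₀
  potential_canonicalMeasure : ∀ x : BerkP1 K,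
    ∫⁻ y, negLogHsia x y ∂(canonicalMeasure K) = ENNReal.ofReal h₀
  energy_le : ∀ μ ν : Measure (BerkP1 K), IsProbabilityMeasure μ → μ.Regular →
    IsProbabilityMeasure ν → ν.Regular →
    2 * ∫⁻ x, ∫⁻ y, negLogHsia x y ∂μ ∂ν ≤
      ∫⁻ x, ∫⁻ y, negLogHsia x y ∂ν ∂ν + ∫⁻ x, ∫⁻ y, negLogHsia x y ∂μ ∂μ
  mean_image_potential : ∀ (μ : Measure (BerkP1 K)) (ψ : P1 K → P1 K) (V : P1 K → BerkP1 K → ℝ)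
    (g : BerkP1 K → ℝ) (κ : ℝ), IsProbabilityMeasure μ → Continuous g →
    (∀ w x, Tendsto (fun z => chordal (ψ z) w) (trace x) (𝓝 (V w x))) →
    (∀ w, g (toBerk w) + κ ≤ 0) →
    (∀ w, ∫⁻ x, negLog (V w x) ∂μ = ENNReal.ofReal (-(g (toBerk w) + κ))) →
    ∫ x, g x ∂(canonicalMeasure K) + κ = -h₀

section Main

variable [NontriviallyNormedField K] [IsAlgClosed K] [∀ x : BerkP1 K, (trace x).NeBot]

lemma integrable_of_continuous {g : BerkP1 K → ℝ} (hg : Continuous g) (μ : Measure (BerkP1 K))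
    [IsFiniteMeasure μ] : Integrable g μ := by
  obtain ⟨C, hC⟩ := isCompact_univ.exists_bound_of_continuousOn hg.continuousOn
  exact Integrable.of_bound hg.measurable.aestronglyMeasurable C
    (Eventually.of_forall fun x => hC x (Set.mem_univ x))

/-- The potential of `μ` is `g + a`. -/
lemma exists_potential_eq {h₀ : ℝ} (hK : HasPotentialTheory K h₀) {g : BerkP1 K → ℝ}
    {μ : Measure (BerkP1 K)} (h : HasLaplacian g μ (canonicalMeasure K)) :
    ∃ a : ℝ, ∀ x, g x + a ≤ 0 ∧ ∫⁻ y, negLogHsia x y ∂μ = ENNReal.ofReal (-(g x + a)) := by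
  obtain ⟨-, c, hc⟩ := h
  refine ⟨-h₀ - c, fun x => ?_⟩
  have hx := hc x
  rw [logPotential, logPotential, hK.potential_canonicalMeasure,
    EReal.coe_ennreal_ofReal, max_eq_left hK.nonneg] at hx
  generalize hU : ∫⁻ y, negLogHsia x y ∂μ = U at hx ⊢
  have hUtop : U ≠ ⊤ := by
    rintro rfl
    rw [EReal.coe_ennreal_top, EReal.neg_top, EReal.bot_add] at hx
    rw [← EReal.coe_neg, ← EReal.coe_add] at hx
    exact EReal.coe_ne_bot _ hx
  lift U to NNReal using hUtop
  rw [show ((U : ℝ≥0∞) : EReal) = ((U : ℝ) : EReal) from rfl, ← EReal.coe_neg, ← EReal.coe_add,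
    ← EReal.coe_neg, ← EReal.coe_add, EReal.coe_eq_coe_iff] at hx
  have e : -(g x + (-h₀ - c)) = (U : ℝ) := by linarith
  refine ⟨?_, ?_⟩
  · have := U.coe_nonneg
    linarith
  · rw [e, ENNReal.ofReal_coe_nnreal]

lemma integral_eq_of_equilibriumEnergy_eq_zero {h₀ : ℝ} (hK : HasPotentialTheory K h₀)
    {g : BerkP1 K → ℝ} (hg : Continuous g) {μ : Measure (BerkP1 K)} [IsProbabilityMeasure μ]
    (hμ : μ.Regular) {a : ℝ}
    (ha : ∀ x, g x + a ≤ 0 ∧ ∫⁻ y, negLogHsia x y ∂μ = ENNReal.ofReal (-(g x + a)))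
    (hV : equilibriumEnergy g = 0) : ∫ x, g x ∂μ = a := by
  have hmix : ∀ ν : Measure (BerkP1 K), IsProbabilityMeasure ν →
      ∫⁻ x, ∫⁻ y, negLogHsia x y ∂μ ∂ν = ENNReal.ofReal (-(∫ x, g x ∂ν + a)) ∧
        ∫ x, g x ∂ν + a ≤ 0 := by
    intro ν hν
    have hi : Integrable (fun x => -(g x + a)) ν :=
      ((integrable_of_continuous hg ν).add (integrable_const a)).neg
    have e : ∫ x, -(g x + a) ∂ν = -(∫ x, g x ∂ν + a) := by
      rw [integral_neg, integral_add (integrable_of_continuous hg ν) (integrable_const a)]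
      simp
    refine ⟨?_, ?_⟩
    · rw [← e, ofReal_integral_eq_lintegral_ofReal hi
        (Eventually.of_forall fun x => neg_nonneg.2 (ha x).1)]
      exact lintegral_congr fun x => (ha x).2
    · have : 0 ≤ ∫ x, -(g x + a) ∂ν := integral_nonneg fun x => neg_nonneg.2 (ha x).1
      linarith
  obtain ⟨hJ, hJ0⟩ := hmix μ inferInstance
  have hμE : energy g μ = ((a - ∫ x, g x ∂μ : ℝ) : EReal) := by
    rw [energy, hJ, EReal.coe_ennreal_ofReal, max_eq_left (by linarith), ← EReal.coe_neg,
      ← EReal.coe_sub]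
    congr 1
    ring
  have hle : ∀ ν : Measure (BerkP1 K), IsProbabilityMeasure ν → ν.Regular →
      energy g ν ≤ ((a - ∫ x, g x ∂μ : ℝ) : EReal) := by
    intro ν hν hνr
    obtain ⟨hm, hm0⟩ := hmix ν hν
    have hdef := hK.energy_le μ ν inferInstance hμ hν hνr
    rw [hm, hJ] at hdef
    rw [energy]
    generalize (∫⁻ x, ∫⁻ y, negLogHsia x y ∂ν ∂ν) = J at hdef ⊢
    by_cases hJt : J = ⊤
    · rw [hJt, EReal.coe_ennreal_top, EReal.neg_top, EReal.bot_sub]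
      exact bot_le
    · lift J to NNReal using hJt
      rw [show ((J : ℝ≥0∞) : EReal) = ((J : ℝ) : EReal) from rfl, ← EReal.coe_neg,
        ← EReal.coe_sub, EReal.coe_le_coe_iff]
      rw [show (2 : ℝ≥0∞) = ENNReal.ofReal 2 by simp, ← ENNReal.ofReal_mul (by norm_num),
        ← ENNReal.ofReal_coe_nnreal, ← ENNReal.ofReal_add J.coe_nonneg (by linarith),
        ENNReal.ofReal_le_ofReal_iff (add_nonneg J.coe_nonneg (by linarith))] at hdef
      linarith
  have h1 : energy g μ ≤ 0 := by
    rw [← hV, equilibriumEnergy]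
    exact le_iSup₂ (f := fun (ν : Measure (BerkP1 K))
      (_ : ν ∈ {ν : Measure (BerkP1 K) | IsProbabilityMeasure ν ∧ ν.Regular}) => energy g ν)
      μ ⟨inferInstance, hμ⟩
  have h2 : (0 : EReal) ≤ ((a - ∫ x, g x ∂μ : ℝ) : EReal) := by
    rw [← hV, equilibriumEnergy]
    exact iSup₂_le fun ν hν => hle ν hν.1 hν.2
  rw [hμE] at h1
  have h1' : a - ∫ x, g x ∂μ ≤ 0 := by exact_mod_cast h1
  have h2' : 0 ≤ a - ∫ x, g x ∂μ := by exact_mod_cast h2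
  linarith

open Classical in
/-- The point of `𝖯¹` represented by a vector. -/
def vecPt (w : Fin 2 → K) : BerkP1 K :=
  if h : w = 0 then OnePoint.infty else toBerk (Projectivization.mk K w h)

lemma vecPt_of_ne {w : Fin 2 → K} (h : w ≠ 0) :
    vecPt w = toBerk (Projectivization.mk K w h) := dif_neg h

lemma tendsto_prod_hsia (x : BerkP1 K) (s : Multiset (Fin 2 → K)) (hs : ∀ w ∈ s, w ≠ 0) :
    Tendsto (fun z : P1 K => ‖(s.map (wedge z.rep)).prod‖ / norm2 z.rep ^ s.card)
      (trace x) (𝓝 (s.map fun w => hsia x (vecPt w) * norm2 w).prod) := by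
  induction s using Multiset.induction_on with
  | empty => simp
  | cons a s ih =>
    have hr := ih fun w hw => hs w (Multiset.mem_cons_of_mem hw)
    have ha : a ≠ 0 := hs a (Multiset.mem_cons_self a s)
    rw [Multiset.map_cons, Multiset.prod_cons, vecPt_of_ne ha]
    refine (((tendsto_chordal x (Projectivization.mk K a ha)).mul_const (norm2 a)).mul
      hr).congr fun z => ?_
    have h1 := norm2_pos z.rep_nonzero
    have h2 := norm2_pos ha
    rw [chordal_mk_right, Multiset.map_cons, Multiset.prod_cons, norm_mul, Multiset.card_cons,
      pow_succ]
    field_simp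

/-- The logarithmic integral of a product of linear forms against a measure with potential
`g + a`. -/
lemma integral_sum_log_hsia {g : BerkP1 K → ℝ} {μ : Measure (BerkP1 K)} [IsProbabilityMeasure μ]
    {a : ℝ} (ha : ∀ x, g x + a ≤ 0 ∧ ∫⁻ y, negLogHsia x y ∂μ = ENNReal.ofReal (-(g x + a)))
    (s : Multiset (Fin 2 → K)) (hs : ∀ w ∈ s, w ≠ 0) :
    (∀ᵐ x ∂μ, ∀ w ∈ s, hsia x (vecPt w) * norm2 w ≠ 0) ∧
      Integrable (fun x => (s.map fun w => Real.log (hsia x (vecPt w) * norm2 w)).sum) μ ∧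
      ∫ x, (s.map fun w => Real.log (hsia x (vecPt w) * norm2 w)).sum ∂μ =
        (s.map fun w => g (vecPt w) + Real.log (norm2 w)).sum + s.card * a := by
  induction s using Multiset.induction_on with
  | empty => simp
  | cons w s ih =>
    obtain ⟨ih1, ih2, ih3⟩ := ih fun w hw => hs w (Multiset.mem_cons_of_mem hw)
    have hw : w ≠ 0 := hs w (Multiset.mem_cons_self w s)
    have hw' := norm2_pos hw
    obtain ⟨h1, h2, h3⟩ := log_of_lintegral_negLog (μ := μ) (measurable_hsia (vecPt w))
      (fun x => hsia_nonneg _ x) (fun x => hsia_le_one _ x) (neg_nonneg.2 (ha (vecPt w)).1)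
      (ha (vecPt w)).2
    simp only [hsia_comm (vecPt w)] at h1 h2 h3
    have hlog : (fun x => Real.log (hsia x (vecPt w) * norm2 w)) =ᵐ[μ]
        fun x => Real.log (hsia x (vecPt w)) + Real.log (norm2 w) := by
      filter_upwards [h1] with x hx
      rw [Real.log_mul hx hw'.ne']
    have hint : Integrable (fun x => Real.log (hsia x (vecPt w) * norm2 w)) μ :=
      (h2.add (integrable_const _)).congr hlog.symm
    refine ⟨?_, ?_, ?_⟩
    · filter_upwards [h1, ih1] with x hx1 hx2 v hv
      rcases Multiset.mem_cons.1 hv with rfl | hv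
      · exact mul_ne_zero hx1 hw'.ne'
      · exact hx2 v hv
    · simp only [Multiset.map_cons, Multiset.sum_cons]
      exact hint.add ih2
    · simp only [Multiset.map_cons, Multiset.sum_cons, Multiset.card_cons]
      rw [integral_add hint ih2, ih3, integral_congr_ae hlog,
        integral_add h2 (integrable_const _), h3]
      simp
      ring

namespace HomogeneousLift

variable {f : RatFunc K} (F : HomogeneousLift f)

lemma escapeRate_eq_vecPt {w : Fin 2 → K} (hw : w ≠ 0) :
    F.escapeRate w = F.green (vecPt w) + Real.log (norm2 w) := by
  rw [F.escapeRate_of_ne hw, vecPt_of_ne hw]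

lemma sum_green_vecPt {s : Multiset (Fin 2 → K)} (hs : ∀ w ∈ s, w ≠ 0) :
    (s.map fun w => F.green (vecPt w) + Real.log (norm2 w)).sum = (s.map F.escapeRate).sum := by
  rw [Multiset.map_congr rfl fun w hw => (F.escapeRate_eq_vecPt (hs w hw)).symm]

/-- The self-map `fⁿ` of `ℙ¹`. -/
def iterMap (n : ℕ) (z : P1 K) : P1 K :=
  Projectivization.mk K (F.toMap^[n] z.rep) (F.iterate_toMap_ne_zero n z.rep_nonzero)

/-- The continuous extension of `[fⁿ(·), π W]` to `𝖯¹`. -/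
def iterChordal (n : ℕ) (W : Fin 2 → K) (x : BerkP1 K) : ℝ :=
  ((F.iterFiber n W).map fun w => hsia x (vecPt w) * norm2 w).prod *
    (Real.exp (-F.T n x) / norm2 W)

lemma exp_neg_logRatio (n : ℕ) (z : P1 K) : Real.exp (-F.logRatio n z) =
    norm2 z.rep ^ ratDegree f ^ n / norm2 (F.toMap^[n] z.rep) := by
  have h1 := norm2_pos z.rep_nonzero
  have h2 := norm2_pos (F.iterate_toMap_ne_zero n z.rep_nonzero)
  rw [logRatio, neg_sub, Real.exp_sub, Real.exp_log h2, ← Nat.cast_pow, ← Real.log_pow,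
    Real.exp_log (by positivity)]

lemma tendsto_iterChordal (hd : ratDegree f ≠ 0) (n : ℕ) {W : Fin 2 → K} (hW : W ≠ 0)
    (x : BerkP1 K) :
    Tendsto (fun z => chordal (F.iterMap n z) (Projectivization.mk K W hW)) (trace x)
      (𝓝 (F.iterChordal n W x)) := by
  obtain ⟨hc, hne, hprod⟩ := F.iterFiber_spec hd n hW
  have h1 := tendsto_prod_hsia x _ hne
  have h2 := (Real.continuous_exp.tendsto _).comp (F.tendsto_logRatio hd n x).neg
  refine (h1.mul (h2.div_const (norm2 W))).congr fun z => ?_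
  have h3 := norm2_pos z.rep_nonzero
  have h4 := norm2_pos (F.iterate_toMap_ne_zero n z.rep_nonzero)
  have h5 := norm2_pos hW
  rw [Function.comp_apply, F.exp_neg_logRatio, iterMap, chordal_mk, hprod, hc]
  field_simp

/-- The integral of `log [fⁿ(·), π W]` against a measure with potential `g_F + a`. -/
lemma integral_log_iterChordal (hd : 1 < ratDegree f) {μ : Measure (BerkP1 K)}
    [IsProbabilityMeasure μ] {a : ℝ}
    (ha : ∀ x, F.green x + a ≤ 0 ∧ ∫⁻ y, negLogHsia x y ∂μ = ENNReal.ofReal (-(F.green x + a)))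
    {ρ : ℝ}
    (hρ : ∀ W : Fin 2 → K, W ≠ 0 → ((F.fiber W).map F.escapeRate).sum = F.escapeRate W + ρ)
    (n : ℕ) {W : Fin 2 → K} (hW : W ≠ 0) :
    (∀ᵐ x ∂μ, F.iterChordal n W x ≠ 0) ∧
      Integrable (fun x => Real.log (F.iterChordal n W x)) μ ∧
      ∫ x, Real.log (F.iterChordal n W x) ∂μ = F.green (vecPt W) +
        (ρ * ∑ k ∈ Finset.range n, (ratDegree f : ℝ) ^ k + (ratDegree f : ℝ) ^ n * a -
          ∫ x, F.T n x ∂μ) := by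
  obtain ⟨hc, hne, -⟩ := F.iterFiber_spec (by omega) n hW
  obtain ⟨h1, h2, h3⟩ := integral_sum_log_hsia ha _ hne
  have hWp := norm2_pos hW
  have hT := integrable_of_continuous (F.continuous_T (by omega) n) μ
  have hprod : ∀ᵐ x ∂μ,
      ((F.iterFiber n W).map fun w => hsia x (vecPt w) * norm2 w).prod ≠ 0 := by
    filter_upwards [h1] with x hx h0
    obtain ⟨b, hb, hb0⟩ := Multiset.mem_map.1 (Multiset.prod_eq_zero_iff.1 h0)
    exact hx b hb hb0
  have hlog : (fun x => Real.log (F.iterChordal n W x)) =ᵐ[μ] fun x =>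
      ((F.iterFiber n W).map fun w => Real.log (hsia x (vecPt w) * norm2 w)).sum -
        (F.T n x + Real.log (norm2 W)) := by
    filter_upwards [h1, hprod] with x hx hx'
    have he : Real.exp (-F.T n x) / norm2 W ≠ 0 := by positivity
    rw [iterChordal, Real.log_mul hx' he, log_multiset_prod _ _ hx,
      Real.log_div (Real.exp_ne_zero _) hWp.ne', Real.log_exp]
    ring
  have hi2 : Integrable (fun x => F.T n x + Real.log (norm2 W)) μ := hT.add (integrable_const _)
  refine ⟨?_, (h2.sub hi2).congr hlog.symm, ?_⟩
  · filter_upwards [hprod] with x hx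
    exact mul_ne_zero hx (by positivity)
  · rw [integral_congr_ae hlog, integral_sub h2 hi2, h3, integral_add hT (integrable_const _),
      F.sum_green_vecPt hne, F.sum_escapeRate_iterFiber hd hρ n hW, hc, F.escapeRate_eq_vecPt hW]
    simp
    ring

lemma iterChordal_mem (hd : ratDegree f ≠ 0) (n : ℕ) {W : Fin 2 → K} (hW : W ≠ 0)
    (x : BerkP1 K) : 0 ≤ F.iterChordal n W x ∧ F.iterChordal n W x ≤ 1 :=
  ⟨ge_of_tendsto (F.tendsto_iterChordal hd n hW x) (Eventually.of_forall fun _ => chordal_nonneg _ _),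
    le_of_tendsto (F.tendsto_iterChordal hd n hW x) (Eventually.of_forall fun _ => chordal_le_one _ _)⟩

lemma mean_green_add {h₀ : ℝ} (hK : HasPotentialTheory K h₀) (hd : 1 < ratDegree f)
    (hg : Continuous F.green) {μ : Measure (BerkP1 K)} [IsProbabilityMeasure μ] {a : ℝ}
    (ha : ∀ x, F.green x + a ≤ 0 ∧ ∫⁻ y, negLogHsia x y ∂μ = ENNReal.ofReal (-(F.green x + a)))
    {ρ : ℝ}
    (hρ : ∀ W : Fin 2 → K, W ≠ 0 → ((F.fiber W).map F.escapeRate).sum = F.escapeRate W + ρ)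
    (n : ℕ) :
    ∫ x, F.green x ∂(canonicalMeasure K) +
      (ρ * ∑ k ∈ Finset.range n, (ratDegree f : ℝ) ^ k + (ratDegree f : ℝ) ^ n * a -
        ∫ x, F.T n x ∂μ) = -h₀ := by
  have hd0 : ratDegree f ≠ 0 := by omega
  have hpt : ∀ w : P1 K, toBerk w = vecPt w.rep := fun w => by
    rw [vecPt_of_ne w.rep_nonzero, w.mk_rep]
  have key := fun w : P1 K => F.integral_log_iterChordal hd ha hρ n w.rep_nonzero
  have hmem := fun w : P1 K => F.iterChordal_mem hd0 n w.rep_nonzero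
  refine hK.mean_image_potential μ (F.iterMap n) (fun w => F.iterChordal n w.rep) F.green _
    inferInstance hg (fun w x => ?_) (fun w => ?_) (fun w => ?_)
  · have := F.tendsto_iterChordal hd0 n w.rep_nonzero x
    rwa [w.mk_rep] at this
  · rw [hpt, ← (key w).2.2]
    exact integral_nonpos fun x => Real.log_nonpos (hmem w x).1 (hmem w x).2
  · rw [hpt, ← (key w).2.2]
    exact lintegral_negLog_of_integrable (key w).1 (fun x => (hmem w x).1)
      (fun x => (hmem w x).2) (key w).2.1

lemma integral_T_one {h₀ : ℝ} (hK : HasPotentialTheory K h₀) (hd : 1 < ratDegree f)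
    (hg : Continuous F.green) {μ : Measure (BerkP1 K)} [IsProbabilityMeasure μ] {a : ℝ}
    (ha : ∀ x, F.green x + a ≤ 0 ∧ ∫⁻ y, negLogHsia x y ∂μ = ENNReal.ofReal (-(F.green x + a)))
    (hint : ∫ x, F.green x ∂μ = a) : ∫ x, F.T 1 x ∂μ = ((ratDegree f : ℝ) - 1) * a := by
  obtain ⟨ρ, hρ⟩ := F.exists_sum_escapeRate_fiber hd
  have hd1 : (1 : ℝ) < ratDegree f := by exact_mod_cast hd
  have hT0 : ∫ x, F.T 0 x ∂μ = 0 := by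
    have : ∀ x, F.T 0 x = 0 := fun x => by
      have h := F.tendsto_logRatio (by omega) 0 x
      have e : F.logRatio 0 = fun _ : P1 K => (0 : ℝ) := by
        ext z
        simp [logRatio]
      rw [e] at h
      exact tendsto_nhds_unique h tendsto_const_nhds
    simp [this]
  have h0 := F.mean_green_add hK hd hg ha hρ 0
  have hn : ∀ n, ∫ x, F.T n x ∂μ =
      ρ * ∑ k ∈ Finset.range n, (ratDegree f : ℝ) ^ k + (ratDegree f : ℝ) ^ n * a - a := by
    intro n
    have := F.mean_green_add hK hd hg ha hρ n
    simp only [hT0, Finset.range_zero, Finset.sum_empty, mul_zero, pow_zero, one_mul, zero_add,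
      sub_zero] at h0
    linarith
  obtain ⟨C, hC⟩ := F.exists_abs_T_div_sub_green_le hd
  have hbound : ∀ n : ℕ, |ρ| * n ≤ C + |a| := by
    intro n
    have hTi := integrable_of_continuous (F.continuous_T (by omega) n) μ
    have hgi := integrable_of_continuous hg μ
    have hpos : (0 : ℝ) < (ratDegree f : ℝ) ^ n := by positivity
    have h1 : ∀ x, |F.T n x - (ratDegree f : ℝ) ^ n * F.green x| ≤ C := by
      intro x
      have := hC n x
      have e : F.T n x - (ratDegree f : ℝ) ^ n * F.green x =
          (ratDegree f : ℝ) ^ n * (F.T n x / (ratDegree f : ℝ) ^ n - F.green x) := by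
        field_simp
      rw [e, abs_mul, abs_of_pos hpos]
      calc _ ≤ (ratDegree f : ℝ) ^ n * (C * ((ratDegree f : ℝ)⁻¹) ^ n) := by gcongr
        _ = C := by rw [inv_pow]; field_simp
    have h2 : |∫ x, F.T n x ∂μ - (ratDegree f : ℝ) ^ n * a| ≤ C := by
      have e : ∫ x, F.T n x ∂μ - (ratDegree f : ℝ) ^ n * a =
          ∫ x, (F.T n x - (ratDegree f : ℝ) ^ n * F.green x) ∂μ := by
        rw [integral_sub hTi (hgi.const_mul _), integral_const_mul, hint]
      rw [e]
      have := norm_integral_le_of_norm_le_const (μ := μ) (C := C)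
        (f := fun x => F.T n x - (ratDegree f : ℝ) ^ n * F.green x) (Eventually.of_forall h1)
      simpa using this
    rw [hn] at h2
    have h3 : |ρ * ∑ k ∈ Finset.range n, (ratDegree f : ℝ) ^ k| ≤ C + |a| := by
      have e : ρ * ∑ k ∈ Finset.range n, (ratDegree f : ℝ) ^ k =
          (ρ * ∑ k ∈ Finset.range n, (ratDegree f : ℝ) ^ k + (ratDegree f : ℝ) ^ n * a - a -
            (ratDegree f : ℝ) ^ n * a) + a := by ring
      rw [e]
      exact (abs_add_le _ _).trans (by linarith)
    have h4 : (n : ℝ) ≤ ∑ k ∈ Finset.range n, (ratDegree f : ℝ) ^ k := by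
      have : ∑ k ∈ Finset.range n, (1 : ℝ) ≤ ∑ k ∈ Finset.range n, (ratDegree f : ℝ) ^ k :=
        Finset.sum_le_sum fun k _ => one_le_pow₀ hd1.le
      simpa using this
    rw [abs_mul, abs_of_nonneg (le_trans (Nat.cast_nonneg n) h4)] at h3
    exact (mul_le_mul_of_nonneg_left h4 (abs_nonneg ρ)).trans h3
  have hρ0 : ρ = 0 := by
    by_contra h
    have hp : 0 < |ρ| := abs_pos.2 h
    obtain ⟨n, hn⟩ := exists_nat_gt ((C + |a|) / |ρ|)
    rw [div_lt_iff₀ hp] at hn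
    have := hbound n
    linarith
  rw [hn 1, hρ0]
  ring

lemma chordalDerivBerk_eq [CharZero K] (hd : 1 < ratDegree f)
    (C : Fin (2 * ratDegree f - 2) → (Fin 2 → K)) (hC : ∀ j, C j ≠ 0)
    (hdet : ∀ v : Fin 2 → K, F.jacobianDet v = ∏ j, wedge v (C j)) (x : BerkP1 K) :
    chordalDerivBerk f x =
      ((Finset.univ.val.map C).map fun w => hsia x (vecPt w) * norm2 w).prod *
        (Real.exp (-F.T 1 x) ^ 2 / ‖(ratDegree f : K)‖) := by
  have hs : ∀ w ∈ Finset.univ.val.map C, w ≠ 0 := by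
    intro w hw
    obtain ⟨j, -, rfl⟩ := Multiset.mem_map.1 hw
    exact hC j
  have h1 := tendsto_prod_hsia x _ hs
  have h2 := (Real.continuous_exp.tendsto _).comp (F.tendsto_logRatio (by omega) 1 x).neg
  refine extendBerk_eq ((h1.mul ((h2.pow 2).div_const _)).congr fun z => ?_)
  have h3 := norm2_pos z.rep_nonzero
  have h4 := norm2_pos (F.toMap_ne_zero z.rep_nonzero)
  have hdK : 0 < ‖(ratDegree f : K)‖ := by
    rw [norm_pos_iff, Nat.cast_ne_zero]
    omega
  have key := F.chordalDeriv_eq (by omega) z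
  rw [hdet] at key
  rw [Function.comp_apply, F.exp_neg_logRatio, Multiset.map_map]
  simp only [Multiset.card_map, Finset.card_val, Finset.card_univ, Fintype.card_fin, pow_one,
    Function.iterate_one, Function.comp_def]
  rw [show (Multiset.map (fun j => wedge z.rep (C j)) Finset.univ.val).prod =
    ∏ j, wedge z.rep (C j) from rfl]
  rw [← mul_div_assoc, div_eq_iff hdK.ne', key, div_pow, ← pow_mul]
  have e : norm2 z.rep ^ (ratDegree f * 2) =
      norm2 z.rep ^ (2 * ratDegree f - 2) * norm2 z.rep ^ 2 := by
    rw [← pow_add]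
    congr 1
    omega
  rw [e]
  field_simp

end HomogeneousLift

/-- The critical point formula, from the potential theory of the Hsia kernel. -/
theorem lyapunov_eq_of_hasPotentialTheory [CharZero K] {h₀ : ℝ} (hK : HasPotentialTheory K h₀)
    (f : RatFunc K) (hd : 1 < ratDegree f) (F : HomogeneousLift f)
    (hgf : IsDynamicalGreenFunction f F.green)
    (C : Fin (2 * ratDegree f - 2) → (Fin 2 → K)) (hC : ∀ j, C j ≠ 0)
    (hdet : ∀ v : Fin 2 → K, F.jacobianDet v = ∏ j, wedge v (C j)) :
    Integrable (fun x => Real.log (chordalDerivBerk f x)) (equilibriumMeasure f) ∧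
      lyapunov f = -Real.log ‖(ratDegree f : K)‖ +
        ∑ j, (F.green (toBerk (Projectivization.mk K (C j) (hC j))) +
          Real.log (norm2 (C j))) := by
  obtain ⟨⟨hg, hμ, hreg, hlap⟩, hV⟩ := hgf
  rw [lyapunov]
  generalize equilibriumMeasure f = μ at *
  obtain ⟨a, ha⟩ := exists_potential_eq hK hlap
  have hint := integral_eq_of_equilibriumEnergy_eq_zero hK hg hreg ha hV
  have hT1 := F.integral_T_one hK hd hg ha hint
  have hs : ∀ w ∈ Finset.univ.val.map C, w ≠ 0 := by
    intro w hw
    obtain ⟨j, -, rfl⟩ := Multiset.mem_map.1 hw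
    exact hC j
  obtain ⟨h1, h2, h3⟩ := integral_sum_log_hsia ha _ hs
  have hdK : 0 < ‖(ratDegree f : K)‖ := by
    rw [norm_pos_iff, Nat.cast_ne_zero]
    omega
  have hT := integrable_of_continuous (F.continuous_T (by omega) 1) μ
  have hlog : (fun x => Real.log (chordalDerivBerk f x)) =ᵐ[μ] fun x =>
      ((Finset.univ.val.map C).map fun w => Real.log (hsia x (vecPt w) * norm2 w)).sum -
        (2 * F.T 1 x + Real.log ‖(ratDegree f : K)‖) := by
    filter_upwards [h1] with x hx
    have hx' : ((Finset.univ.val.map C).map fun w => hsia x (vecPt w) * norm2 w).prod ≠ 0 := by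
      intro h0
      obtain ⟨b, hb, hb0⟩ := Multiset.mem_map.1 (Multiset.prod_eq_zero_iff.1 h0)
      exact hx b hb hb0
    rw [F.chordalDerivBerk_eq hd C hC hdet, Real.log_mul hx' (by positivity),
      log_multiset_prod _ _ hx, Real.log_div (by positivity) hdK.ne', Real.log_pow, Real.log_exp]
    push_cast
    ring
  have hi2 : Integrable (fun x => 2 * F.T 1 x + Real.log ‖(ratDegree f : K)‖) μ :=
    (hT.const_mul 2).add (integrable_const _)
  refine ⟨(h2.sub hi2).congr hlog.symm, ?_⟩
  have hsum : ((Finset.univ.val.map C).map fun w =>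
      F.green (vecPt w) + Real.log (norm2 w)).sum =
      ∑ j, (F.green (toBerk (Projectivization.mk K (C j) (hC j))) + Real.log (norm2 (C j))) := by
    rw [Multiset.map_map, ← Finset.sum_eq_multiset_sum]
    exact Finset.sum_congr rfl fun j _ => by rw [Function.comp_apply, vecPt_of_ne (hC j)]
  have hcard : ((2 * ratDegree f - 2 : ℕ) : ℝ) = 2 * ratDegree f - 2 := by
    rw [Nat.cast_sub (by omega)]
    push_cast
    ring
  rw [integral_congr_ae hlog, integral_sub h2 hi2, h3,
    integral_add (hT.const_mul 2) (integrable_const _), integral_const_mul, hT1, hsum]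
  simp only [Multiset.card_map, Finset.card_val, Finset.card_univ, Fintype.card_fin, hcard,
    integral_const, probReal_univ, one_smul]
  ring

end Main

lemma le_of_forall_pow_le {a M : ℝ} (hM0 : 0 ≤ M) (hpow : ∀ n : ℕ, a ^ n ≤ (n + 1) * M ^ n) :
    a ≤ M := by
  by_contra! hlt
  rcases hM0.eq_or_lt with h0 | h0
  · have := hpow 1
    rw [← h0] at this hlt
    simp only [pow_one, mul_zero] at this
    linarith
  · have hq : 1 < a / M := (one_lt_div h0).2 hlt
    have hbd : ∀ n : ℕ, (a / M) ^ n ≤ n + 1 := fun n => by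
      rw [div_pow, div_le_iff₀ (by positivity)]
      exact hpow n
    have h1 := tendsto_pow_const_div_const_pow_of_one_lt 1 hq
    have h2 := tendsto_pow_const_div_const_pow_of_one_lt 0 hq
    have h3 := h1.add h2
    have h4 : ∀ n : ℕ, (1 : ℝ) ≤ (n : ℝ) ^ 1 / (a / M) ^ n + (n : ℝ) ^ 0 / (a / M) ^ n := fun n => by
      rw [← add_div, one_le_div (by positivity)]
      simpa using hbd n
    have := ge_of_tendsto h3 (Eventually.of_forall h4)
    norm_num at this

section

variable [NontriviallyNormedField K] [IsAlgClosed K]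

lemma BerkA1.apply_eq_prod (x : BerkA1 K) (p : K[X]) :
    x.1 p = ‖p.leadingCoeff‖ *
      (p.roots.map fun a => x.1 (Polynomial.X - Polynomial.C a)).prod := by
  conv_lhs => rw [← Polynomial.C_leadingCoeff_mul_prod_multiset_X_sub_C
    (IsAlgClosed.card_roots_eq_natDegree (p := p))]
  rw [map_mul, x.2, map_multiset_prod, Multiset.map_map]
  rfl

end

/-! ### Non-archimedean fields: classical points and the Gauss point -/

section Ultrametric

variable [NontriviallyNormedField K] [IsUltrametricDist K]

lemma BerkA1.apply_natCast_le_one (x : BerkA1 K) (n : ℕ) : x.1 (n : K[X]) ≤ 1 := by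
  have h := x.2 (n : K)
  rw [map_natCast] at h
  rw [h]
  exact IsUltrametricDist.norm_natCast_le_one K n

lemma BerkA1.apply_add_le_max (x : BerkA1 K) (p q : K[X]) : x.1 (p + q) ≤ max (x.1 p) (x.1 q) := by
  set M := max (x.1 p) (x.1 q) with hM
  have hM0 : 0 ≤ M := le_max_of_le_left (x.apply_nonneg p)
  have hpow : ∀ n : ℕ, x.1 (p + q) ^ n ≤ (n + 1) * M ^ n := by
    intro n
    rw [← map_pow, add_pow]
    refine (Finset.le_sum_of_subadditive x.1 (map_zero x.1).le (fun a b => map_add_le_add x.1 a b)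
      _ _).trans ?_
    have : ∀ m ∈ Finset.range (n + 1), x.1 (p ^ m * q ^ (n - m) * (n.choose m : K[X])) ≤ M ^ n := by
      intro m hm
      have hmn : m ≤ n := Nat.lt_succ_iff.1 (Finset.mem_range.1 hm)
      rw [map_mul, map_mul, map_pow, map_pow]
      calc x.1 p ^ m * x.1 q ^ (n - m) * x.1 (n.choose m : K[X])
          ≤ M ^ m * M ^ (n - m) * 1 := by
            gcongr
            · exact le_max_left _ _
            · exact le_max_right _ _
            · exact x.apply_natCast_le_one _
        _ = M ^ n := by rw [mul_one, ← pow_add, Nat.add_sub_cancel' hmn]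
    refine (Finset.sum_le_sum this).trans_eq ?_
    simp
  exact le_of_forall_pow_le hM0 hpow

lemma norm_sub_eq_max {a b : K} (h : ‖a‖ ≠ ‖b‖) : ‖a - b‖ = max ‖a‖ ‖b‖ := by
  rw [sub_eq_add_neg, IsUltrametricDist.norm_add_eq_max_of_norm_ne_norm (by rwa [norm_neg]),
    norm_neg]

lemma norm2_eq_norm (v : Fin 2 → K) : norm2 v = ‖v‖ := by
  refine le_antisymm ?_ (norm_le_norm2 v)
  rw [norm2, if_pos ‹IsUltrametricDist K›]
  exact max_le (norm_le_pi_norm v 0) (norm_le_pi_norm v 1)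

lemma norm2_affine {t : K} (ht : ‖t‖ ≤ 1) : norm2 ![t, 1] = 1 := by
  rw [norm2, if_pos ‹IsUltrametricDist K›]
  simpa using ht

lemma chordal_ofAffine_of_le {s t : K} (hs : ‖s‖ ≤ 1) (ht : ‖t‖ ≤ 1) :
    chordal (ofAffine s) (ofAffine t) = ‖s - t‖ := by
  rw [chordal_ofAffine, norm2_affine hs, norm2_affine ht]
  simp

lemma chordal_le_max (a b c : P1 K) : chordal a c ≤ max (chordal a b) (chordal b c) := by
  have ha := norm2_pos a.rep_nonzero
  have hb := norm2_pos b.rep_nonzero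
  have hc := norm2_pos c.rep_nonzero
  have h : ‖wedge a.rep c.rep‖ * norm2 b.rep ≤
      max (‖wedge b.rep c.rep‖ * norm2 a.rep) (‖wedge a.rep b.rep‖ * norm2 c.rep) := by
    rw [norm2_eq_norm, norm2_eq_norm, norm2_eq_norm, ← norm_smul, ← norm_smul, ← norm_smul,
      wedge_smul_eq a.rep c.rep b.rep]
    exact IsUltrametricDist.norm_add_le_max _ _
  rw [chordal, chordal, chordal]
  rcases le_max_iff.1 h with h | h
  · refine le_max_of_le_right ?_
    rw [div_le_div_iff₀ (by positivity) (by positivity)]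
    nlinarith
  · refine le_max_of_le_left ?_
    rw [div_le_div_iff₀ (by positivity) (by positivity)]
    nlinarith

variable [IsAlgClosed K]

lemma exists_norm_between {a b : ℝ} (ha : 0 < a) (hab : a < b) : ∃ z : K, a < ‖z‖ ∧ ‖z‖ < b := by
  obtain ⟨c, hc⟩ := NormedField.exists_one_lt_norm K
  obtain ⟨n, hn⟩ := pow_unbounded_of_one_lt ‖c‖ ((one_lt_div ha).2 hab)
  have hn0 : n ≠ 0 := by
    rintro rfl
    rw [pow_zero] at hn
    linarith
  obtain ⟨r, hr⟩ := IsAlgClosed.exists_pow_nat_eq c (Nat.pos_of_ne_zero hn0)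
  have hr' : ‖r‖ ^ n = ‖c‖ := by rw [← norm_pow, hr]
  have hr1 : 1 < ‖r‖ := by
    by_contra! h
    have := pow_le_one₀ (n := n) (norm_nonneg r) h
    linarith
  have hr2 : ‖r‖ < b / a := lt_of_pow_lt_pow_left₀ n (div_pos (ha.trans hab) ha).le (by rw [hr']; exact hn)
  obtain ⟨m, hm1, hm2⟩ := exists_mem_Ico_zpow ha hr1
  refine ⟨r ^ (m + 1), ?_, ?_⟩
  · rwa [norm_zpow]
  · rw [norm_zpow, zpow_add₀ (by positivity), zpow_one]
    rw [lt_div_iff₀ ha] at hr2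
    nlinarith

lemma exists_norm_between_add {r ε : ℝ} (hr : 0 ≤ r) (hε : 0 < ε) :
    ∃ z : K, r < ‖z‖ ∧ ‖z‖ < r + ε := by
  obtain ⟨z, h1, h2⟩ := exists_norm_between (K := K) (a := r + ε / 2) (b := r + ε)
    (by positivity) (by linarith)
  exact ⟨z, by linarith, h2⟩

lemma BerkA1.apply_X_sub_C_triangle (x : BerkA1 K) (a b : K) :
    x.1 (Polynomial.X - Polynomial.C a) ≤
      max (x.1 (Polynomial.X - Polynomial.C b)) ‖a - b‖ := by
  have := x.apply_add_le_max (Polynomial.X - Polynomial.C b) (Polynomial.C (b - a))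
  rw [x.2, norm_sub_rev b a] at this
  convert this using 2
  rw [map_sub]
  ring

lemma BerkA1.norm_sub_le_max (x : BerkA1 K) (a b : K) :
    ‖a - b‖ ≤ max (x.1 (Polynomial.X - Polynomial.C a)) (x.1 (Polynomial.X - Polynomial.C b)) := by
  have := x.apply_add_le_max (-(Polynomial.X - Polynomial.C a)) (Polynomial.X - Polynomial.C b)
  rw [map_neg_eq_map] at this
  have e : -(Polynomial.X - Polynomial.C a) + (Polynomial.X - Polynomial.C b) =
      Polynomial.C (a - b) := by
    rw [map_sub]; ring
  rwa [e, x.2] at this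

/-- Finitely many linear polynomials can be approximated simultaneously at classical points. -/
lemma BerkA1.exists_tendsto_norm_sub (x : BerkA1 K) (A : Finset K) :
    ∃ z : ℕ → K, ∀ a ∈ A,
      Tendsto (fun k => ‖z k - a‖) atTop (𝓝 (x.1 (Polynomial.X - Polynomial.C a))) := by
  rcases A.eq_empty_or_nonempty with rfl | hA
  · exact ⟨fun _ => 0, by simp⟩
  obtain ⟨b, hb, hmin⟩ := A.exists_min_image (fun a => x.1 (Polynomial.X - Polynomial.C a)) hA
  set r := x.1 (Polynomial.X - Polynomial.C b) with hr
  have hr0 : 0 ≤ r := x.apply_nonneg _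
  choose y hy1 hy2 using fun k : ℕ =>
    exists_norm_between_add (K := K) hr0 (ε := 1 / ((k : ℝ) + 1)) (by positivity)
  have hylim : Tendsto (fun k => ‖y k‖) atTop (𝓝 r) := by
    refine tendsto_of_tendsto_of_tendsto_of_le_of_le tendsto_const_nhds ?_
      (fun k => (hy1 k).le) (fun k => (hy2 k).le)
    simpa using (tendsto_one_div_add_atTop_nhds_zero_nat (𝕜 := ℝ)).const_add r
  refine ⟨fun k => b + y k, fun a ha => ?_⟩
  set s := x.1 (Polynomial.X - Polynomial.C a) with hs
  have h1 : s ≤ max r ‖a - b‖ := x.apply_X_sub_C_triangle a b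
  have h2 : ‖a - b‖ ≤ max s r := x.norm_sub_le_max a b
  have e : ∀ k, b + y k - a = y k - (a - b) := fun k => by ring
  simp only [e]
  rcases (hmin a ha).eq_or_lt with h | h
  · have hsr : s = r := hs.trans h.symm
    have h3 : ‖a - b‖ ≤ r := by rwa [hsr, max_self] at h2
    rw [hsr]
    refine hylim.congr fun k => ?_
    have hne : ‖y k‖ ≠ ‖a - b‖ := (h3.trans_lt (hy1 k)).ne'
    rw [norm_sub_eq_max hne,
      max_eq_left (h3.trans (hy1 k).le)]
  · change r < s at h
    have h3 : ‖a - b‖ = s := by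
      apply le_antisymm
      · rwa [max_eq_left h.le] at h2
      · rcases le_max_iff.1 h1 with h4 | h4
        · linarith
        · exact h4
    refine tendsto_const_nhds.congr' ?_
    filter_upwards [hylim.eventually (gt_mem_nhds h)] with k hk
    have hne : ‖y k‖ ≠ ‖a - b‖ := by rw [h3]; exact hk.ne
    rw [norm_sub_eq_max hne, h3, max_eq_right hk.le]

lemma BerkA1.exists_finite_of_mem_nhds {x : BerkA1 K} {N : Set (BerkA1 K)} (hN : N ∈ 𝓝 x) :
    ∃ (I : Set K[X]) (t : K[X] → Set ℝ), I.Finite ∧ (∀ p, t p ∈ 𝓝 (x.1 p)) ∧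
      ∀ y : BerkA1 K, (∀ p ∈ I, y.1 p ∈ t p) → y ∈ N := by
  rw [nhds_induced, Filter.mem_comap] at hN
  obtain ⟨M, hM, hMN⟩ := hN
  rw [nhds_pi, Filter.mem_pi] at hM
  obtain ⟨I, hI, t, ht, hIt⟩ := hM
  exact ⟨I, t, hI, ht, fun y hy => hMN (hIt fun p hp => hy p hp)⟩

/-- Classical points are dense. -/
instance trace_neBot_of_ultrametric (x : BerkP1 K) : (trace x).NeBot := by
  classical
  induction x using OnePoint.rec with
  | infty => rw [← toBerk_inftyPt]; infer_instance
  | coe x =>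
    rw [trace, comap_neBot_iff]
    intro N hN
    rw [OnePoint.nhds_coe_eq, Filter.mem_map] at hN
    obtain ⟨I, t, hI, ht, hIN⟩ := BerkA1.exists_finite_of_mem_nhds hN
    obtain ⟨z, hz⟩ := x.exists_tendsto_norm_sub (hI.toFinset.biUnion fun p => p.roots.toFinset)
    have hlim : ∀ p ∈ I, Tendsto (fun k => ‖p.eval (z k)‖) atTop (𝓝 (x.1 p)) := by
      intro p hp
      have e : ∀ k, ‖p.eval (z k)‖ =
          ‖p.leadingCoeff‖ * (p.roots.map fun a => ‖z k - a‖).prod := by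
        intro k
        have := (evalPoint (z k)).apply_eq_prod p
        change ‖p.eval (z k)‖ = _ * (p.roots.map fun a =>
          ‖(Polynomial.X - Polynomial.C a).eval (z k)‖).prod at this
        simpa using this
      simp only [e]
      rw [x.apply_eq_prod p]
      refine Tendsto.const_mul _ (tendsto_multiset_prod _ fun a ha => hz a ?_)
      exact Finset.mem_biUnion.2 ⟨p, hI.mem_toFinset.2 hp, Multiset.mem_toFinset.2 ha⟩
    have hev : ∀ᶠ k in atTop, ∀ p ∈ I, ‖p.eval (z k)‖ ∈ t p :=
      (Filter.eventually_all_finite hI).2 fun p hp => (hlim p hp).eventually (ht p)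
    obtain ⟨k, hk⟩ := hev.exists
    refine ⟨ofAffine (z k), ?_⟩
    rw [toBerk_ofAffine]
    exact hIN _ hk

/-- The residue field is infinite. -/
lemma exists_norm_sub_eq_one (S : Finset K) (hS : ∀ s ∈ S, ‖s‖ ≤ 1) :
    ∃ t : K, ‖t‖ ≤ 1 ∧ ∀ s ∈ S, ‖t - s‖ = 1 := by
  rcases S.eq_empty_or_nonempty with rfl | hne
  · exact ⟨0, by simp⟩
  have hdeg : (∏ s ∈ S, (Polynomial.X - Polynomial.C s) - Polynomial.C 1).degree ≠ 0 := by
    rw [Polynomial.degree_sub_C, Polynomial.degree_prod]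
    · simpa using hne.ne_empty
    · rw [Polynomial.degree_prod]
      simpa using hne
  obtain ⟨t, ht⟩ := IsAlgClosed.exists_root _ hdeg
  have hprod : ∏ s ∈ S, ‖t - s‖ = 1 := by
    have : ∏ s ∈ S, (t - s) = 1 := by
      simpa [Polynomial.IsRoot, Polynomial.eval_prod, sub_eq_zero] using ht
    rw [← norm_prod, this, norm_one]
  have ht1 : ‖t‖ ≤ 1 := by
    by_contra! h
    have h1 : ∀ s ∈ S, ‖t - s‖ = ‖t‖ := fun s hs => by
      have hlt := (hS s hs).trans_lt h
      rw [norm_sub_eq_max hlt.ne', max_eq_left hlt.le]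
    rw [Finset.prod_congr rfl h1, Finset.prod_const] at hprod
    have := one_lt_pow₀ h (Finset.card_ne_zero.2 hne)
    linarith
  have hle : ∀ s ∈ S, ‖t - s‖ ≤ 1 := fun s hs => by
    have := IsUltrametricDist.norm_add_le_max t (-s)
    rw [norm_neg, ← sub_eq_add_neg] at this
    exact this.trans (max_le ht1 (hS s hs))
  refine ⟨t, ht1, fun s hs => le_antisymm (hle s hs) ?_⟩
  by_contra! h
  have := Finset.prod_lt_prod (f := fun s => ‖t - s‖) (g := fun _ => (1 : ℝ)) (s := S) (fun i hi => ?_)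
    (fun i hi => hle i hi) ⟨s, hs, h⟩
  · simp only [Finset.prod_const_one] at this
    linarith
  · rw [norm_pos_iff]
    intro h0
    rw [Finset.prod_eq_zero hi (by rw [h0, norm_zero])] at hprod
    exact zero_ne_one hprod

lemma gaussPoint_X_sub_C (a : K) :
    (gaussPoint (K := K)).1 (Polynomial.X - Polynomial.C a) = max 1 ‖a‖ := by
  have hX : (gaussPoint (K := K)).1 Polynomial.X = 1 := by
    change (Polynomial.X : K[X]).gaussNorm (NormedField.toAbsoluteValue K) 1 = 1
    rw [← Polynomial.monomial_one_one_eq_X, Polynomial.gaussNorm_monomial]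
    simp
  have h1 := (gaussPoint (K := K)).apply_add_le_max Polynomial.X (Polynomial.C (-a))
  rw [hX, (gaussPoint (K := K)).2, norm_neg, map_neg, ← sub_eq_add_neg] at h1
  refine le_antisymm h1 ?_
  have hl := fun i => (Polynomial.X - Polynomial.C a).le_gaussNorm (NormedField.toAbsoluteValue K)
    zero_le_one i
  refine max_le ?_ ?_
  · have := hl 1
    simp only [Polynomial.coeff_sub, Polynomial.coeff_X_one, Polynomial.coeff_C_succ, sub_zero,
      map_one, one_pow, mul_one] at this
    exact this
  · have := hl 0
    simp only [Polynomial.coeff_sub, Polynomial.coeff_X_zero, Polynomial.coeff_C_zero, zero_sub,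
      AbsoluteValue.map_neg, pow_zero, mul_one] at this
    exact this

/-- A neighbourhood of the Gauss point contains the integral classical points outside finitely
many residue classes. -/
lemma exists_finset_of_mem_nhds_gaussPoint {N : Set (BerkP1 K)}
    (hN : N ∈ 𝓝 (OnePoint.some (gaussPoint (K := K)))) :
    ∃ S : Finset K, (∀ s ∈ S, ‖s‖ ≤ 1) ∧
      ∀ t : K, ‖t‖ ≤ 1 → (∀ s ∈ S, ‖t - s‖ = 1) → toBerk (ofAffine t) ∈ N := by
  classical
  rw [OnePoint.nhds_coe_eq, Filter.mem_map] at hN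
  obtain ⟨I, t, hI, ht, hIN⟩ := BerkA1.exists_finite_of_mem_nhds hN
  refine ⟨(hI.toFinset.biUnion fun p => p.roots.toFinset).filter fun s => ‖s‖ ≤ 1,
    fun s hs => (Finset.mem_filter.1 hs).2, fun u hu hS => ?_⟩
  rw [toBerk_ofAffine]
  refine hIN _ fun p hp => ?_
  have e : (evalPoint u).1 p = (gaussPoint (K := K)).1 p := by
    rw [BerkA1.apply_eq_prod, BerkA1.apply_eq_prod]
    congr 2
    refine Multiset.map_congr rfl fun a ha => ?_
    rw [gaussPoint_X_sub_C]
    change ‖(Polynomial.X - Polynomial.C a).eval u‖ = _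
    rw [Polynomial.eval_sub, Polynomial.eval_X, Polynomial.eval_C]
    by_cases h : ‖a‖ ≤ 1
    · rw [max_eq_left h]
      exact hS a (Finset.mem_filter.2
        ⟨Finset.mem_biUnion.2 ⟨p, hI.mem_toFinset.2 hp, Multiset.mem_toFinset.2 ha⟩, h⟩)
    · push Not at h
      have hlt := hu.trans_lt h
      rw [max_eq_right h.le, norm_sub_eq_max hlt.ne,
        max_eq_right hlt.le]
  rw [e]
  exact mem_of_mem_nhds (ht p)

lemma hsia_gaussPoint (x : BerkP1 K) : hsia x (OnePoint.some gaussPoint) = 1 := by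
  refine le_antisymm (hsia_le_one _ _) ?_
  rw [hsia_eq_limsup]
  refine le_limsup_of_frequently_le ?_ (isBoundedUnder_le_chordal _)
  rw [Filter.frequently_iff]
  intro U hU
  obtain ⟨A, hA, B, hB, hAB⟩ := Filter.mem_prod_iff.1 hU
  obtain ⟨V, hV, hVB⟩ := Filter.mem_comap.1 hB
  obtain ⟨S, hS, hSV⟩ := exists_finset_of_mem_nhds_gaussPoint hV
  obtain ⟨z, hz⟩ := (trace_neBot_of_ultrametric x).nonempty_of_mem hA
  obtain ⟨t, ht, htS, hzt⟩ : ∃ t : K, ‖t‖ ≤ 1 ∧ (∀ s ∈ S, ‖t - s‖ = 1) ∧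
      1 ≤ chordal z (ofAffine t) := by
    classical
    rcases ofAffine_or_inftyPt z with ⟨u, rfl⟩ | rfl
    · by_cases hu : ‖u‖ ≤ 1
      · obtain ⟨t, ht, htS⟩ := exists_norm_sub_eq_one (insert u S) (by
          intro s hs
          rcases Finset.mem_insert.1 hs with rfl | hs
          · exact hu
          · exact hS s hs)
        refine ⟨t, ht, fun s hs => htS s (Finset.mem_insert_of_mem hs), ?_⟩
        rw [chordal_ofAffine_of_le hu ht, norm_sub_rev, htS u (Finset.mem_insert_self u S)]
      · obtain ⟨t, ht, htS⟩ := exists_norm_sub_eq_one S hS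
        push Not at hu
        have hlt := ht.trans_lt hu
        have hn : norm2 ![u, 1] = ‖u‖ := by
          rw [norm2, if_pos ‹IsUltrametricDist K›]
          simpa using hu.le
        refine ⟨t, ht, htS, ?_⟩
        rw [chordal_ofAffine, norm2_affine ht, hn,
          norm_sub_eq_max hlt.ne', max_eq_left hlt.le,
          mul_one, div_self (by linarith)]
    · obtain ⟨t, ht, htS⟩ := exists_norm_sub_eq_one S hS
      refine ⟨t, ht, htS, ?_⟩
      rw [chordal_comm, chordal_ofAffine_inftyPt, norm2_affine ht, div_one]
  exact ⟨(z, ofAffine t), hAB (Set.mk_mem_prod hz (hVB (hSV t ht htS))), hzt⟩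

lemma hsia_le_max (x y z : BerkP1 K) : hsia x z ≤ max (hsia x y) (hsia y z) := by
  refine le_of_forall_gt_imp_ge_of_dense fun r hr => ?_
  obtain ⟨h1, h2⟩ := max_lt_iff.1 hr
  obtain ⟨A, hA, B, hB, hAB⟩ := Filter.mem_prod_iff.1 (eventually_chordal_lt h1)
  obtain ⟨B', hB', C, hC, hBC⟩ := Filter.mem_prod_iff.1 (eventually_chordal_lt h2)
  obtain ⟨q, hq⟩ := (trace_neBot_of_ultrametric y).nonempty_of_mem (Filter.inter_mem hB hB')
  refine hsia_le_of_eventually ?_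
  filter_upwards [prod_mem_prod hA hC] with p hp
  exact (chordal_le_max p.1 q p.2).trans (max_le (hAB (Set.mk_mem_prod hp.1 hq.1)).le
    (hBC (Set.mk_mem_prod hq.2 hp.2)).le)

end Ultrametric

/-! ### Ultrametric kernels and the energy inequality -/

section Layers

open Classical in
lemma negLog_layers {q t : ℝ} (hq0 : 0 < q) (hq1 : q < 1) (h0 : 0 ≤ t) (h1 : t ≤ 1) :
    (∑' k : ℕ, if t < q ^ (k + 1) then ENNReal.ofReal (-Real.log q) else 0) ≤ negLog t ∧
      negLog t ≤ ∑' k : ℕ, if t < q ^ k then ENNReal.ofReal (-Real.log q) else 0 := by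
  have hL : 0 < -Real.log q := neg_pos.2 (Real.log_neg hq0 hq1)
  rcases h0.eq_or_lt with rfl | h0
  · rw [negLog_zero]
    refine ⟨le_top, ?_⟩
    simp only [pow_pos hq0, if_true]
    rw [ENNReal.tsum_const_eq_top_of_ne_zero (by simpa using hL)]
  set L := -Real.log q with hLdef
  set a := -Real.log t / L with ha
  have haL : -Real.log t = a * L := by rw [ha, div_mul_cancel₀ _ hL.ne']
  have hlt : ∀ k : ℕ, t < q ^ k ↔ k < ⌈a⌉₊ := fun k => by
    rw [Nat.lt_ceil, ha, lt_div_iff₀ hL, ← Real.log_lt_log_iff h0 (pow_pos hq0 k), Real.log_pow,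
      hLdef]
    constructor <;> intro h <;> linarith
  rw [negLog_of_ne h0.ne', haL]
  simp only [hlt]
  constructor
  · rw [tsum_eq_sum (s := Finset.range (⌈a⌉₊ - 1)) (fun k hk => if_neg (by
      rw [Finset.mem_range] at hk; omega)), Finset.sum_congr rfl (fun k hk => if_pos (by
      rw [Finset.mem_range] at hk; omega)), Finset.sum_const, Finset.card_range, nsmul_eq_mul,
      ← ENNReal.ofReal_natCast, ← ENNReal.ofReal_mul (by positivity)]
    refine ENNReal.ofReal_le_ofReal (mul_le_mul_of_nonneg_right ?_ hL.le)
    rcases Nat.eq_zero_or_pos ⌈a⌉₊ with h | h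
    · rw [h]
      simpa using div_nonneg (neg_nonneg.2 (Real.log_nonpos h0.le h1)) hL.le
    · exact (Nat.lt_ceil.1 (Nat.sub_lt h one_pos)).le
  · rw [tsum_eq_sum (s := Finset.range ⌈a⌉₊) (fun k hk => if_neg (by
      rw [Finset.mem_range] at hk; omega)), Finset.sum_congr rfl (fun k hk => if_pos (by
      rw [Finset.mem_range] at hk; omega)), Finset.sum_const, Finset.card_range, nsmul_eq_mul,
      ← ENNReal.ofReal_natCast, ← ENNReal.ofReal_mul (by positivity)]
    exact ENNReal.ofReal_le_ofReal (mul_le_mul_of_nonneg_right (Nat.le_ceil a) hL.le)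

lemma two_mul_mul_le_add_mul_self (a b : ℝ≥0∞) : 2 * (a * b) ≤ b * b + a * a := by
  rcases le_total a b with h | h
  · obtain ⟨c, rfl⟩ := exists_add_of_le h
    calc 2 * (a * (a + c)) ≤ 2 * (a * (a + c)) + c * c := le_self_add
      _ = _ := by ring
  · obtain ⟨c, rfl⟩ := exists_add_of_le h
    calc 2 * ((b + c) * b) ≤ 2 * ((b + c) * b) + c * c := le_self_add
      _ = _ := by ring

variable {X : Type*} [MeasurableSpace X] {k : X → X → ℝ}

/-- The balls of an ultrametric kernel that are charged by one of two measures form a countable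
family. -/
lemma exists_countable_balls (hsymm : ∀ x y, k x y = k y x)
    (hult : ∀ x y z, k x z ≤ max (k x y) (k y z)) (r : ℝ)
    (hmeas : ∀ x, MeasurableSet {y | k x y < r}) (μ ν : Measure X) [IsFiniteMeasure μ]
    [IsFiniteMeasure ν] :
    ∃ T : Set (Set X), T.Countable ∧ (∀ B ∈ T, MeasurableSet B) ∧
      ∀ m : Measure X, m ≤ μ + ν →
        ∀ x, m {y | k x y < r} = ∑' B : T, m B * (B : Set X).indicator 1 x := by
  have key : ∀ x y, k x y < r → {z | k x z < r} = {z | k y z < r} := by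
    intro x y hxy
    ext z
    constructor
    · intro hz
      exact (hult y x z).trans_lt (max_lt (by rwa [hsymm]) hz)
    · intro hz
      exact (hult x y z).trans_lt (max_lt hxy hz)
  let S : Set (Set X) := Set.range fun x => {y | k x y < r}
  have hdisj : Pairwise (Function.onFun Disjoint fun B : S => (B : Set X)) := by
    rintro ⟨_, x, rfl⟩ ⟨_, y, rfl⟩ hne
    rw [Function.onFun, Set.disjoint_left]
    intro z hz hz'
    exact hne (Subtype.ext ((key x z hz).trans (key y z hz').symm))
  have hS : ∀ B : S, MeasurableSet (B : Set X) := by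
    rintro ⟨_, x, rfl⟩
    exact hmeas x
  have hc := Measure.countable_meas_pos_of_disjoint_iUnion (μ := μ + ν) hS hdisj
  refine ⟨Subtype.val '' {B : S | 0 < (μ + ν) (B : Set X)}, hc.image _, ?_, ?_⟩
  · rintro _ ⟨B, -, rfl⟩
    exact hS B
  intro m hm x
  by_cases h0 : m {y | k x y < r} = 0
  · rw [h0, eq_comm, ENNReal.tsum_eq_zero]
    rintro ⟨_, ⟨⟨_, y, rfl⟩, -, rfl⟩⟩
    by_cases hx : x ∈ {z | k y z < r}
    · simp only
      rw [key y x hx, h0, zero_mul]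
    · simp only
      rw [Set.indicator_of_notMem hx, mul_zero]
  · obtain ⟨y, hy⟩ : {y | k x y < r}.Nonempty := nonempty_of_measure_ne_zero h0
    have hxx : x ∈ {y | k x y < r} := (hult x y x).trans_lt (max_lt hy (by rwa [hsymm]))
    have hmem : {y | k x y < r} ∈ Subtype.val '' {B : S | 0 < (μ + ν) (B : Set X)} :=
      ⟨⟨_, Set.mem_range_self x⟩, lt_of_lt_of_le (pos_iff_ne_zero.2 h0) (hm _), rfl⟩
    refine Eq.symm ((tsum_eq_single ⟨_, hmem⟩ ?_).trans ?_)
    · rintro ⟨B, hB⟩ hne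
      obtain ⟨⟨_, z, rfl⟩, -, rfl⟩ := id hB
      have hx : x ∉ {y | k z y < r} := fun hx => hne (Subtype.ext (key z x hx))
      simp only
      rw [Set.indicator_of_notMem hx, mul_zero]
    · simp only
      rw [Set.indicator_of_mem hxx]
      simp

lemma measure_ball_le (hsymm : ∀ x y, k x y = k y x)
    (hult : ∀ x y z, k x z ≤ max (k x y) (k y z)) (r : ℝ)
    (hmeas : ∀ x, MeasurableSet {y | k x y < r}) (μ ν : Measure X) [IsFiniteMeasure μ]
    [IsFiniteMeasure ν] :
    (Measurable fun x => μ {y | k x y < r}) ∧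
    2 * ∫⁻ x, μ {y | k x y < r} ∂ν ≤ ∫⁻ x, ν {y | k x y < r} ∂ν + ∫⁻ x, μ {y | k x y < r} ∂μ := by
  obtain ⟨T, hTc, hTm, hT⟩ := exists_countable_balls hsymm hult r hmeas μ ν
  have : Countable T := hTc
  have hterm : ∀ (m : Measure X) (B : T), Measurable fun x => m B * (B : Set X).indicator 1 x :=
    fun m B => (measurable_one.indicator (hTm B B.2)).const_mul _
  have hint : ∀ m m' : Measure X, m ≤ μ + ν →
      ∫⁻ x, m {y | k x y < r} ∂m' = ∑' B : T, m B * m' B := by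
    intro m m' hm
    simp only [hT m hm]
    rw [lintegral_tsum fun B => (hterm m B).aemeasurable]
    refine tsum_congr fun B => ?_
    rw [lintegral_const_mul _ (measurable_one.indicator (hTm B B.2)),
      lintegral_indicator_one (hTm B B.2)]
  have hμ : μ ≤ μ + ν := Measure.le_add_right le_rfl
  have hν : ν ≤ μ + ν := Measure.le_add_left le_rfl
  constructor
  · simp only [hT μ hμ]
    exact Measurable.tsum fun B => hterm μ B
  · rw [hint μ ν hμ, hint ν ν hν, hint μ μ hμ, ← ENNReal.tsum_mul_left, ← ENNReal.tsum_add]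
    exact ENNReal.tsum_le_tsum fun B => two_mul_mul_le_add_mul_self _ _

lemma ultrametric_energy_le (hsymm : ∀ x y, k x y = k y x)
    (hult : ∀ x y z, k x z ≤ max (k x y) (k y z)) (h0 : ∀ x y, 0 ≤ k x y) (h1 : ∀ x y, k x y ≤ 1)
    (hmeas : ∀ x r, MeasurableSet {y | k x y < r}) (μ ν : Measure X) [IsProbabilityMeasure μ]
    [IsProbabilityMeasure ν] :
    2 * ∫⁻ x, ∫⁻ y, negLog (k x y) ∂μ ∂ν ≤
      ∫⁻ x, ∫⁻ y, negLog (k x y) ∂ν ∂ν + ∫⁻ x, ∫⁻ y, negLog (k x y) ∂μ ∂μ := by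
  classical
  refine ENNReal.le_of_forall_pos_le_add fun ε hε _ => ?_
  set δ : ℝ := ε / 2 with hδ
  have hδ0 : 0 < δ := by positivity
  set q := Real.exp (-δ) with hq
  have hq0 : 0 < q := Real.exp_pos _
  have hq1 : q < 1 := by rw [hq, Real.exp_lt_one_iff]; linarith
  have hqδ : -Real.log q = δ := by rw [hq, Real.log_exp, neg_neg]
  have hlay : ∀ x y, _ := fun x y => negLog_layers hq0 hq1 (h0 x y) (h1 x y)
  rw [hqδ] at hlay
  have hmf : ∀ x (j : ℕ), Measurable fun y => if k x y < q ^ j then ENNReal.ofReal δ else 0 :=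
    fun x j => Measurable.ite (hmeas x _) measurable_const measurable_const
  let I : Measure X → Measure X → ℝ≥0∞ := fun m m' =>
    ∑' j : ℕ, ENNReal.ofReal δ * ∫⁻ x, m {y | k x y < q ^ (j + 1)} ∂m'
  have hI : ∀ m m' : Measure X, IsProbabilityMeasure m → IsProbabilityMeasure m' →
      ∫⁻ x, ∫⁻ y, (∑' j : ℕ, if k x y < q ^ (j + 1) then ENNReal.ofReal δ else 0) ∂m ∂m' = I m m' := by
    intro m m' _ _
    have e : ∀ x, ∫⁻ y, (∑' j : ℕ, if k x y < q ^ (j + 1) then ENNReal.ofReal δ else 0) ∂m =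
        ∑' j : ℕ, ENNReal.ofReal δ * m {y | k x y < q ^ (j + 1)} := by
      intro x
      rw [lintegral_tsum fun j => (hmf x _).aemeasurable]
      refine tsum_congr fun j => ?_
      rw [← lintegral_indicator_const (hmeas x _)]
      rfl
    simp only [e]
    have hm := fun j : ℕ => (measure_ball_le hsymm hult (q ^ (j + 1)) (fun x => hmeas x _) m m').1
    rw [lintegral_tsum fun j => ((hm j).const_mul _).aemeasurable]
    exact tsum_congr fun j => lintegral_const_mul _ (hm j)
  have hlow : ∀ m m' : Measure X, IsProbabilityMeasure m → IsProbabilityMeasure m' →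
      I m m' ≤ ∫⁻ x, ∫⁻ y, negLog (k x y) ∂m ∂m' := by
    intro m m' h h'
    rw [← hI m m' h h']
    exact lintegral_mono fun x => lintegral_mono fun y => (hlay x y).1
  have hup : ∫⁻ x, ∫⁻ y, negLog (k x y) ∂μ ∂ν ≤ I μ ν + ENNReal.ofReal δ := by
    have hpt : ∀ x y, negLog (k x y) ≤
        (∑' j : ℕ, if k x y < q ^ (j + 1) then ENNReal.ofReal δ else 0) + ENNReal.ofReal δ := by
      intro x y
      refine (hlay x y).2.trans ?_
      rw [tsum_eq_zero_add' ENNReal.summable, add_comm]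
      gcongr
      split_ifs <;> simp
    calc ∫⁻ x, ∫⁻ y, negLog (k x y) ∂μ ∂ν
        ≤ ∫⁻ x, ∫⁻ y, ((∑' j : ℕ, if k x y < q ^ (j + 1) then ENNReal.ofReal δ else 0) +
            ENNReal.ofReal δ) ∂μ ∂ν := lintegral_mono fun x => lintegral_mono fun y => hpt x y
      _ = I μ ν + ENNReal.ofReal δ := by
          simp only [lintegral_add_right _ measurable_const, lintegral_const, measure_univ, mul_one]
          rw [hI μ ν inferInstance inferInstance]
  calc 2 * ∫⁻ x, ∫⁻ y, negLog (k x y) ∂μ ∂ν ≤ 2 * (I μ ν + ENNReal.ofReal δ) := by gcongr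
    _ = 2 * I μ ν + ε := by
        rw [mul_add, show (2 : ℝ≥0∞) * ENNReal.ofReal δ = ε by
          rw [show (2 : ℝ≥0∞) = ENNReal.ofReal 2 by simp, ← ENNReal.ofReal_mul (by norm_num), hδ,
            mul_div_cancel₀ _ (by norm_num), ENNReal.ofReal_coe_nnreal]]
    _ ≤ (I ν ν + I μ μ) + ε := by
        gcongr
        simp only [I]
        rw [← ENNReal.tsum_mul_left, ← ENNReal.tsum_add]
        refine ENNReal.tsum_le_tsum fun j => ?_
        rw [mul_left_comm, ← mul_add]
        gcongr
        exact (measure_ball_le hsymm hult _ (fun x => hmeas x _) μ ν).2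
    _ ≤ _ := by
        gcongr
        · exact hlow ν ν inferInstance inferInstance
        · exact hlow μ μ inferInstance inferInstance

end Layers

section NestedDiscs

variable [NontriviallyNormedField K] [IsUltrametricDist K] [IsAlgClosed K]

lemma norm_add_le_of_le {a b : K} {r : ℝ} (ha : ‖a‖ ≤ r) (hb : ‖b‖ ≤ r) : ‖a + b‖ ≤ r :=
  (IsUltrametricDist.norm_add_le_max a b).trans (max_le ha hb)

lemma exists_seq_norm_sub_eq_one (S : Finset K) (hS : ∀ s ∈ S, ‖s‖ ≤ 1) :
    ∃ t : ℕ → K, (∀ i, ‖t i‖ ≤ 1 ∧ ∀ s ∈ S, ‖t i - s‖ = 1) ∧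
      Pairwise fun i j => ‖t i - t j‖ = 1 := by
  classical
  have : Std.Symm fun a b : K => ‖a - b‖ = 1 := ⟨fun a b h => by rwa [norm_sub_rev]⟩
  obtain ⟨t, h1, h2⟩ := exists_seq_of_forall_finset_exists'
    (fun t : K => ‖t‖ ≤ 1 ∧ ∀ s ∈ S, ‖t - s‖ = 1) (fun a b => ‖a - b‖ = 1) (by
      intro A hA
      obtain ⟨t, ht, hts⟩ := exists_norm_sub_eq_one (A ∪ S) (by
        intro s hs
        rcases Finset.mem_union.1 hs with h | h
        · exact (hA s h).1
        · exact hS s h)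
      refine ⟨t, ⟨ht, fun s hs => hts s (Finset.mem_union_right _ hs)⟩, fun a ha => ?_⟩
      rw [norm_sub_rev]
      exact hts a (Finset.mem_union_left _ ha))
  exact ⟨t, h1, h2⟩

variable {X : Type*} [MeasurableSpace X]

lemma exists_measure_disc_lt {u : K → X → ℝ} (hmeas : ∀ t, ‖t‖ ≤ 1 → Measurable (u t))
    (hu : ∀ s t x, ‖s‖ ≤ 1 → ‖t‖ ≤ 1 → ‖s - t‖ ≤ max (u s x) (u t x))
    (μ : Measure X) [IsFiniteMeasure μ] (S : Finset K) (hS : ∀ s ∈ S, ‖s‖ ≤ 1) {c : K}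
    (hc : ‖c‖ ≤ 1) (n : ℕ) {w : K} (hw : ‖w‖ ≤ 1) {η : ℝ≥0∞} (hη : 0 < η) :
    ∃ t : K, ‖t‖ ≤ 1 ∧ (∀ s ∈ S, ‖t - s‖ = 1) ∧ μ {x | u (w + c ^ n * t) x < ‖c‖ ^ n} < η := by
  obtain ⟨t, ht, htt⟩ := exists_seq_norm_sub_eq_one S hS
  have hwt : ∀ i, ‖w + c ^ n * t i‖ ≤ 1 := fun i => by
    refine norm_add_le_of_le hw ?_
    rw [norm_mul, norm_pow]
    exact mul_le_one₀ (pow_le_one₀ (norm_nonneg c) hc) (norm_nonneg _) (ht i).1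
  have hfin := Measure.finite_const_le_meas_of_disjoint_iUnion μ hη
    (As := fun i => {x | u (w + c ^ n * t i) x < ‖c‖ ^ n})
    (fun i => measurableSet_lt (hmeas _ (hwt i)) measurable_const) (by
      intro i j hij
      rw [Function.onFun, Set.disjoint_left]
      intro x hi hj
      have := hu _ _ x (hwt i) (hwt j)
      rw [show w + c ^ n * t i - (w + c ^ n * t j) = c ^ n * (t i - t j) by ring, norm_mul, norm_pow,
        htt hij, mul_one] at this
      exact absurd (max_lt hi hj) (not_lt.2 this)) (measure_ne_top _ _)
  obtain ⟨i, hi⟩ := hfin.infinite_compl.nonempty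
  exact ⟨t i, (ht i).1, (ht i).2, not_le.1 hi⟩

/-- A family of functions `u t`, each comparable to the distance of `t` to a moving centre, has
members of arbitrarily small logarithmic integral. -/
lemma exists_lintegral_negLog_le [CompleteSpace K] {u : K → X → ℝ}
    (hmeas : ∀ t, ‖t‖ ≤ 1 → Measurable (u t)) (hu0 : ∀ t x, 0 ≤ u t x) (hu1 : ∀ t x, u t x ≤ 1)
    (hu : ∀ s t x, ‖s‖ ≤ 1 → ‖t‖ ≤ 1 → ‖s - t‖ ≤ max (u s x) (u t x))
    (hu' : ∀ s t x, ‖s‖ ≤ 1 → ‖t‖ ≤ 1 → u s x ≤ max ‖s - t‖ (u t x))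
    (μ : Measure X) [IsFiniteMeasure μ] (S : Finset K) (hS : ∀ s ∈ S, ‖s‖ ≤ 1) {ε : ℝ≥0∞}
    (hε : ε ≠ 0) :
    ∃ w : K, ‖w‖ ≤ 1 ∧ (∀ s ∈ S, ‖w - s‖ = 1) ∧ ∫⁻ x, negLog (u w x) ∂μ ≤ ε := by
  classical
  obtain ⟨c, hc0, hc1⟩ := NormedField.exists_norm_lt_one K
  obtain ⟨η, hη0, hη⟩ := ENNReal.exists_pos_tsum_mul_lt_of_countable hε
    (fun _ : ℕ => ENNReal.ofReal (-Real.log ‖c‖)) (fun _ => ENNReal.ofReal_ne_top)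
  choose t ht htS htη using fun (n : ℕ) (w : {w : K // ‖w‖ ≤ 1}) =>
    exists_measure_disc_lt hmeas hu μ S hS hc1.le n w.2 (ENNReal.coe_pos.2 (hη0 n))
  have hstep : ∀ (n : ℕ) (w : {w : K // ‖w‖ ≤ 1}), ‖c ^ n * t n w‖ ≤ ‖c‖ ^ n := fun n w => by
    rw [norm_mul, norm_pow]
    exact mul_le_of_le_one_right (by positivity) (ht n w)
  let W : ℕ → {w : K // ‖w‖ ≤ 1} := fun n => Nat.rec ⟨0, by simp⟩ (fun n w => ⟨w + c ^ n * t n w,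
    norm_add_le_of_le w.2 ((hstep n w).trans (pow_le_one₀ hc0.le hc1.le))⟩) n
  have hW : ∀ n, (W (n + 1)).1 = (W n).1 + c ^ n * t n (W n) := by intro n; rfl
  have hcau : CauchySeq fun n => (W n).1 := by
    refine cauchySeq_of_le_geometric ‖c‖ 1 hc1 fun n => ?_
    rw [one_mul, dist_eq_norm, hW, norm_sub_rev, add_sub_cancel_left]
    exact hstep n _
  obtain ⟨w, hw⟩ := cauchySeq_tendsto_of_complete hcau
  have hdist : ∀ n, ‖w - (W n).1‖ ≤ ‖c‖ ^ n := by
    intro n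
    have hn : ∀ m, ‖(W (n + m)).1 - (W n).1‖ ≤ ‖c‖ ^ n := by
      intro m
      induction m with
      | zero => simp
      | succ m ih =>
        rw [← add_assoc, hW, add_sub_right_comm]
        exact norm_add_le_of_le ih ((hstep _ _).trans
          (pow_le_pow_of_le_one hc0.le hc1.le (Nat.le_add_right n m)))
    refine le_of_tendsto (((tendsto_add_atTop_iff_nat n).2 hw).sub_const (W n).1).norm
      (Eventually.of_forall fun m => ?_)
    rw [add_comm]
    exact hn m
  have hw1 : ‖w‖ ≤ 1 := le_of_tendsto hw.norm (Eventually.of_forall fun n => (W n).2)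
  refine ⟨w, hw1, fun s hs => ?_, ?_⟩
  · have h1 : ‖(W 1).1 - s‖ = 1 := by
      have : (W 1).1 = t 0 (W 0) := by
        refine (hW 0).trans ?_
        rw [pow_zero, one_mul]
        exact zero_add _
      rw [this]
      exact htS 0 _ s hs
    have h2 : ‖(W 1).1 - w‖ < 1 := by
      rw [norm_sub_rev]
      exact (hdist 1).trans_lt (by rwa [pow_one])
    rw [show w - s = ((W 1).1 - s) - ((W 1).1 - w) by ring, norm_sub_eq_max (by rw [h1]; exact h2.ne'),
      h1, max_eq_left h2.le]
  · calc ∫⁻ x, negLog (u w x) ∂μ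
        ≤ ∫⁻ x, (∑' n : ℕ, if u w x < ‖c‖ ^ n then ENNReal.ofReal (-Real.log ‖c‖) else 0) ∂μ :=
          lintegral_mono fun x => (negLog_layers hc0 hc1 (hu0 w x) (hu1 w x)).2
      _ = ∑' n : ℕ, ENNReal.ofReal (-Real.log ‖c‖) * μ {x | u w x < ‖c‖ ^ n} := by
          have hms : ∀ n : ℕ, MeasurableSet {x | u w x < ‖c‖ ^ n} := fun n =>
            measurableSet_lt (hmeas w hw1) measurable_const
          rw [lintegral_tsum fun n => (Measurable.ite (hms n) measurable_const
            measurable_const).aemeasurable]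
          refine tsum_congr fun n => ?_
          rw [← lintegral_indicator_const (hms n)]
          rfl
      _ ≤ ∑' n : ℕ, ENNReal.ofReal (-Real.log ‖c‖) * η n := by
          refine ENNReal.tsum_le_tsum fun n => ?_
          gcongr
          refine le_trans (measure_mono fun x hx => ?_) (htη n (W n)).le
          rw [Set.mem_ofPred_eq, ← hW]
          refine (hu' _ w x (W (n + 1)).2 hw1).trans_lt (max_lt ?_ hx)
          rw [norm_sub_rev]
          exact (hdist (n + 1)).trans_lt (pow_lt_pow_right_of_lt_one₀ hc0 hc1 (Nat.lt_succ_self n))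
      _ ≤ ε := hη.le

end NestedDiscs

section NonArchimedean

variable [NontriviallyNormedField K] [IsUltrametricDist K] [IsAlgClosed K]

lemma canonicalMeasure_eq_dirac :
    canonicalMeasure K = Measure.dirac (OnePoint.some (gaussPoint (K := K))) := by
  rw [canonicalMeasure, dif_pos ‹IsUltrametricDist K›]

lemma hasPotentialTheory_of_ultrametric [CompleteSpace K] : HasPotentialTheory K 0 where
  nonneg := le_rfl
  potential_canonicalMeasure x := by
    rw [canonicalMeasure_eq_dirac, lintegral_dirac' _ (measurable_negLogHsia x), negLogHsia_eq,
      hsia_gaussPoint, negLog_of_ne one_ne_zero]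
    simp
  energy_le μ ν _ _ _ _ := ultrametric_energy_le hsia_comm hsia_le_max hsia_nonneg hsia_le_one
    (fun x r => (isOpen_setOf_hsia_lt x r).measurableSet) μ ν
  mean_image_potential μ ψ V g κ hμ hg hV hg0 hint := by
    rw [canonicalMeasure_eq_dirac, integral_dirac' _ _ hg.measurable.stronglyMeasurable, neg_zero]
    set G : BerkP1 K := OnePoint.some gaussPoint with hG
    refine le_antisymm ?_ ?_
    · exact le_of_tendsto (((hg.tendsto G).comp (tendsto_toBerk_trace G)).add_const κ)
        (Eventually.of_forall fun w => hg0 w)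
    refine le_of_forall_pos_le_add fun ε hε => ?_
    have hN : {x | g x < g G + ε / 2} ∈ 𝓝 G :=
      hg.continuousAt.eventually (gt_mem_nhds (by linarith))
    obtain ⟨S, hS, hSN⟩ := exists_finset_of_mem_nhds_gaussPoint hN
    obtain ⟨w, hw, hwS, hwε⟩ := exists_lintegral_negLog_le
      (u := fun t x => V (ofAffine t) x)
      (fun t _ => (continuous_of_tendsto_trace (hV (ofAffine t))).measurable)
      (fun t x => ge_of_tendsto (hV _ x) (Eventually.of_forall fun z => chordal_nonneg _ _))
      (fun t x => le_of_tendsto (hV _ x) (Eventually.of_forall fun z => chordal_le_one _ _))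
      (fun s t x hs ht => ge_of_tendsto ((hV _ x).max (hV _ x)) (Eventually.of_forall fun z => by
        rw [← chordal_ofAffine_of_le hs ht, chordal_comm (ψ z) (ofAffine s)]
        exact chordal_le_max _ _ _))
      (fun s t x hs ht => le_of_tendsto_of_tendsto' (hV _ x) ((tendsto_const_nhds).max (hV _ x))
        fun z => by
          rw [← chordal_ofAffine_of_le hs ht, max_comm, chordal_comm (ofAffine s)]
          exact chordal_le_max _ _ _)
      μ S hS (ε := ENNReal.ofReal (ε / 2)) (by simpa using hε)
    rw [hint, ENNReal.ofReal_le_ofReal_iff (by positivity)] at hwε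
    have := hSN w hw hwS
    simp only [Set.mem_ofPred_eq] at this
    linarith

end NonArchimedean

/-! ### Archimedean fields -/

section Archimedean

/-- If `p n = n ^ s` for natural numbers `n`, then `p ^ (1 / s)` is subadditive. -/
lemma rpow_inv_add_le {R : Type*} [CommRing R] (p : MulRingSeminorm R) {s : ℝ} (hs : 0 < s)
    (hp : ∀ n : ℕ, p (n : R) = (n : ℝ) ^ s) (a b : R) :
    p (a + b) ^ s⁻¹ ≤ p a ^ s⁻¹ + p b ^ s⁻¹ := by
  set A := p a ^ s⁻¹ with hA
  set B := p b ^ s⁻¹ with hB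
  have hA0 : 0 ≤ A := Real.rpow_nonneg (apply_nonneg p a) _
  have hB0 : 0 ≤ B := Real.rpow_nonneg (apply_nonneg p b) _
  have hAs : A ^ s = p a := Real.rpow_inv_rpow (apply_nonneg p a) hs.ne'
  have hBs : B ^ s = p b := Real.rpow_inv_rpow (apply_nonneg p b) hs.ne'
  have hM0 : 0 ≤ (A + B) ^ s := Real.rpow_nonneg (add_nonneg hA0 hB0) _
  suffices h : p (a + b) ≤ (A + B) ^ s by
    calc p (a + b) ^ s⁻¹ ≤ ((A + B) ^ s) ^ s⁻¹ :=
          Real.rpow_le_rpow (apply_nonneg p _) h (inv_nonneg.2 hs.le)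
      _ = A + B := Real.rpow_rpow_inv (add_nonneg hA0 hB0) hs.ne'
  refine le_of_forall_pow_le hM0 fun n => ?_
  rw [← map_pow, add_pow]
  refine (Finset.le_sum_of_subadditive p (map_zero p).le (fun a b => map_add_le_add p a b)
    _ _).trans ?_
  have : ∀ m ∈ Finset.range (n + 1),
      p (a ^ m * b ^ (n - m) * (n.choose m : R)) ≤ ((A + B) ^ s) ^ n := by
    intro m hm
    rw [map_mul, map_mul, map_pow, map_pow, hp, ← hAs, ← hBs, ← Real.rpow_natCast (A ^ s),
      ← Real.rpow_natCast (B ^ s), ← Real.rpow_natCast ((A + B) ^ s), ← Real.rpow_mul hA0,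
      ← Real.rpow_mul hB0, ← Real.rpow_mul (add_nonneg hA0 hB0), mul_comm s, mul_comm s,
      mul_comm s, Real.rpow_mul hA0, Real.rpow_mul hB0, Real.rpow_mul (add_nonneg hA0 hB0),
      Real.rpow_natCast, Real.rpow_natCast, Real.rpow_natCast,
      ← Real.mul_rpow (by positivity) (by positivity), ← Real.mul_rpow (by positivity) (by positivity)]
    refine Real.rpow_le_rpow (by positivity) ?_ hs.le
    rw [add_pow]
    exact Finset.single_le_sum (f := fun m => A ^ m * B ^ (n - m) * (n.choose m : ℝ))
      (fun i _ => by positivity) hm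
  refine (Finset.sum_le_sum this).trans_eq ?_
  simp

variable [NontriviallyNormedField K]

lemma exists_norm_ratCast_eq_rpow [CharZero K] (h : ¬IsUltrametricDist K) :
    ∃ s : ℝ, 0 < s ∧ ∀ q : ℚ, ‖(q : K)‖ = |(q : ℝ)| ^ s := by
  rw [isUltrametricDist_iff_forall_norm_natCast_le_one] at h
  let v : AbsoluteValue ℚ ℝ :=
    (NormedField.toAbsoluteValue K).comp (f := Rat.castHom K) Rat.cast_injective
  have hv : ∀ q : ℚ, v q = ‖(q : K)‖ := fun q => rfl
  have hunb : ¬∀ n : ℕ, v (n : ℚ) ≤ 1 := by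
    simpa only [hv, Rat.cast_natCast] using h
  obtain ⟨c, hc, hvc⟩ := AbsoluteValue.isEquiv_iff_exists_rpow_eq.1
    (Rat.AbsoluteValue.equiv_real_of_unbounded hunb)
  refine ⟨c⁻¹, inv_pos.2 hc, fun q => ?_⟩
  have : ‖(q : K)‖ ^ c = |(q : ℝ)| := by
    rw [← hv]
    exact congrFun hvc q
  rw [← this, Real.rpow_rpow_inv (norm_nonneg _) hc.ne']

variable (K) in
/-- The power `‖·‖ ^ (1 / s)` of the norm, as an absolute value. -/
def rpowAbs {s : ℝ} (hs : 0 < s) (h : ∀ n : ℕ, ‖(n : K)‖ = (n : ℝ) ^ s) : AbsoluteValue K ℝ where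
  toFun x := ‖x‖ ^ s⁻¹
  map_mul' x y := by rw [norm_mul, Real.mul_rpow (norm_nonneg _) (norm_nonneg _)]
  nonneg' x := Real.rpow_nonneg (norm_nonneg _) _
  eq_zero' x := by
    rw [Real.rpow_eq_zero (norm_nonneg _) (inv_ne_zero hs.ne'), norm_eq_zero]
  add_le' x y := rpow_inv_add_le (NormedField.toMulRingNorm K).toMulRingSeminorm hs h x y

/-- Gelfand–Mazur for an absolute value that extends the one of `ℚ`. -/
lemma exists_ringEquiv_norm_eq {L : Type*} [NormedField L] [IsAlgClosed L] [CompleteSpace L]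
    (h : ∀ q : ℚ, ‖(q : L)‖ = |(q : ℝ)|) : ∃ e : L ≃+* ℂ, ∀ x, ‖x‖ = ‖e x‖ := by
  have : CharZero L := charZero_of_injective_ringHom (f := (algebraMap ℤ L)) (by
    rw [injective_iff_map_eq_zero]
    intro n hn
    have := h n
    rw [Rat.cast_intCast, show ((n : ℤ) : L) = 0 from hn, norm_zero] at this
    simpa using this.symm)
  have hiso : Isometry (Rat.castHom L) := by
    refine Isometry.of_dist_eq fun a b => ?_
    rw [dist_eq_norm, ← map_sub, Rat.dist_eq]
    change ‖((a - b : ℚ) : L)‖ = _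
    rw [h]
    push_cast
    rfl
  have hui : IsUniformInducing (Rat.castHom ℝ) := Rat.isUniformEmbedding_coe_real.isUniformInducing
  have hdr : DenseRange (Rat.castHom ℝ) := Rat.denseRange_cast
  let ι : ℝ →+* L := IsDenseInducing.extendRingHom hui hdr hiso.uniformContinuous
  have hιc : Continuous ι := (uniformContinuous_uniformly_extend hui hdr
    hiso.uniformContinuous).continuous
  have hι : ∀ r : ℝ, ‖ι r‖ = ‖r‖ := by
    refine fun r => DenseRange.induction_on hdr r (isClosed_eq hιc.norm continuous_norm) fun q => ?_
    rw [show ι ((Rat.castHom ℝ) q) = (q : L) from map_ratCast ι q, h]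
    rfl
  let _ : Algebra ℝ L := ι.toAlgebra
  let _ : NormedAlgebra ℝ L := ⟨fun r x => by
    rw [Algebra.smul_def, norm_mul]
    exact (congrArg (· * ‖x‖) (hι r)).le⟩
  rcases NormedAlgebra.Real.nonempty_algEquiv_or L with ⟨⟨e⟩⟩ | ⟨⟨e⟩⟩
  · obtain ⟨z, hz⟩ := IsAlgClosed.exists_pow_nat_eq (-1 : L) (n := 2) two_pos
    have := congrArg e hz
    rw [map_pow, map_neg, map_one] at this
    nlinarith [sq_nonneg (e z)]
  · have hI : ‖e.symm Complex.I‖ = 1 := by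
      have h1 : ‖e.symm Complex.I‖ ^ 2 = 1 := by
        rw [← norm_pow, ← map_pow, Complex.I_sq, map_neg, map_one, norm_neg, norm_one]
      exact (pow_eq_one_iff_of_nonneg (norm_nonneg _) two_ne_zero).1 h1
    have h2 : ∀ z : ℂ, ‖e.symm z‖ ≤ 2 * ‖z‖ := fun z => by
      have hz : e.symm z = algebraMap ℝ L z.re + algebraMap ℝ L z.im * e.symm Complex.I := by
        rw [← e.symm.commutes, ← e.symm.commutes, ← map_mul, ← map_add]
        congr 1
        exact (Complex.re_add_im z).symm
      rw [hz]
      refine (norm_add_le _ _).trans ?_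
      rw [norm_mul, hI, mul_one]
      have e1 : ‖algebraMap ℝ L z.re‖ = |z.re| := hι _
      have e2 : ‖algebraMap ℝ L z.im‖ = |z.im| := hι _
      rw [e1, e2, two_mul]
      exact add_le_add (Complex.abs_re_le_norm z) (Complex.abs_im_le_norm z)
    have h3 : ∀ z : ℂ, ‖e.symm z‖ ≤ ‖z‖ := fun z => by
      refine le_of_forall_pow_le (norm_nonneg z) fun n => ?_
      rcases Nat.eq_zero_or_pos n with rfl | hn
      · simp
      · rw [← norm_pow, ← map_pow]
        refine (h2 _).trans ?_
        rw [norm_pow]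
        have : (1 : ℝ) ≤ n := by exact_mod_cast hn
        gcongr
        linarith
    refine ⟨e.toRingEquiv, fun x => ?_⟩
    change ‖x‖ = ‖e x‖
    have hle : ∀ y : L, ‖y‖ ≤ ‖e y‖ := fun y => by simpa using h3 (e y)
    refine le_antisymm (hle x) ?_
    by_cases hx : x = 0
    · simp [hx]
    · have := hle x⁻¹
      rw [map_inv₀, norm_inv, norm_inv] at this
      exact (inv_le_inv₀ (norm_pos_iff.2 hx) (by simpa using hx)).1 this

/-- Ostrowski's theorem. -/
theorem exists_ringEquiv_complex [IsAlgClosed K] [CharZero K] [CompleteSpace K]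
    (h : ¬IsUltrametricDist K) :
    ∃ (e : K ≃+* ℂ) (s : ℝ), 0 < s ∧ ∀ x, ‖x‖ = ‖e x‖ ^ s := by
  obtain ⟨s, hs, hq⟩ := exists_norm_ratCast_eq_rpow h
  have hn : ∀ n : ℕ, ‖(n : K)‖ = (n : ℝ) ^ s := fun n => by simpa using hq n
  let v := rpowAbs K hs hn
  have hv : ∀ x : WithAbs v, ‖x‖ = ‖x.ofAbs‖ ^ s⁻¹ := fun x => rfl
  have : IsAlgClosed (WithAbs v) := IsAlgClosed.of_ringEquiv K _ (WithAbs.equiv v).symm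
  have : CompleteSpace (WithAbs v) := by
    refine Metric.complete_of_cauchySeq_tendsto fun u hu => ?_
    have hcu : CauchySeq fun n => (u n).ofAbs := by
      rw [Metric.cauchySeq_iff] at hu ⊢
      intro ε hε
      obtain ⟨N, hN⟩ := hu (ε ^ s⁻¹) (Real.rpow_pos_of_pos hε _)
      refine ⟨N, fun m hm n hn => ?_⟩
      have := hN m hm n hn
      rw [dist_eq_norm, hv, Real.rpow_lt_rpow_iff (norm_nonneg _) hε.le (inv_pos.2 hs)] at this
      rw [dist_eq_norm]
      exact this
    obtain ⟨x, hx⟩ := cauchySeq_tendsto_of_complete hcu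
    refine ⟨WithAbs.toAbs v x, ?_⟩
    rw [tendsto_iff_norm_sub_tendsto_zero] at hx ⊢
    have := hx.rpow_const (p := s⁻¹) (Or.inr (inv_nonneg.2 hs.le))
    rw [Real.zero_rpow (inv_ne_zero hs.ne')] at this
    exact this
  obtain ⟨e, he⟩ := exists_ringEquiv_norm_eq (L := WithAbs v) fun q => by
    rw [hv]
    change ‖(WithAbs.equiv v) (q : WithAbs v)‖ ^ s⁻¹ = _
    rw [map_ratCast, hq, Real.rpow_rpow_inv (abs_nonneg _) hs.ne']
  refine ⟨(WithAbs.equiv v).symm.trans e, s, hs, fun x => ?_⟩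
  change ‖x‖ = ‖e (WithAbs.toAbs v x)‖ ^ s
  rw [← he, hv, Real.rpow_inv_rpow (norm_nonneg _) hs.ne']

lemma BerkA1.eq_evalPoint (x : BerkA1 K) {z : K}
    (h : x.1 (Polynomial.X - Polynomial.C z) = 0) : x = evalPoint z := by
  refine Subtype.ext (MulRingSeminorm.ext fun p => ?_)
  change x.1 p = ‖p.eval z‖
  rw [← x.2 (p.eval z)]
  obtain ⟨q, hq⟩ := Polynomial.X_sub_C_dvd_sub_C_eval (p := p) (a := z)
  have h0 : x.1 (p - Polynomial.C (p.eval z)) = 0 := by rw [hq, map_mul, h, zero_mul]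
  have h1 := map_add_le_add x.1 (p - Polynomial.C (p.eval z)) (Polynomial.C (p.eval z))
  have h2 := map_add_le_add x.1 (-(p - Polynomial.C (p.eval z))) p
  rw [map_neg_eq_map] at h2
  rw [h0, zero_add, sub_add_cancel] at h1
  rw [h0, zero_add, show -(p - Polynomial.C (p.eval z)) + p = Polynomial.C (p.eval z) by ring] at h2
  exact le_antisymm h1 h2

/-- Over an archimedean field every point of the Berkovich affine line is classical. -/
lemma BerkA1.exists_eq_evalPoint [IsAlgClosed K] (e : K ≃+* ℂ) {s : ℝ} (hs : 0 < s)
    (he : ∀ x, ‖x‖ = ‖e x‖ ^ s) (x : BerkA1 K) : ∃ z, x = evalPoint z := by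
  by_contra! hne
  have hX : ∀ z, x.1 (Polynomial.X - Polynomial.C z) ≠ 0 := fun z hz => hne z (x.eq_evalPoint hz)
  have h0 : ∀ p : K[X], x.1 p = 0 ↔ p = 0 := by
    refine fun p => ⟨fun hp => ?_, fun hp => by rw [hp, map_zero]⟩
    rw [x.apply_eq_prod, mul_eq_zero, norm_eq_zero, Polynomial.leadingCoeff_eq_zero] at hp
    refine hp.resolve_right fun h => ?_
    rw [Multiset.prod_eq_zero_iff, Multiset.mem_map] at h
    obtain ⟨a, -, ha⟩ := h
    exact hX a ha
  have hnat : ∀ n : ℕ, x.1 (n : K[X]) = (n : ℝ) ^ s := fun n => by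
    rw [← map_natCast Polynomial.C, x.2, he, map_natCast, Complex.norm_natCast]
  let v : AbsoluteValue K[X] ℝ :=
    { toFun := fun p => x.1 p ^ s⁻¹
      map_mul' := fun p q => by
        rw [map_mul, Real.mul_rpow (x.apply_nonneg _) (x.apply_nonneg _)]
      nonneg' := fun p => Real.rpow_nonneg (x.apply_nonneg _) _
      eq_zero' := fun p => by
        rw [Real.rpow_eq_zero (x.apply_nonneg _) (inv_ne_zero hs.ne'), h0]
      add_le' := fun p q => rpow_inv_add_le x.1 hs hnat p q }
  have hv : ∀ p : WithAbs v, ‖p‖ = x.1 p.ofAbs ^ s⁻¹ := fun p => rfl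
  let ι : ℂ →+* WithAbs v := ((WithAbs.equiv v).symm : K[X] →+* WithAbs v).comp
    (Polynomial.C.comp (e.symm : ℂ →+* K))
  have hι : ∀ z, ‖ι z‖ = ‖z‖ := fun z => by
    rw [hv]
    change x.1 (Polynomial.C (e.symm z)) ^ s⁻¹ = _
    rw [x.2, he, RingEquiv.apply_symm_apply, Real.rpow_rpow_inv (norm_nonneg _) hs.ne']
  have hmul : ∀ p q : WithAbs v, ‖p * q‖ = ‖p‖ * ‖q‖ := fun p q => map_mul v p.ofAbs q.ofAbs
  let _ : Algebra ℂ (WithAbs v) := ι.toAlgebra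
  let _ : NormedAlgebra ℂ (WithAbs v) := ⟨fun r p => by
    rw [Algebra.smul_def, hmul]
    exact (congrArg (· * ‖p‖) (hι r)).le⟩
  have : NormMulClass (WithAbs v) := ⟨hmul⟩
  have : NormOneClass (WithAbs v) := ⟨map_one v⟩
  obtain ⟨z, hz⟩ := NormedAlgebra.Complex.exists_norm_sub_smul_one_eq_zero
    (WithAbs.toAbs v Polynomial.X)
  rw [hv, Real.rpow_eq_zero (x.apply_nonneg _) (inv_ne_zero hs.ne')] at hz
  exact hX (e.symm z) hz

lemma exists_toBerk_eq [IsAlgClosed K] (e : K ≃+* ℂ) {s : ℝ} (hs : 0 < s)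
    (he : ∀ x, ‖x‖ = ‖e x‖ ^ s) (x : BerkP1 K) : ∃ z, x = toBerk z := by
  induction x using OnePoint.rec with
  | infty => exact ⟨inftyPt, toBerk_inftyPt.symm⟩
  | coe x =>
    obtain ⟨z, rfl⟩ := x.exists_eq_evalPoint e hs he
    exact ⟨ofAffine z, (toBerk_ofAffine z).symm⟩

lemma trace_neBot_of_ringEquiv [IsAlgClosed K] (e : K ≃+* ℂ) {s : ℝ} (hs : 0 < s)
    (he : ∀ x, ‖x‖ = ‖e x‖ ^ s) (x : BerkP1 K) : (trace x).NeBot := by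
  obtain ⟨z, rfl⟩ := exists_toBerk_eq e hs he x
  infer_instance

end Archimedean

/-! ### The energy inequality over archimedean fields -/

section PositiveDefinite

variable {X : Type*} [MeasurableSpace X]

lemma lintegral_lintegral_ofReal_sum {ι : Type*} [Fintype ι] {Φ : ι → X → ℝ}
    (hΦ : ∀ i, Measurable (Φ i)) {B : ℝ} (hB : ∀ i x, |Φ i x| ≤ B)
    (h0 : ∀ x y, 0 ≤ ∑ i, Φ i x * Φ i y) (μ ν : Measure X) [IsProbabilityMeasure μ]
    [IsProbabilityMeasure ν] :
    (Measurable fun x => ∫⁻ y, ENNReal.ofReal (∑ i, Φ i x * Φ i y) ∂μ) ∧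
      ∫⁻ x, ∫⁻ y, ENNReal.ofReal (∑ i, Φ i x * Φ i y) ∂μ ∂ν =
        ENNReal.ofReal (∑ i, (∫ x, Φ i x ∂ν) * ∫ y, Φ i y ∂μ) := by
  have hint : ∀ (m : Measure X) [IsProbabilityMeasure m] i, Integrable (Φ i) m := fun m _ i =>
    Integrable.of_bound (hΦ i).aestronglyMeasurable B (Eventually.of_forall (hB i))
  have e1 : ∀ x, ∫ y, ∑ i, Φ i x * Φ i y ∂μ = ∑ i, Φ i x * ∫ y, Φ i y ∂μ := fun x => by
    rw [integral_finsetSum _ fun i _ => (hint μ i).const_mul _]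
    exact Finset.sum_congr rfl fun i _ => integral_const_mul _ _
  have e2 : ∀ x, ∫⁻ y, ENNReal.ofReal (∑ i, Φ i x * Φ i y) ∂μ =
      ENNReal.ofReal (∑ i, Φ i x * ∫ y, Φ i y ∂μ) := fun x => by
    rw [← e1, ofReal_integral_eq_lintegral_ofReal
      (integrable_finsetSum _ fun i _ => (hint μ i).const_mul _) (Eventually.of_forall (h0 x))]
  have e3 : ∀ x, 0 ≤ ∑ i, Φ i x * ∫ y, Φ i y ∂μ := fun x => by
    rw [← e1]
    exact integral_nonneg (h0 x)
  constructor
  · simp only [e2]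
    exact ENNReal.measurable_ofReal.comp
      (Finset.measurable_fun_sum _ fun i _ => (hΦ i).mul_const _)
  · simp only [e2]
    rw [← ofReal_integral_eq_lintegral_ofReal
      (integrable_finsetSum _ fun i _ => (hint ν i).mul_const _) (Eventually.of_forall e3),
      integral_finsetSum _ fun i _ => (hint ν i).mul_const _]
    congr 1
    exact Finset.sum_congr rfl fun i _ => integral_mul_const _ _

lemma negLog_eq_tsum {t : ℝ} (h0 : 0 ≤ t) (h1 : t ≤ 1) :
    negLog t = ∑' n : ℕ, ENNReal.ofReal (1 / (2 * (n + 1))) * ENNReal.ofReal ((1 - t ^ 2) ^ (n + 1)) := by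
  rcases h0.eq_or_lt with rfl | h0
  · rw [negLog_zero, eq_comm]
    by_contra h
    have h2 := ENNReal.summable_toReal h
    have h3 : Summable fun n : ℕ => 1 / ((n + 1 : ℕ) : ℝ) := by
      refine (h2.mul_left 2).congr fun n => ?_
      rw [← ENNReal.ofReal_mul (by positivity), ENNReal.toReal_ofReal (by positivity)]
      push_cast
      field_simp
      simp
    exact Real.not_summable_one_div_natCast ((summable_nat_add_iff 1).1 h3)
  · have ht2 : 0 < t ^ 2 := by positivity
    have ht1 : t ^ 2 ≤ 1 := by nlinarith
    have hs := Real.hasSum_pow_div_log_of_abs_lt_one (x := 1 - t ^ 2) (by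
      rw [abs_of_nonneg (by linarith)]
      linarith)
    rw [sub_sub_cancel, Real.log_pow] at hs
    have hs2 := hs.mul_left (1 / 2)
    have e : ∀ n : ℕ, ENNReal.ofReal (1 / (2 * (n + 1))) * ENNReal.ofReal ((1 - t ^ 2) ^ (n + 1)) =
        ENNReal.ofReal (1 / 2 * ((1 - t ^ 2) ^ (n + 1) / (n + 1))) := fun n => by
      rw [← ENNReal.ofReal_mul (by positivity)]
      congr 1
      field_simp
    have hnn : 0 ≤ 1 - t ^ 2 := by linarith
    simp only [e]
    rw [negLog_of_ne h0.ne', ← ENNReal.ofReal_tsum_of_nonneg (fun n => by positivity) hs2.summable,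
      hs2.tsum_eq]
    congr 1
    push_cast
    ring

/-- A kernel `k` for which `1 - k²` has finite rank and is positive semidefinite satisfies the
energy inequality. -/
lemma posDef_energy_le {ι : Type*} [Fintype ι] {Φ : ι → X → ℝ} (hΦ : ∀ i, Measurable (Φ i))
    (hB : ∀ i x, |Φ i x| ≤ 1) {k : X → X → ℝ} (h0 : ∀ x y, 0 ≤ k x y)
    (h1 : ∀ x y, k x y ≤ 1) (hk : ∀ x y, 1 - k x y ^ 2 = ∑ i, Φ i x * Φ i y)
    (μ ν : Measure X) [IsProbabilityMeasure μ] [IsProbabilityMeasure ν] :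
    (Measurable fun x => ∫⁻ y, negLog (k x y) ∂μ) ∧
    2 * ∫⁻ x, ∫⁻ y, negLog (k x y) ∂μ ∂ν ≤
      ∫⁻ x, ∫⁻ y, negLog (k x y) ∂ν ∂ν + ∫⁻ x, ∫⁻ y, negLog (k x y) ∂μ ∂μ := by
  have hpow : ∀ (n : ℕ) x y, (1 - k x y ^ 2) ^ n =
      ∑ p : Fin n → ι, (∏ i, Φ (p i) x) * ∏ i, Φ (p i) y := fun n x y => by
    rw [hk, Fintype.sum_pow]
    exact Finset.sum_congr rfl fun p _ => Finset.prod_mul_distrib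
  have hnn : ∀ (n : ℕ) x y, 0 ≤ (1 - k x y ^ 2) ^ n := fun n x y => by
    have : k x y ^ 2 ≤ 1 := pow_le_one₀ (h0 x y) (h1 x y)
    exact pow_nonneg (by linarith) n
  have hΨ : ∀ (n : ℕ) (p : Fin n → ι), Measurable fun x => ∏ i, Φ (p i) x := fun n p =>
    Finset.measurable_fun_prod _ fun i _ => hΦ (p i)
  have hΨB : ∀ (n : ℕ) (p : Fin n → ι) x, |∏ i, Φ (p i) x| ≤ 1 := fun n p x => by
    rw [Finset.abs_prod]
    exact Finset.prod_le_one (fun i _ => abs_nonneg _) fun i _ => hB (p i) x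
  let A : (n : ℕ) → (Fin n → ι) → Measure X → ℝ := fun n p m => ∫ x, ∏ i, Φ (p i) x ∂m
  have hterm : ∀ (n : ℕ) (m m' : Measure X) [IsProbabilityMeasure m] [IsProbabilityMeasure m'],
      (Measurable fun x => ∫⁻ y, ENNReal.ofReal ((1 - k x y ^ 2) ^ n) ∂m) ∧
        ∫⁻ x, ∫⁻ y, ENNReal.ofReal ((1 - k x y ^ 2) ^ n) ∂m ∂m' =
          ENNReal.ofReal (∑ p : Fin n → ι, A n p m' * A n p m) := by
    intro n m m' _ _
    simp only [hpow]
    refine lintegral_lintegral_ofReal_sum (hΨ n) (hΨB n) (fun x y => ?_) m m'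
    rw [← hpow]
    exact hnn n x y
  have hmeas : ∀ (n : ℕ) x, Measurable fun y => ENNReal.ofReal ((1 - k x y ^ 2) ^ n) := by
    intro n x
    simp only [hpow]
    exact ENNReal.measurable_ofReal.comp
      (Finset.measurable_fun_sum _ fun p _ => (hΨ n p).const_mul _)
  have hin : ∀ (m : Measure X) x, ∫⁻ y, negLog (k x y) ∂m = ∑' n : ℕ,
      ENNReal.ofReal (1 / (2 * (n + 1))) * ∫⁻ y, ENNReal.ofReal ((1 - k x y ^ 2) ^ (n + 1)) ∂m := by
    intro m x
    simp only [negLog_eq_tsum (h0 x _) (h1 x _)]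
    rw [lintegral_tsum fun n => ((hmeas (n + 1) x).const_mul _).aemeasurable]
    exact tsum_congr fun n => lintegral_const_mul _ (hmeas (n + 1) x)
  have hout : ∀ (m m' : Measure X) [IsProbabilityMeasure m] [IsProbabilityMeasure m'],
      ∫⁻ x, ∫⁻ y, negLog (k x y) ∂m ∂m' = ∑' n : ℕ, ENNReal.ofReal (1 / (2 * (n + 1))) *
        ENNReal.ofReal (∑ p : Fin (n + 1) → ι, A (n + 1) p m' * A (n + 1) p m) := by
    intro m m' _ _
    simp only [hin]
    rw [lintegral_tsum fun n => ((hterm (n + 1) m m').1.const_mul _).aemeasurable]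
    refine tsum_congr fun n => ?_
    rw [lintegral_const_mul _ (hterm (n + 1) m m').1, (hterm (n + 1) m m').2]
  constructor
  · simp only [hin]
    exact Measurable.tsum fun n => (hterm (n + 1) μ μ).1.const_mul _
  · rw [hout, hout, hout, ← ENNReal.tsum_mul_left, ← ENNReal.tsum_add]
    refine ENNReal.tsum_le_tsum fun n => ?_
    rw [mul_left_comm, ← mul_add]
    gcongr
    have hsq : ∀ m : Measure X, 0 ≤ ∑ p : Fin (n + 1) → ι, A (n + 1) p m * A (n + 1) p m :=
      fun m => Finset.sum_nonneg fun p _ => mul_self_nonneg _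
    rw [← ENNReal.ofReal_add (hsq ν) (hsq μ), show (2 : ℝ≥0∞) = ENNReal.ofReal 2 by simp,
      ← ENNReal.ofReal_mul (by norm_num), Finset.mul_sum, ← Finset.sum_add_distrib]
    refine ENNReal.ofReal_le_ofReal (Finset.sum_le_sum fun p _ => ?_)
    nlinarith [sq_nonneg (A (n + 1) p ν - A (n + 1) p μ)]

end PositiveDefinite

section Coordinates

variable [NontriviallyNormedField K]

lemma measurable_of_continuous_coe {Y : Type*} [TopologicalSpace Y] [MeasurableSpace Y]
    [BorelSpace Y] {φ : BerkP1 K → Y} (h : Continuous fun x : BerkA1 K => φ x) : Measurable φ := by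
  refine measurable_of_isOpen fun U hU => ?_
  have e : φ ⁻¹' U = OnePoint.some '' ((fun x : BerkA1 K => φ x) ⁻¹' U) ∪
      (φ ⁻¹' U ∩ {OnePoint.infty}) := by
    ext x
    induction x using OnePoint.rec with
    | infty => simp
    | coe x => simp
  rw [e]
  refine (OnePoint.isOpenEmbedding_coe.isOpenMap _ (hU.preimage h)).measurableSet.union ?_
  exact (Set.subsingleton_singleton.anti Set.inter_subset_right).measurableSet

open Classical in
/-- The affine coordinate of a classical point. -/
def classicalCoord (x : BerkA1 K) : K := if h : ∃ z, x = evalPoint z then h.choose else 0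

/-- Homogeneous coordinates of a classical point. -/
def homogCoord (x : BerkP1 K) : Fin 2 → K := x.elim ![1, 0] fun y => ![classicalCoord y, 1]

lemma homogCoord_ne_zero (x : BerkP1 K) : homogCoord x ≠ 0 := by
  induction x using OnePoint.rec with
  | infty => exact coaffine_ne_zero 0
  | coe x => exact affine_ne_zero _

lemma evalPoint_classicalCoord (hcl : ∀ x : BerkA1 K, ∃ z, x = evalPoint z)
    (x : BerkA1 K) : evalPoint (classicalCoord x) = x := by
  rw [classicalCoord, dif_pos (hcl x)]
  exact (hcl x).choose_spec.symm

lemma continuous_classicalCoord (hcl : ∀ x : BerkA1 K, ∃ z, x = evalPoint z) :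
    Continuous (classicalCoord (K := K)) := by
  rw [continuous_iff_continuousAt]
  intro x
  rw [ContinuousAt, tendsto_iff_norm_sub_tendsto_zero]
  have h := (BerkA1.continuous_apply (K := K)
    (Polynomial.X - Polynomial.C (classicalCoord x))).tendsto x
  have e : ∀ y : BerkA1 K, y.1 (Polynomial.X - Polynomial.C (classicalCoord x)) =
      ‖classicalCoord y - classicalCoord x‖ := fun y => by
    conv_lhs => rw [← evalPoint_classicalCoord hcl y]
    change ‖(Polynomial.X - Polynomial.C (classicalCoord x)).eval (classicalCoord y)‖ = _
    simp
  simp only [e, sub_self, norm_zero] at h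
  exact h

lemma measurable_homogCoord (hcl : ∀ x : BerkA1 K, ∃ z, x = evalPoint z)
    {φ : K → ℂ} (hφ : Continuous φ) (i : Fin 2) :
    Measurable fun x : BerkP1 K => φ (homogCoord x i) := by
  refine measurable_of_continuous_coe ?_
  fin_cases i
  · exact hφ.comp (continuous_classicalCoord hcl)
  · exact (continuous_const : Continuous fun _ : BerkA1 K => φ 1)

lemma toBerk_homogCoord (hcl : ∀ x : BerkA1 K, ∃ z, x = evalPoint z) (x : BerkP1 K) :
    toBerk (Projectivization.mk K (homogCoord x) (homogCoord_ne_zero x)) = x := by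
  induction x using OnePoint.rec with
  | infty => exact toBerk_inftyPt
  | coe x =>
    refine (toBerk_ofAffine (classicalCoord x)).trans ?_
    rw [evalPoint_classicalCoord hcl]

lemma hsia_eq_wedge_homogCoord (hcl : ∀ x : BerkA1 K, ∃ z, x = evalPoint z)
    [∀ x : BerkP1 K, (trace x).NeBot] (x y : BerkP1 K) :
    hsia x y = ‖wedge (homogCoord x) (homogCoord y)‖ /
      (norm2 (homogCoord x) * norm2 (homogCoord y)) := by
  conv_lhs => rw [← toBerk_homogCoord hcl x, ← toBerk_homogCoord hcl y, hsia_toBerk, chordal_mk]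

end Coordinates

section Energy

lemma lagrange_identity (a b c d : ℂ) :
    ‖a * d - b * c‖ ^ 2 + ((‖a‖ ^ 2 * ‖c‖ ^ 2 + ‖b‖ ^ 2 * ‖d‖ ^ 2) +
      2 * ((a * star b).re * (c * star d).re + (a * star b).im * (c * star d).im)) =
      (‖a‖ ^ 2 + ‖b‖ ^ 2) * (‖c‖ ^ 2 + ‖d‖ ^ 2) := by
  simp only [← Complex.normSq_eq_norm_sq, Complex.normSq_apply]
  simp
  ring

/-- The entries of the orthogonal projection onto the line spanned by `(a, b)`. -/
def projEntry (a b : ℂ) : Fin 4 → ℝ :=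
  ![‖a‖ ^ 2 / (‖a‖ ^ 2 + ‖b‖ ^ 2), ‖b‖ ^ 2 / (‖a‖ ^ 2 + ‖b‖ ^ 2),
    √2 * (a * star b).re / (‖a‖ ^ 2 + ‖b‖ ^ 2), √2 * (a * star b).im / (‖a‖ ^ 2 + ‖b‖ ^ 2)]

lemma sum_projEntry {a b c d : ℂ} (h : 0 < ‖a‖ ^ 2 + ‖b‖ ^ 2) (h' : 0 < ‖c‖ ^ 2 + ‖d‖ ^ 2) :
    1 - (‖a * d - b * c‖ / (√(‖a‖ ^ 2 + ‖b‖ ^ 2) * √(‖c‖ ^ 2 + ‖d‖ ^ 2))) ^ 2 =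
      ∑ i, projEntry a b i * projEntry c d i := by
  rw [div_pow, mul_pow, Real.sq_sqrt h.le, Real.sq_sqrt h'.le]
  have := lagrange_identity a b c d
  have h2 : √2 * √2 = (2 : ℝ) := Real.mul_self_sqrt (by norm_num)
  simp only [projEntry, Fin.sum_univ_four, Matrix.cons_val]
  generalize (a * star b).re = p at *
  generalize (a * star b).im = q at *
  generalize (c * star d).re = p' at *
  generalize (c * star d).im = q' at *
  have e : ∀ P Q u v : ℝ, √2 * P / u * (√2 * Q / v) = 2 * (P * Q) / (u * v) := fun P Q u v => by
    rw [div_mul_div_comm, mul_mul_mul_comm, h2]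
  rw [e, e, div_mul_div_comm, div_mul_div_comm, ← add_div, ← add_div, ← add_div,
    eq_div_iff (by positivity), sub_mul, div_mul_cancel₀ _ (by positivity), one_mul, ← this]
  ring

lemma abs_projEntry_le {a b : ℂ} (h : 0 < ‖a‖ ^ 2 + ‖b‖ ^ 2) (i : Fin 4) :
    |projEntry a b i| ≤ 1 := by
  have hs := sum_projEntry h h
  rw [show a * b - b * a = 0 by ring, norm_zero, zero_div] at hs
  have h1 : projEntry a b i * projEntry a b i ≤ 1 := by
    calc projEntry a b i * projEntry a b i ≤ ∑ i, projEntry a b i * projEntry a b i :=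
          Finset.single_le_sum (f := fun i => projEntry a b i * projEntry a b i)
            (fun i _ => mul_self_nonneg _) (Finset.mem_univ i)
      _ = 1 := by rw [← hs]; norm_num
  rw [abs_le_one_iff_mul_self_le_one]
  exact h1

variable [NontriviallyNormedField K] [IsAlgClosed K]

lemma archimedean_energy_le (hna : ¬IsUltrametricDist K) (e : K ≃+* ℂ) {s : ℝ} (hs : 0 < s)
    (he : ∀ x, ‖x‖ = ‖e x‖ ^ s) (hec : Continuous e) (μ ν : Measure (BerkP1 K))
    [IsProbabilityMeasure μ] [IsProbabilityMeasure ν] :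
    2 * ∫⁻ x, ∫⁻ y, negLogHsia x y ∂μ ∂ν ≤
      ∫⁻ x, ∫⁻ y, negLogHsia x y ∂ν ∂ν + ∫⁻ x, ∫⁻ y, negLogHsia x y ∂μ ∂μ := by
  have hcl := BerkA1.exists_eq_evalPoint e hs he
  have : ∀ x : BerkP1 K, (trace x).NeBot := trace_neBot_of_ringEquiv e hs he
  have hs1 : s ≤ 1 := by
    have h2 : ‖(2 : K)‖ ≤ 2 := by
      rw [← one_add_one_eq_two]
      exact (norm_add_le _ _).trans (by rw [norm_one]; norm_num)
    rw [he, map_ofNat, Complex.norm_ofNat] at h2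
    by_contra! h
    have := Real.rpow_lt_rpow_of_exponent_lt (one_lt_two) h
    rw [Real.rpow_one] at this
    linarith
  let p : BerkP1 K → ℂ := fun x => e (homogCoord x 0)
  let q : BerkP1 K → ℂ := fun x => e (homogCoord x 1)
  have hp : Measurable p := measurable_homogCoord hcl hec 0
  have hq : Measurable q := measurable_homogCoord hcl hec 1
  have hpq : ∀ x, 0 < ‖p x‖ ^ 2 + ‖q x‖ ^ 2 := fun x => by
    by_contra! h
    have h1 : ‖p x‖ = 0 := by nlinarith [sq_nonneg ‖p x‖, sq_nonneg ‖q x‖]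
    have h2 : ‖q x‖ = 0 := by nlinarith [sq_nonneg ‖p x‖, sq_nonneg ‖q x‖]
    refine homogCoord_ne_zero x (funext fun i => ?_)
    fin_cases i
    · simpa [p] using h1
    · simpa [q] using h2
  let E : BerkP1 K → ℝ := fun x => √(‖p x‖ ^ 2 + ‖q x‖ ^ 2)
  let N : BerkP1 K → ℝ := fun x => norm2 (homogCoord x)
  have hE : ∀ x, 0 < E x := fun x => Real.sqrt_pos.2 (hpq x)
  have hN : ∀ x, 0 < N x := fun x => norm2_pos (homogCoord_ne_zero x)
  have hN' : ∀ x, N x = √((‖p x‖ ^ s) ^ 2 + (‖q x‖ ^ s) ^ 2) := fun x => by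
    simp only [N, norm2, if_neg hna, he, p, q]
  have hEN : ∀ x, E x ^ s ≤ N x := fun x => by
    rw [hN']
    refine Real.le_sqrt_of_sq_le ?_
    have e1 : ∀ t : ℝ, 0 ≤ t → (t ^ s) ^ 2 = (t ^ 2) ^ s := fun t ht => by
      rw [← Real.rpow_natCast, ← Real.rpow_natCast, ← Real.rpow_mul ht, ← Real.rpow_mul ht,
        mul_comm]
    rw [e1 _ (hE x).le, e1 _ (norm_nonneg _), e1 _ (norm_nonneg _), Real.sq_sqrt (hpq x).le]
    exact Real.rpow_add_le_add_rpow (sq_nonneg _) (sq_nonneg _) hs.le hs1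
  let ψ : BerkP1 K → ℝ := fun x => Real.log (N x) - s * Real.log (E x)
  have hψ0 : ∀ x, 0 ≤ ψ x := fun x => by
    rw [sub_nonneg, ← Real.log_rpow (hE x)]
    exact Real.log_le_log (Real.rpow_pos_of_pos (hE x) s) (hEN x)
  have hψm : Measurable ψ := by
    have hNm : Measurable N := by
      simp only [funext hN']
      fun_prop
    fun_prop
  let k : BerkP1 K → BerkP1 K → ℝ := fun x y => ‖p x * q y - q x * p y‖ / (E x * E y)
  have hk0 : ∀ x y, 0 ≤ k x y := fun x y => by positivity
  have hk : ∀ x y, 1 - k x y ^ 2 = ∑ i, projEntry (p x) (q x) i * projEntry (p y) (q y) i :=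
    fun x y => sum_projEntry (hpq x) (hpq y)
  have hk1 : ∀ x y, k x y ≤ 1 := fun x y => by
    have h1 := lagrange_identity (p x) (q x) (p y) (q y)
    refine div_le_one_of_le₀ ?_ (mul_pos (hE x) (hE y)).le
    rw [← Real.sqrt_mul (hpq x).le]
    refine Real.le_sqrt_of_sq_le ?_
    rw [← h1]
    have h2 : ∀ a b : ℂ, (a * star b).re ^ 2 + (a * star b).im ^ 2 = ‖a‖ ^ 2 * ‖b‖ ^ 2 :=
      fun a b => by
        rw [← mul_pow, ← norm_star b, ← norm_mul, ← Complex.normSq_eq_norm_sq,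
          Complex.normSq_apply]
        ring
    have h3 := h2 (p x) (q x)
    have h4 := h2 (p y) (q y)
    generalize (p x * star (q x)).re = r1 at *
    generalize (p x * star (q x)).im = r2 at *
    generalize (p y * star (q y)).re = r3 at *
    generalize (p y * star (q y)).im = r4 at *
    have h5 : (r1 * r3 + r2 * r4) ^ 2 ≤ (‖p x‖ * ‖q x‖ * (‖p y‖ * ‖q y‖)) ^ 2 := by
      rw [mul_pow, mul_pow, mul_pow, ← h3, ← h4]
      nlinarith [sq_nonneg (r1 * r4 - r2 * r3)]
    have h6 := abs_le_of_sq_le_sq' h5 (by positivity)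
    nlinarith [sq_nonneg (‖p x‖ * ‖p y‖ - ‖q x‖ * ‖q y‖), h6.1]
  have hkey : ∀ x y, negLogHsia x y =
      ENNReal.ofReal s * negLog (k x y) + ENNReal.ofReal (ψ x) + ENNReal.ofReal (ψ y) := by
    intro x y
    have hW : ‖wedge (homogCoord x) (homogCoord y)‖ = ‖p x * q y - q x * p y‖ ^ s := by
      rw [he, wedge, map_sub, map_mul, map_mul]
    rw [negLogHsia_eq, hsia_eq_wedge_homogCoord hcl, hW]
    change negLog (_ / (N x * N y)) = _
    by_cases h0 : ‖p x * q y - q x * p y‖ = 0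
    · simp only [k, h0]
      rw [Real.zero_rpow hs.ne', zero_div, zero_div, negLog_zero,
        ENNReal.mul_top (by simpa using hs), top_add, top_add]
    · have hpos : 0 < ‖p x * q y - q x * p y‖ := lt_of_le_of_ne (norm_nonneg _) (Ne.symm h0)
      have hkpos : 0 < k x y := div_pos hpos (mul_pos (hE x) (hE y))
      rw [negLog_of_ne (div_pos (Real.rpow_pos_of_pos hpos s) (mul_pos (hN x) (hN y))).ne',
        negLog_of_ne hkpos.ne', ← ENNReal.ofReal_mul hs.le, ← ENNReal.ofReal_add
          (mul_nonneg hs.le (neg_nonneg.2 (Real.log_nonpos hkpos.le (hk1 x y)))) (hψ0 x),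
        ← ENNReal.ofReal_add (add_nonneg (mul_nonneg hs.le (neg_nonneg.2
          (Real.log_nonpos hkpos.le (hk1 x y)))) (hψ0 x)) (hψ0 y)]
      congr 1
      simp only [k, ψ]
      rw [Real.log_div (Real.rpow_pos_of_pos hpos s).ne' (mul_pos (hN x) (hN y)).ne',
        Real.log_div h0 (mul_pos (hE x) (hE y)).ne', Real.log_mul (hN x).ne' (hN y).ne',
        Real.log_mul (hE x).ne' (hE y).ne', Real.log_rpow hpos]
      ring
  have hfeat : ∀ i, Measurable fun x => projEntry (p x) (q x) i := fun i => by
    have hre : Measurable fun x => (p x * star (q x)).re :=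
      Complex.measurable_re.comp (hp.mul (continuous_star.measurable.comp hq))
    have him : Measurable fun x => (p x * star (q x)).im :=
      Complex.measurable_im.comp (hp.mul (continuous_star.measurable.comp hq))
    have hden : Measurable fun x => ‖p x‖ ^ 2 + ‖q x‖ ^ 2 := by fun_prop
    fin_cases i
    · exact (hp.norm.pow_const 2).div hden
    · exact (hq.norm.pow_const 2).div hden
    · exact (hre.const_mul _).div hden
    · exact (him.const_mul _).div hden
  have hen := fun (m m' : Measure (BerkP1 K)) [IsProbabilityMeasure m] [IsProbabilityMeasure m'] =>
    posDef_energy_le hfeat (fun i x => abs_projEntry_le (hpq x) i) hk0 hk1 hk m m'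
  have hψe : Measurable fun x => ENNReal.ofReal (ψ x) := ENNReal.measurable_ofReal.comp hψm
  have hsplit : ∀ (m m' : Measure (BerkP1 K)) [IsProbabilityMeasure m] [IsProbabilityMeasure m'],
      ∫⁻ x, ∫⁻ y, negLogHsia x y ∂m ∂m' =
        ENNReal.ofReal s * ∫⁻ x, ∫⁻ y, negLog (k x y) ∂m ∂m' +
          ∫⁻ x, ENNReal.ofReal (ψ x) ∂m' + ∫⁻ x, ENNReal.ofReal (ψ x) ∂m := by
    intro m m' _ _
    simp only [hkey]
    have e1 : ∀ x, ∫⁻ y, (ENNReal.ofReal s * negLog (k x y) + ENNReal.ofReal (ψ x) +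
        ENNReal.ofReal (ψ y)) ∂m = ENNReal.ofReal s * ∫⁻ y, negLog (k x y) ∂m +
          ENNReal.ofReal (ψ x) + ∫⁻ y, ENNReal.ofReal (ψ y) ∂m := fun x => by
      rw [lintegral_add_right _ hψe, lintegral_add_right _ measurable_const, lintegral_const,
        measure_univ, mul_one, lintegral_const_mul' _ _ ENNReal.ofReal_ne_top]
    simp only [e1]
    rw [lintegral_add_right _ measurable_const, lintegral_add_right _ hψe, lintegral_const,
      measure_univ, mul_one, lintegral_const_mul' _ _ ENNReal.ofReal_ne_top]
  rw [hsplit, hsplit, hsplit]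
  have hmain := (hen μ ν).2
  calc _ = ENNReal.ofReal s * (2 * ∫⁻ x, ∫⁻ y, negLog (k x y) ∂μ ∂ν) +
        2 * (∫⁻ x, ENNReal.ofReal (ψ x) ∂ν + ∫⁻ x, ENNReal.ofReal (ψ x) ∂μ) := by ring
    _ ≤ ENNReal.ofReal s * (∫⁻ x, ∫⁻ y, negLog (k x y) ∂ν ∂ν + ∫⁻ x, ∫⁻ y, negLog (k x y) ∂μ ∂μ) +
        2 * (∫⁻ x, ENNReal.ofReal (ψ x) ∂ν + ∫⁻ x, ENNReal.ofReal (ψ x) ∂μ) := by gcongr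
    _ = _ := by ring

end Energy

/-! ### The Fubini–Study potential -/

section FubiniStudy

/-- The potential of the Fubini–Study area element at distance `A`, as a function of
the squared chordal distance `t` from the origin. -/
def radialKernel (A t : ℝ) : ℝ := -(1 / 2) * Real.log (max A t) - 1 / 2 * Real.log (1 - min A t)

lemma radialKernel_nonneg {A t : ℝ} (hA : A ∈ Set.Icc (0 : ℝ) 1) (ht : t ∈ Set.Icc (0 : ℝ) 1) :
    0 ≤ radialKernel A t := by
  have h1 : Real.log (max A t) ≤ 0 := Real.log_nonpos (le_max_of_le_left hA.1) (max_le hA.2 ht.2)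
  have h2 : Real.log (1 - min A t) ≤ 0 := by
    refine Real.log_nonpos ?_ ?_
    · have := min_le_of_left_le (b := A) (c := t) hA.2
      linarith
    · have := le_min hA.1 ht.1
      linarith
  rw [radialKernel]
  linarith

lemma lintegral_radialKernel {A : ℝ} (hA : A ∈ Set.Icc (0 : ℝ) 1) :
    ∫⁻ t in Set.Icc (0 : ℝ) 1, ENNReal.ofReal (radialKernel A t) = ENNReal.ofReal (1 / 2) := by
  have hlog : ∀ a b : ℝ, IntervalIntegrable (fun t => Real.log (1 - t)) volume a b := fun a b => by
    have := (intervalIntegral.intervalIntegrable_log' (a := 1 - a) (b := 1 - b)).comp_sub_left 1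
    simpa using this
  have hl : Set.EqOn (fun t => -(1 / 2) * Real.log A - 1 / 2 * Real.log (1 - t)) (radialKernel A)
      (Set.uIcc 0 A) := by
    intro t ht
    rw [Set.uIcc_of_le hA.1] at ht
    simp only [radialKernel]
    rw [max_eq_left ht.2, min_eq_right ht.2]
  have hr : Set.EqOn (fun t => -(1 / 2) * Real.log t - 1 / 2 * Real.log (1 - A)) (radialKernel A)
      (Set.uIcc A 1) := by
    intro t ht
    rw [Set.uIcc_of_le hA.2] at ht
    simp only [radialKernel]
    rw [max_eq_right ht.1, min_eq_left ht.1]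
  have hil : IntervalIntegrable (fun t => -(1 / 2) * Real.log A - 1 / 2 * Real.log (1 - t))
      volume 0 A := intervalIntegrable_const.sub ((hlog 0 A).const_mul _)
  have hir : IntervalIntegrable (fun t => -(1 / 2) * Real.log t - 1 / 2 * Real.log (1 - A))
      volume A 1 :=
    (intervalIntegral.intervalIntegrable_log'.const_mul _).sub intervalIntegrable_const
  have hil' : IntervalIntegrable (radialKernel A) volume 0 A :=
    hil.congr fun t ht => hl (Set.uIoc_subset_uIcc ht)
  have hir' : IntervalIntegrable (radialKernel A) volume A 1 :=
    hir.congr fun t ht => hr (Set.uIoc_subset_uIcc ht)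
  have hint : ∫ t in (0 : ℝ)..1, radialKernel A t = 1 / 2 := by
    rw [← intervalIntegral.integral_add_adjacent_intervals hil' hir',
      ← intervalIntegral.integral_congr hl, ← intervalIntegral.integral_congr hr,
      intervalIntegral.integral_sub intervalIntegrable_const ((hlog 0 A).const_mul _),
      intervalIntegral.integral_sub (intervalIntegral.intervalIntegrable_log'.const_mul _)
        intervalIntegrable_const]
    simp only [intervalIntegral.integral_const_mul, intervalIntegral.integral_const,
      intervalIntegral.integral_comp_sub_left Real.log, integral_log, smul_eq_mul, sub_zero,
      Real.log_one]
    ring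
  rw [← ofReal_integral_eq_lintegral_ofReal, integral_Icc_eq_integral_Ioc,
    ← intervalIntegral.integral_of_le zero_le_one, hint]
  · rw [← IntegrableOn, integrableOn_Icc_iff_integrableOn_Ioc,
      ← intervalIntegrable_iff_integrableOn_Ioc_of_le zero_le_one]
    exact hil'.trans hir'
  · filter_upwards [ae_restrict_mem measurableSet_Icc] with t ht
    exact radialKernel_nonneg hA ht

lemma radialKernel_eq {x y : ℝ} (hx : 0 ≤ x) (hy : 0 < y) :
    radialKernel (x ^ 2 / (1 + x ^ 2)) (y ^ 2 / (1 + y ^ 2)) =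
      1 / 2 * Real.log (1 + x ^ 2) + 1 / 2 * Real.log (1 + y ^ 2) - Real.log (max x y) := by
  have h1 : ∀ t : ℝ, 1 - t ^ 2 / (1 + t ^ 2) = (1 + t ^ 2)⁻¹ := fun t => by
    field_simp
    ring
  have h2 : ∀ t : ℝ, 0 < t →
      Real.log (t ^ 2 / (1 + t ^ 2)) = 2 * Real.log t - Real.log (1 + t ^ 2) := fun t ht => by
    rw [Real.log_div (by positivity) (by positivity), Real.log_pow]
    norm_num
  have hmono : ∀ a b : ℝ, 0 ≤ a → a ≤ b → a ^ 2 / (1 + a ^ 2) ≤ b ^ 2 / (1 + b ^ 2) := by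
    intro a b ha hab
    rw [div_le_div_iff₀ (by positivity) (by positivity)]
    nlinarith [pow_le_pow_left₀ ha hab 2]
  rw [radialKernel]
  rcases le_total x y with h | h
  · rw [max_eq_right (hmono x y hx h), min_eq_left (hmono x y hx h), max_eq_right h, h1, h2 y hy,
      Real.log_inv]
    ring
  · rw [max_eq_left (hmono y x hy.le h), min_eq_right (hmono y x hy.le h), max_eq_left h, h1,
      h2 x (hy.trans_le h), Real.log_inv]
    ring

lemma sq_div_one_add_sq_mem (x : ℝ) : x ^ 2 / (1 + x ^ 2) ∈ Set.Icc (0 : ℝ) 1 :=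
  ⟨by positivity, div_le_one_of_le₀ (by linarith) (by positivity)⟩

variable [NontriviallyNormedField K]

section Measure

variable [MeasurableSpace K] [BorelSpace K] {ν : Measure K}

lemma IsFubiniStudy.map_eq_volume (hν : IsFubiniStudy ν) :
    ν.map (fun w => ‖w‖ ^ 2 / (1 + ‖w‖ ^ 2)) = volume.restrict (Set.Icc (0 : ℝ) 1) := by
  obtain ⟨hprob, -, hball⟩ := hν
  have hm : Measurable fun w : K => ‖w‖ ^ 2 / (1 + ‖w‖ ^ 2) := by
    have : Measurable fun w : K => ‖w‖ := continuous_norm.measurable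
    fun_prop
  have : IsProbabilityMeasure (ν.map fun w => ‖w‖ ^ 2 / (1 + ‖w‖ ^ 2)) :=
    Measure.isProbabilityMeasure_map hm.aemeasurable
  refine Measure.ext_of_Iic _ _ fun a => ?_
  rw [Measure.map_apply hm measurableSet_Iic, Measure.restrict_apply measurableSet_Iic]
  rcases lt_or_ge a 0 with h0 | h0
  · have e1 : (fun w : K => ‖w‖ ^ 2 / (1 + ‖w‖ ^ 2)) ⁻¹' Set.Iic a = ∅ := by
      ext w
      simpa using h0.trans_le (sq_div_one_add_sq_mem ‖w‖).1
    have e2 : Set.Iic a ∩ Set.Icc (0 : ℝ) 1 = ∅ := by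
      ext t
      simp only [Set.mem_inter_iff, Set.mem_Iic, Set.mem_Icc, Set.mem_empty_iff_false, iff_false]
      intro h
      linarith [h.1, h.2.1]
    rw [e1, e2, measure_empty, measure_empty]
  rcases lt_or_ge a 1 with h1 | h1
  · have e1 : (fun w : K => ‖w‖ ^ 2 / (1 + ‖w‖ ^ 2)) ⁻¹' Set.Iic a =
        Metric.closedBall 0 √(a / (1 - a)) := by
      ext w
      rw [Set.mem_preimage, Set.mem_Iic, mem_closedBall_zero_iff, div_le_iff₀ (by positivity),
        Real.le_sqrt (norm_nonneg _) (div_nonneg h0 (by linarith)), le_div_iff₀ (by linarith)]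
      constructor <;> intro h <;> linarith
    have e2 : Set.Iic a ∩ Set.Icc (0 : ℝ) 1 = Set.Icc 0 a := by
      ext t
      simp only [Set.mem_inter_iff, Set.mem_Iic, Set.mem_Icc]
      constructor
      · exact fun h => ⟨h.2.1, h.1⟩
      · exact fun h => ⟨h.2, h.1, by linarith [h.2]⟩
    rw [e1, e2, hball _ (Real.sqrt_nonneg _), Real.volume_Icc,
      Real.sq_sqrt (div_nonneg h0 (by linarith))]
    congr 1
    have : 1 - a ≠ 0 := by linarith
    field_simp
    ring
  · have e1 : (fun w : K => ‖w‖ ^ 2 / (1 + ‖w‖ ^ 2)) ⁻¹' Set.Iic a = Set.univ := by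
      ext w
      simpa using (sq_div_one_add_sq_mem ‖w‖).2.trans h1
    have e2 : Set.Iic a ∩ Set.Icc (0 : ℝ) 1 = Set.Icc 0 1 := by
      refine Set.inter_eq_right.2 fun t ht => ht.2.trans h1
    rw [e1, e2, measure_univ, Real.volume_Icc]
    simp

lemma IsFubiniStudy.lintegral_radialKernel (hν : IsFubiniStudy ν) {A : ℝ}
    (hA : A ∈ Set.Icc (0 : ℝ) 1) :
    ∫⁻ w, ENNReal.ofReal (radialKernel A (‖w‖ ^ 2 / (1 + ‖w‖ ^ 2))) ∂ν =
      ENNReal.ofReal (1 / 2) := by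
  have hm : Measurable fun w : K => ‖w‖ ^ 2 / (1 + ‖w‖ ^ 2) := by
    have : Measurable fun w : K => ‖w‖ := continuous_norm.measurable
    fun_prop
  have hG : Measurable fun t => ENNReal.ofReal (radialKernel A t) := by
    unfold radialKernel
    fun_prop
  rw [← BerkovichLine.lintegral_radialKernel hA, ← hν.map_eq_volume, lintegral_map hG hm]

lemma IsFubiniStudy.ae_ne_zero (hν : IsFubiniStudy ν) : ∀ᵐ w ∂ν, w ≠ 0 := by
  have := hν.2.2 0 le_rfl
  rw [Metric.closedBall_zero] at this
  rw [ae_iff]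
  simpa using this

end Measure

lemma norm2_affine_of_not_ultrametric (hna : ¬IsUltrametricDist K) (t : K) :
    norm2 ![t, 1] = √(1 + ‖t‖ ^ 2) := by
  rw [norm2, if_neg hna, add_comm]
  simp

lemma log_norm2_affine (hna : ¬IsUltrametricDist K) (t : K) :
    Real.log (norm2 ![t, 1]) = 1 / 2 * Real.log (1 + ‖t‖ ^ 2) := by
  rw [norm2_affine_of_not_ultrametric hna, Real.log_sqrt (by positivity)]
  ring

lemma continuous_ringEquiv (e : K ≃+* ℂ) {s : ℝ} (hs : 0 < s) (he : ∀ x, ‖x‖ = ‖e x‖ ^ s) :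
    Continuous e ∧ Continuous e.symm := by
  constructor
  · rw [continuous_iff_continuousAt]
    intro x
    rw [ContinuousAt, tendsto_iff_norm_sub_tendsto_zero]
    have h := (tendsto_iff_norm_sub_tendsto_zero.1 (tendsto_id (x := 𝓝 x))).rpow_const
      (p := s⁻¹) (Or.inr (inv_nonneg.2 hs.le))
    rw [Real.zero_rpow (inv_ne_zero hs.ne')] at h
    refine h.congr fun y => ?_
    rw [he, Real.rpow_rpow_inv (norm_nonneg _) hs.ne', map_sub]
    rfl
  · rw [continuous_iff_continuousAt]
    intro x
    rw [ContinuousAt, tendsto_iff_norm_sub_tendsto_zero]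
    have h := (tendsto_iff_norm_sub_tendsto_zero.1 (tendsto_id (x := 𝓝 x))).rpow_const
      (p := s) (Or.inr hs.le)
    rw [Real.zero_rpow hs.ne'] at h
    refine h.congr fun y => ?_
    rw [he, map_sub, RingEquiv.apply_symm_apply, RingEquiv.apply_symm_apply]
    rfl

/-- The circle average of the potential `-log [a, ·]`. -/
lemma lintegral_circle_negLog (hna : ¬IsUltrametricDist K) (e : K ≃+* ℂ) {s : ℝ} (hs : 0 < s)
    (he : ∀ x, ‖x‖ = ‖e x‖ ^ s) (a : K) {w : K} (hw : w ≠ 0) :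
    ∫⁻ θ in Set.Ioc 0 (2 * Real.pi),
        negLog (chordal (ofAffine a) (ofAffine (e.symm (circleMap 0 1 θ) * w))) =
      ENNReal.ofReal (2 * Real.pi) * ENNReal.ofReal (radialKernel (‖a‖ ^ 2 / (1 + ‖a‖ ^ 2))
        (‖w‖ ^ 2 / (1 + ‖w‖ ^ 2))) := by
  have hew : e w ≠ 0 := by simpa using hw
  have hW : 0 < ‖e w‖ := norm_pos_iff.2 hew
  set b : ℂ := e a / e w with hb
  have hu : ∀ θ : ℝ, ‖e.symm (circleMap 0 1 θ)‖ = 1 := fun θ => by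
    rw [he, RingEquiv.apply_symm_apply]
    simp
  have hsub : ∀ θ : ℝ, ‖a - e.symm (circleMap 0 1 θ) * w‖ =
      (‖e w‖ * ‖circleMap 0 1 θ - b‖) ^ s := fun θ => by
    rw [he, map_sub, map_mul, RingEquiv.apply_symm_apply, ← norm_mul, ← norm_neg]
    congr 2
    rw [hb]
    field_simp
    ring
  set M := Real.log (norm2 ![a, 1]) + Real.log (norm2 ![w, 1]) with hM
  have hae : ∀ᵐ θ ∂volume.restrict (Set.Ioc 0 (2 * Real.pi)), circleMap 0 1 θ ≠ b := by
    refine ae_restrict_of_ae ?_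
    have := ((Set.countable_singleton b).preimage_circleMap 0 (one_ne_zero (α := ℝ))).ae_notMem
      volume
    filter_upwards [this] with θ hθ h
    exact hθ h
  have hch : ∀ θ : ℝ, chordal (ofAffine a) (ofAffine (e.symm (circleMap 0 1 θ) * w)) =
      (‖e w‖ * ‖circleMap 0 1 θ - b‖) ^ s / (norm2 ![a, 1] * norm2 ![w, 1]) := fun θ => by
    rw [chordal_ofAffine, hsub, norm2_affine_of_not_ultrametric hna,
      norm2_affine_of_not_ultrametric hna, norm2_affine_of_not_ultrametric hna, norm_mul, hu, one_mul]
  have hna1 := norm2_pos (affine_ne_zero a)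
  have hnw1 := norm2_pos (affine_ne_zero w)
  have hlog : ∀ θ : ℝ, circleMap 0 1 θ ≠ b →
      Real.log (chordal (ofAffine a) (ofAffine (e.symm (circleMap 0 1 θ) * w))) =
        s * Real.log ‖circleMap 0 1 θ - b‖ + (s * Real.log ‖e w‖ - M) := fun θ hθ => by
    have h1 : 0 < ‖circleMap 0 1 θ - b‖ := norm_pos_iff.2 (sub_ne_zero.2 hθ)
    rw [hch, Real.log_div (by positivity) (by positivity), Real.log_rpow (by positivity),
      Real.log_mul hW.ne' h1.ne', Real.log_mul hna1.ne' hnw1.ne', hM]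
    ring
  have hci : IntervalIntegrable (fun θ => Real.log ‖circleMap 0 1 θ - b‖) volume 0
      (2 * Real.pi) := circleIntegrable_log_norm_sub_const 1
  have hpi := Real.two_pi_pos
  have hint : Integrable (fun θ => s * Real.log ‖circleMap 0 1 θ - b‖ + (s * Real.log ‖e w‖ - M))
      (volume.restrict (Set.Ioc 0 (2 * Real.pi))) := by
    have := (hci.const_mul s).add (intervalIntegrable_const (c := s * Real.log ‖e w‖ - M))
    rwa [intervalIntegrable_iff_integrableOn_Ioc_of_le hpi.le] at this
  have hcongr : (fun θ => s * Real.log ‖circleMap 0 1 θ - b‖ + (s * Real.log ‖e w‖ - M))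
      =ᵐ[volume.restrict (Set.Ioc 0 (2 * Real.pi))] fun θ =>
        Real.log (chordal (ofAffine a) (ofAffine (e.symm (circleMap 0 1 θ) * w))) := by
    filter_upwards [hae] with θ hθ
    exact (hlog θ hθ).symm
  have havg : ∫ θ in (0 : ℝ)..2 * Real.pi, Real.log ‖circleMap 0 1 θ - b‖ =
      2 * Real.pi * Real.posLog ‖b‖ := by
    have := circleAverage_log_norm_sub_const_eq_posLog (a := b)
    rw [Real.circleAverage_def, smul_eq_mul, inv_mul_eq_iff_eq_mul₀ hpi.ne'] at this
    exact this
  have hval : ∫ θ in Set.Ioc 0 (2 * Real.pi),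
      Real.log (chordal (ofAffine a) (ofAffine (e.symm (circleMap 0 1 θ) * w))) =
        2 * Real.pi * (s * (Real.log ‖e w‖ + Real.posLog ‖b‖) - M) := by
    rw [← integral_congr_ae hcongr, ← intervalIntegral.integral_of_le hpi.le,
      intervalIntegral.integral_add (hci.const_mul s) intervalIntegrable_const,
      intervalIntegral.integral_const_mul, havg]
    simp
    ring
  have hmax : s * (Real.log ‖e w‖ + Real.posLog ‖b‖) = Real.log (max ‖a‖ ‖w‖) := by
    rcases le_total ‖e a‖ ‖e w‖ with h | h
    · have h1 : ‖a‖ ≤ ‖w‖ := by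
        rw [he, he]
        exact Real.rpow_le_rpow (norm_nonneg _) h hs.le
      rw [max_eq_right h1, Real.posLog_eq_zero_iff _ |>.2, add_zero, he w, Real.log_rpow hW]
      rw [hb, norm_div, abs_div, abs_norm, abs_norm]
      exact div_le_one_of_le₀ h hW.le
    · have h1 : ‖w‖ ≤ ‖a‖ := by
        rw [he, he]
        exact Real.rpow_le_rpow (norm_nonneg _) h hs.le
      rw [max_eq_left h1, Real.posLog_eq_log, he a, Real.log_rpow (hW.trans_le h), hb, norm_div,
        Real.log_div (hW.trans_le h).ne' hW.ne']
      · ring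
      · rw [hb, norm_div, abs_div, abs_norm, abs_norm]
        exact (one_le_div hW).2 h
  rw [lintegral_negLog_of_integrable _ (fun θ => chordal_nonneg _ _) (fun θ => chordal_le_one _ _)
    (hint.congr hcongr), hval, hmax, radialKernel_eq (norm_nonneg a) (norm_pos_iff.2 hw),
    ← ENNReal.ofReal_mul hpi.le, hM, log_norm2_affine hna, log_norm2_affine hna]
  · congr 1
    ring
  · filter_upwards [hae] with θ hθ
    rw [hch]
    have h1 : 0 < ‖circleMap 0 1 θ - b‖ := norm_pos_iff.2 (sub_ne_zero.2 hθ)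
    positivity

section Potential

variable [MeasurableSpace K] [BorelSpace K] {ν : Measure K}

lemma continuous_chordal_ofAffine (z : P1 K) : Continuous fun w : K => chordal z (ofAffine w) := by
  have h : ∀ w : K, chordal z (ofAffine w) =
      ‖wedge z.rep ![w, 1]‖ / (norm2 z.rep * norm2 ![w, 1]) := fun w => chordal_mk_right _ _
  simp only [h]
  have hc : Continuous fun w : K => (![w, 1] : Fin 2 → K) := by fun_prop
  refine Continuous.div ?_ (continuous_const.mul (continuous_norm2.comp hc)) fun w =>
    (mul_pos (norm2_pos z.rep_nonzero) (norm2_pos (affine_ne_zero w))).ne'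
  simp only [wedge]
  fun_prop

/-- The logarithmic potential of the Fubini–Study area element is constant. -/
lemma IsFubiniStudy.lintegral_negLog_chordal (hν : IsFubiniStudy ν) (hna : ¬IsUltrametricDist K)
    (e : K ≃+* ℂ) {s : ℝ} (hs : 0 < s) (he : ∀ x, ‖x‖ = ‖e x‖ ^ s) (z : P1 K) :
    ∫⁻ w, negLog (chordal z (ofAffine w)) ∂ν = ENNReal.ofReal (1 / 2) := by
  have hprob := hν.1
  rcases ofAffine_or_inftyPt z with ⟨a, rfl⟩ | rfl
  · have hpi := Real.two_pi_pos
    let F : K → ℝ≥0∞ := fun w => negLog (chordal (ofAffine a) (ofAffine w))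
    have hF : Measurable F :=
      measurable_negLog.comp (continuous_chordal_ofAffine (ofAffine a)).measurable
    let u : ℝ → K := fun θ => e.symm (circleMap 0 1 θ)
    have hu : Continuous u := (continuous_ringEquiv e hs he).2.comp (continuous_circleMap 0 1)
    have hrot : ∀ θ, ∫⁻ w, F (u θ * w) ∂ν = ∫⁻ w, F w ∂ν := fun θ => by
      have hm : Measurable fun w : K => u θ * w := (continuous_const.mul continuous_id).measurable
      rw [← lintegral_map hF hm, hν.2.1]
      simp only [u]
      rw [he, RingEquiv.apply_symm_apply]
      simp
    have hjoint : Measurable (Function.uncurry fun (θ : ℝ) (w : K) => F (u θ * w)) := by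
      refine hF.comp (Continuous.measurable ?_)
      exact (hu.comp continuous_fst).mul continuous_snd
    have h1 : ENNReal.ofReal (2 * Real.pi) * ∫⁻ w, F w ∂ν =
        ∫⁻ θ in Set.Ioc 0 (2 * Real.pi), ∫⁻ w, F (u θ * w) ∂ν := by
      simp only [hrot, lintegral_const, Measure.restrict_apply MeasurableSet.univ, Set.univ_inter,
        Real.volume_Ioc, sub_zero]
      rw [mul_comm]
    rw [lintegral_lintegral_swap hjoint.aemeasurable] at h1
    have h2 : ∫⁻ w, (∫⁻ θ in Set.Ioc 0 (2 * Real.pi), F (u θ * w)) ∂ν =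
        ∫⁻ w, ENNReal.ofReal (2 * Real.pi) * ENNReal.ofReal
          (radialKernel (‖a‖ ^ 2 / (1 + ‖a‖ ^ 2)) (‖w‖ ^ 2 / (1 + ‖w‖ ^ 2))) ∂ν := by
      refine lintegral_congr_ae ?_
      filter_upwards [hν.ae_ne_zero] with w hw
      exact lintegral_circle_negLog hna e hs he a hw
    rw [h2, lintegral_const_mul' _ _ ENNReal.ofReal_ne_top,
      hν.lintegral_radialKernel (sq_div_one_add_sq_mem _)] at h1
    exact (ENNReal.mul_right_inj (by simpa using Real.pi_pos) ENNReal.ofReal_ne_top).1 h1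
  · rw [← hν.lintegral_radialKernel (A := 1) ⟨zero_le_one, le_rfl⟩]
    refine lintegral_congr fun w => ?_
    have hpos := norm2_pos (affine_ne_zero w)
    rw [chordal_comm, chordal_ofAffine_inftyPt, negLog_of_ne (by positivity), one_div, Real.log_inv,
      neg_neg, log_norm2_affine hna, radialKernel, max_eq_left (sq_div_one_add_sq_mem _).2,
      min_eq_right (sq_div_one_add_sq_mem _).2, Real.log_one]
    congr 1
    have : 1 - ‖w‖ ^ 2 / (1 + ‖w‖ ^ 2) = (1 + ‖w‖ ^ 2)⁻¹ := by
      field_simp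
      ring
    rw [this, Real.log_inv]
    ring

end Potential

end FubiniStudy

section ArchimedeanPotentialTheory

variable [NontriviallyNormedField K] [IsAlgClosed K]

lemma continuous_toBerk_ofAffine : Continuous fun z : K => toBerk (ofAffine z) := by
  simp only [toBerk_ofAffine]
  refine OnePoint.continuous_coe.comp ?_
  rw [continuous_induced_rng, continuous_pi_iff]
  exact fun p => p.continuous.norm

lemma exists_isFubiniStudy (hna : ¬IsUltrametricDist K) (h : canonicalMeasure K ≠ 0) :
    letI : MeasurableSpace K := borel K
    ∃ ν : Measure K, IsFubiniStudy ν ∧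
      canonicalMeasure K = ν.map fun z => toBerk (ofAffine z) := by
  let _ : MeasurableSpace K := borel K
  by_cases hex : ∃ ν : Measure K, IsFubiniStudy ν
  · refine ⟨hex.choose, hex.choose_spec, ?_⟩
    rw [canonicalMeasure, dif_neg hna, dif_pos hex]
    simp only [toBerk_ofAffine]
  · refine absurd ?_ h
    rw [canonicalMeasure, dif_neg hna, dif_neg hex]

lemma hasPotentialTheory_of_archimedean (hna : ¬IsUltrametricDist K) (e : K ≃+* ℂ) {s : ℝ}
    (hs : 0 < s) (he : ∀ x, ‖x‖ = ‖e x‖ ^ s) (hΩ : canonicalMeasure K ≠ 0) :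
    HasPotentialTheory K (1 / 2) := by
  have : ∀ x : BerkP1 K, (trace x).NeBot := trace_neBot_of_ringEquiv e hs he
  let _ : MeasurableSpace K := borel K
  have : BorelSpace K := ⟨rfl⟩
  obtain ⟨hec, hec'⟩ := continuous_ringEquiv e hs he
  have : SecondCountableTopology K :=
    (Homeomorph.mk e.toEquiv hec hec').isInducing.secondCountableTopology
  obtain ⟨ν, hν, hΩν⟩ := exists_isFubiniStudy hna hΩ
  have hprob := hν.1
  have hm : Measurable fun z : K => toBerk (ofAffine z) := continuous_toBerk_ofAffine.measurable
  have hΩ1 : IsProbabilityMeasure (canonicalMeasure K) := by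
    rw [hΩν]
    exact Measure.isProbabilityMeasure_map hm.aemeasurable
  refine ⟨by norm_num, fun x => ?_, fun μ ν _ _ _ _ => archimedean_energy_le hna e hs he hec μ ν, ?_⟩
  · obtain ⟨z, rfl⟩ := exists_toBerk_eq e hs he x
    rw [hΩν, lintegral_map (measurable_negLogHsia _) hm]
    simp only [negLogHsia_eq, hsia_toBerk]
    exact hν.lintegral_negLog_chordal hna e hs he z
  · intro μ ψ V g κ hμ hg hV hg0 hint
    have hVz : ∀ w z, V w (toBerk z) = chordal (ψ z) w := fun w z =>
      eq_of_tendsto_trace_toBerk (φ := fun z => chordal (ψ z) w) (hV w (toBerk z))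
    have hjoint : Measurable (Function.uncurry fun (w : K) (x : BerkP1 K) => V (ofAffine w) x) := by
      refine measurable_uncurry_of_continuous_of_measurable (fun x => ?_) fun w =>
        (continuous_of_tendsto_trace (hV (ofAffine w))).measurable
      obtain ⟨z, rfl⟩ := exists_toBerk_eq e hs he x
      simp only [hVz]
      exact continuous_chordal_ofAffine (ψ z)
    have hswap := lintegral_lintegral_swap (μ := ν) (ν := μ)
      (f := fun w x => negLog (V (ofAffine w) x)) (measurable_negLog.comp hjoint).aemeasurable
    have hinner : ∀ x, ∫⁻ w, negLog (V (ofAffine w) x) ∂ν = ENNReal.ofReal (1 / 2) := fun x => by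
      obtain ⟨z, rfl⟩ := exists_toBerk_eq e hs he x
      simp only [hVz]
      exact hν.lintegral_negLog_chordal hna e hs he (ψ z)
    have hgi : Integrable g (canonicalMeasure K) := integrable_of_continuous hg _
    have hcomp : Integrable (fun w : K => g (toBerk (ofAffine w))) ν := by
      rw [hΩν] at hgi
      exact hgi.comp_measurable hm
    have hgint : ∫ x, g x ∂(canonicalMeasure K) = ∫ w, g (toBerk (ofAffine w)) ∂ν := by
      rw [hΩν, integral_map hm.aemeasurable hg.measurable.aestronglyMeasurable]
    have hneg : Integrable (fun w : K => -(g (toBerk (ofAffine w)) + κ)) ν :=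
      (hcomp.add (integrable_const κ)).neg
    have hnn : ∀ w : K, 0 ≤ -(g (toBerk (ofAffine w)) + κ) := fun w => neg_nonneg.2 (hg0 _)
    simp only [hint, hinner] at hswap
    rw [← ofReal_integral_eq_lintegral_ofReal hneg (Eventually.of_forall hnn), lintegral_const,
      measure_univ, mul_one, ENNReal.ofReal_eq_ofReal_iff (integral_nonneg hnn) (by norm_num),
      integral_neg, integral_add hcomp (integrable_const κ), integral_const, probReal_univ,
      one_smul] at hswap
    rw [hgint]
    linarith

end ArchimedeanPotentialTheory

end BerkovichLine

end

/-- Let `K` be an algebraically closed field of characteristic `0`, complete with respect to a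
non-trivial absolute value, `f ∈ K(z)` of degree `d > 1`, `F` a non-degenerate homogeneous lift of
`f` with `g_F = g_f`, and `C_j ∈ K² \ {0}`, `1 ≤ j ≤ 2d - 2`, with `det DF = ∏_j (· ∧ C_j)`. Then
`log f^#` is `μ_f`-integrable and `L(f) = - log |d| + ∑_j (g_f(π(C_j)) + log ‖C_j‖)`. -/
theorem lyapunov_critical_point_formula {K : Type*} [NontriviallyNormedField K] [IsAlgClosed K]
    [CharZero K] [CompleteSpace K] (f : RatFunc K) (hd : 1 < BerkovichLine.ratDegree f)
    (gf : BerkovichLine.BerkP1 K → ℝ) (hgf : BerkovichLine.IsDynamicalGreenFunction f gf)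
    (F : BerkovichLine.HomogeneousLift f) (hF : F.green = gf)
    (C : Fin (2 * BerkovichLine.ratDegree f - 2) → (Fin 2 → K)) (hC : ∀ j, C j ≠ 0)
    (hdet : ∀ v : Fin 2 → K, F.jacobianDet v = ∏ j, BerkovichLine.wedge v (C j)) :
    MeasureTheory.Integrable (fun x => Real.log (BerkovichLine.chordalDerivBerk f x))
        (BerkovichLine.equilibriumMeasure f) ∧
      BerkovichLine.lyapunov f = -Real.log ‖(BerkovichLine.ratDegree f : K)‖ +
        ∑ j, (gf (BerkovichLine.toBerk (Projectivization.mk K (C j) (hC j))) +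
          Real.log (BerkovichLine.norm2 (C j))) := by
  subst hF
  by_cases hK : IsUltrametricDist K
  · exact BerkovichLine.lyapunov_eq_of_hasPotentialTheory
      BerkovichLine.hasPotentialTheory_of_ultrametric f hd F hgf C hC hdet
  · obtain ⟨e, s, hs, he⟩ := BerkovichLine.exists_ringEquiv_complex hK
    have hΩ : BerkovichLine.canonicalMeasure K ≠ 0 := by
      intro h
      obtain ⟨-, hprob, -, hmass, -⟩ := hgf.1
      rw [h, MeasureTheory.measure_univ] at hmass
      exact one_ne_zero hmass
    have := BerkovichLine.trace_neBot_of_ringEquiv e hs he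
    exact BerkovichLine.lyapunov_eq_of_hasPotentialTheory
      (BerkovichLine.hasPotentialTheory_of_archimedean hK e hs he hΩ) f hd F hgf C hC hdet
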